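/- Under the AMP setup, for fixed 0 < s < t the within-window false discovery proportion converges in probability: FDP([s,t]) := |{i : s ≤ β̂_i ≤ t, β_i = 0}| / |{i : s ≤ β̂_i ≤ t}| → P(Π = 0 | s ≤ η_{ατ}(Π + τZ) ≤ t) as p → ∞. Moreover, if q₀ and q are continuous at t with q(t) > 0, then as s → t⁻ this limit converges to lfdr(t) = (1−ε)f₀(t)/f(t); that is, lim_{s→t⁻} lim_{p→∞} FDP([s,t]) = lfdr(t). -/

import Mathlib

open MeasureTheory ProbabilityTheory Filter Set
open scoped Classical ENNReal NNReal Topology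

noncomputable section

/-- Standard normal p.d.f. `φ`. -/
def stdPhi (x : ℝ) : ℝ := (Real.sqrt (2 * Real.pi))⁻¹ * Real.exp (-(x ^ 2) / 2)

/-- Standard normal c.d.f. `Φ`. -/
def stdPhiCDF (x : ℝ) : ℝ := ((gaussianReal 0 1) (Set.Iic x)).toReal

/-- Soft-thresholding operator `η_θ(x) = sign(x)(|x| - θ)₊`. -/
def softThr (θ x : ℝ) : ℝ := Real.sign x * max (|x| - θ) 0

/-- The two-groups prior `Π = (1-ε)δ₀ + εΠ₁`. -/
def mixture (eps : ℝ) (Pi1 : Measure ℝ) : Measure ℝ :=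
  ENNReal.ofReal (1 - eps) • Measure.dirac 0 + ENNReal.ofReal eps • Pi1

instance (eps : ℝ) (Pi1 : Measure ℝ) [IsFiniteMeasure Pi1] :
    IsFiniteMeasure (mixture eps Pi1) := by
  constructor
  simp only [mixture, Measure.add_apply, Measure.smul_apply, smul_eq_mul]
  exact ENNReal.add_lt_top.2
    ⟨ENNReal.mul_lt_top ENNReal.ofReal_lt_top (measure_lt_top _ _),
      ENNReal.mul_lt_top ENNReal.ofReal_lt_top (measure_lt_top _ _)⟩

/-- The limiting law of the Lasso estimates, i.e. the law of `η_{ατ}(Π + τZ)`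
where `Π ~ mixture eps Pi1` and `Z ~ N(0,1)` are independent. -/
def limitLaw (eps : ℝ) (Pi1 : Measure ℝ) (α τ : ℝ) : Measure ℝ :=
  Measure.map (fun w : ℝ × ℝ => softThr (α * τ) (w.1 + τ * w.2))
    ((mixture eps Pi1).prod (gaussianReal 0 1))

/-- The (unnormalized) density `q₀` of the nonzero part of the null component:
`q₀(x) = τ⁻¹ φ((x + ατ sign x)/τ)` for `x ≠ 0`. -/
def q0fun (α τ x : ℝ) : ℝ := τ⁻¹ * stdPhi ((x + α * τ * Real.sign x) / τ)

end

/-- The standard Gaussian measure on `ℝ^K`. -/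
noncomputable abbrev stdGauss (K : Type*) [Fintype K] : Measure (K → ℝ) :=
  Measure.pi fun _ : K => gaussianReal 0 1

lemma hasDerivAt_gaussianPDFReal (x : ℝ) :
    HasDerivAt (gaussianPDFReal 0 1) (-x * gaussianPDFReal 0 1 x) x := by
  have h1 : HasDerivAt (fun y : ℝ => -(y - 0) ^ 2 / (2 * ((1 : ℝ≥0) : ℝ))) (-x) x := by
    have := (((hasDerivAt_id x).sub_const 0).pow 2).neg.div_const (2 * ((1 : ℝ≥0) : ℝ))
    refine this.congr_deriv ?_
    norm_num
    ring
  have h2 := (h1.exp).const_mul (√(2 * Real.pi * ((1 : ℝ≥0) : ℝ)))⁻¹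
  have : gaussianPDFReal 0 1 = fun y => (√(2 * Real.pi * ((1 : ℝ≥0) : ℝ)))⁻¹ *
      Real.exp (-(y - 0) ^ 2 / (2 * ((1 : ℝ≥0) : ℝ))) := by
    rw [gaussianPDFReal_def]
  rw [this]
  refine h2.congr_deriv ?_
  ring

lemma integrable_mul_bounded_gaussian {f : ℝ → ℝ} (hf : Measurable f) {C : ℝ}
    (hC : ∀ x, |f x| ≤ C) : Integrable (fun x => x * f x) (gaussianReal 0 1) := by
  have h1 : Integrable (fun x : ℝ => x) (gaussianReal 0 1) :=
    (memLp_id_gaussianReal (μ := 0) (v := 1) 1).integrable le_rfl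
  have := h1.bdd_mul (c := C) (f := f) hf.aestronglyMeasurable
    (Eventually.of_forall fun x => by simpa using hC x)
  refine this.congr (Eventually.of_forall fun x => ?_)
  simp [mul_comm]

lemma gaussian_stein {f f' : ℝ → ℝ} (hf : ∀ x, HasDerivAt f (f' x) x) {C : ℝ}
    (hC : ∀ x, |f x| ≤ C) (hC' : ∀ x, |f' x| ≤ C) :
    ∫ x, x * f x ∂gaussianReal 0 1 = ∫ x, f' x ∂gaussianReal 0 1 := by
  have hfm : Measurable f :=
    (continuous_iff_continuousAt.2 fun x => (hf x).continuousAt).measurable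
  have hf'm : Measurable f' := by
    have : f' = deriv f := funext fun x => (hf x).deriv.symm
    rw [this]; exact measurable_deriv f
  have key : ∀ {g : ℝ → ℝ}, Integrable g (gaussianReal 0 1) →
      Integrable (fun x => g x * gaussianPDFReal 0 1 x) := by
    intro g hg
    rw [gaussianReal_of_var_ne_zero 0 one_ne_zero] at hg
    rw [integrable_withDensity_iff (measurable_gaussianPDF 0 1)
      (Eventually.of_forall fun x => gaussianPDF_lt_top)] at hg
    simpa [toReal_gaussianPDF] using hg
  have i1 := integrable_mul_bounded_gaussian hfm hC
  have i0 : Integrable f (gaussianReal 0 1) :=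
    Integrable.of_bound hfm.aestronglyMeasurable C (Eventually.of_forall fun x => by simpa using hC x)
  have i2 : Integrable f' (gaussianReal 0 1) :=
    Integrable.of_bound hf'm.aestronglyMeasurable C (Eventually.of_forall fun x => by simpa using hC' x)
  have := integral_mul_deriv_eq_deriv_mul_of_integrable (u := f) (u' := f')
    (v := gaussianPDFReal 0 1) (v' := fun x => -x * gaussianPDFReal 0 1 x)
    (fun x _ => hf x) (fun x _ => hasDerivAt_gaussianPDFReal x)
    (by
      refine (key i1).neg.congr (Eventually.of_forall fun x => ?_)
      simp; ring)
    (key i2) (key i0)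
  rw [integral_gaussianReal_eq_integral_smul one_ne_zero,
    integral_gaussianReal_eq_integral_smul one_ne_zero]
  calc ∫ x, gaussianPDFReal 0 1 x • (x * f x)
      = -∫ x, f x * (-x * gaussianPDFReal 0 1 x) := by
        rw [← integral_neg]; congr 1; ext x; simp; ring
    _ = ∫ x, f' x * gaussianPDFReal 0 1 x := by rw [this, neg_neg]
    _ = _ := by congr 1; ext x; simp; ring

lemma stdGauss_map_update {K : Type*} [Fintype K] (k : K) :
    ((stdGauss K).prod (gaussianReal 0 1)).map (fun w => Function.update w.1 k w.2)
      = stdGauss K := by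
  have hm : Measurable fun w : (K → ℝ) × ℝ => Function.update w.1 k w.2 := by
    refine measurable_pi_iff.2 fun i => ?_
    by_cases h : i = k
    · subst h; simpa using measurable_snd
    · simp only [Function.update_of_ne h]; fun_prop
  refine (Measure.pi_eq fun s hs => ?_).symm
  rw [Measure.map_apply hm (MeasurableSet.univ_pi hs)]
  have : (fun w : (K → ℝ) × ℝ => Function.update w.1 k w.2) ⁻¹' Set.pi univ s
      = (Set.pi univ (Function.update s k univ)) ×ˢ (s k) := by
    ext w
    simp only [mem_preimage, Set.mem_pi, mem_univ, true_imp_iff, mem_prod]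
    constructor
    · intro h
      refine ⟨fun i => ?_, by simpa using h k⟩
      by_cases hi : i = k
      · subst hi; simp
      · simpa [Function.update_of_ne hi] using h i
    · rintro ⟨h, h'⟩ i
      by_cases hi : i = k
      · subst hi; simpa using h'
      · simpa [Function.update_of_ne hi] using h i
  rw [this, Measure.prod_prod, Measure.pi_pi, ← Finset.prod_erase_mul _ _ (Finset.mem_univ k),
    ← Finset.prod_erase_mul _ (fun i => gaussianReal 0 1 (s i)) (Finset.mem_univ k)]
  simp only [Function.update_self, measure_univ, mul_one]
  congr 1
  refine Finset.prod_congr rfl fun i hi => ?_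
  rw [Function.update_of_ne (Finset.ne_of_mem_erase hi)]

lemma integral_stdGauss_update {K : Type*} [Fintype K] (k : K) {F : (K → ℝ) → ℝ}
    (hF : Integrable F (stdGauss K)) :
    ∫ ξ, F ξ ∂stdGauss K
      = ∫ ξ, ∫ x, F (Function.update ξ k x) ∂gaussianReal 0 1 ∂stdGauss K := by
  have hm : Measurable fun w : (K → ℝ) × ℝ => Function.update w.1 k w.2 := by
    refine measurable_pi_iff.2 fun i => ?_
    by_cases h : i = k
    · subst h; simpa using measurable_snd
    · simp only [Function.update_of_ne h]; fun_prop
  have hF' : Integrable F (((stdGauss K).prod (gaussianReal 0 1)).map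
      (fun w => Function.update w.1 k w.2)) := by rwa [stdGauss_map_update]
  conv_lhs => rw [← stdGauss_map_update k]
  rw [integral_map hm.aemeasurable hF'.aestronglyMeasurable, integral_prod]
  exact hF'.comp_measurable hm

lemma stdGauss_integrable_eval {K : Type*} [Fintype K] (k : K) :
    Integrable (fun ξ : K → ℝ => ξ k) (stdGauss K) := by
  have h1 : Integrable (fun x : ℝ => x) (gaussianReal 0 1) :=
    (memLp_id_gaussianReal (μ := 0) (v := 1) 1).integrable le_rfl
  exact (measurePreserving_eval (fun _ : K => gaussianReal 0 1) k).integrable_comp_of_integrable h1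

lemma stdGauss_stein {K : Type*} [Fintype K] (k : K) {H H' : (K → ℝ) → ℝ}
    (hH : ∀ ξ, HasDerivAt (fun t => H (Function.update ξ k t)) (H' ξ) (ξ k))
    (hm : Measurable H) (hm' : Measurable H') {C : ℝ}
    (hC : ∀ ξ, |H ξ| ≤ C) (hC' : ∀ ξ, |H' ξ| ≤ C) :
    ∫ ξ, ξ k * H ξ ∂stdGauss K = ∫ ξ, H' ξ ∂stdGauss K := by
  have i1 : Integrable (fun ξ : K → ℝ => ξ k * H ξ) (stdGauss K) := by
    refine ((stdGauss_integrable_eval k).bdd_mul (c := C) (f := H) hm.aestronglyMeasurable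
      (Eventually.of_forall fun x => by simpa using hC x)).congr
      (Eventually.of_forall fun x => by simp [mul_comm])
  have i2 : Integrable H' (stdGauss K) :=
    Integrable.of_bound hm'.aestronglyMeasurable C
      (Eventually.of_forall fun x => by simpa using hC' x)
  rw [integral_stdGauss_update k i1, integral_stdGauss_update k i2]
  congr 1
  ext ξ
  simp only [Function.update_self]
  refine gaussian_stein (f := fun x => H (Function.update ξ k x))
    (f' := fun x => H' (Function.update ξ k x)) (C := C) (fun x => ?_)
    (fun x => hC _) (fun x => hC' _)
  simpa using hH (Function.update ξ k x)

lemma clm_pi_apply_eq_sum {X : Type*} [Fintype X] {E : Type*} [NormedAddCommGroup E]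
    [NormedSpace ℝ E] (T : (X → ℝ) →L[ℝ] E) (v : X → ℝ) :
    T v = ∑ x, v x • T (Pi.single x 1) := by
  conv_lhs => rw [pi_eq_sum_univ' v]
  rw [map_sum]
  refine Finset.sum_congr rfl fun x _ => ?_
  rw [map_smul]

lemma stdGauss_stein_affine {X K : Type*} [Fintype X] [Fintype K] (L : X → K → ℝ) (ψ : X → ℝ)
    {G : (X → ℝ) → ℝ} (hG : ContDiff ℝ 2 G) {C : ℝ}
    (hC1 : ∀ v, ‖fderiv ℝ G v‖ ≤ C) (hC2 : ∀ v, ‖fderiv ℝ (fderiv ℝ G) v‖ ≤ C) (x : X) (k : K) :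
    ∫ ξ, ξ k * fderiv ℝ G (fun y => ∑ l, L y l * ξ l + ψ y) (Pi.single x 1) ∂stdGauss K
      = ∑ y, L y k * ∫ ξ, fderiv ℝ (fderiv ℝ G) (fun y => ∑ l, L y l * ξ l + ψ y)
          (Pi.single y 1) (Pi.single x 1) ∂stdGauss K := by
  have hC0 : 0 ≤ C := (norm_nonneg _).trans (hC1 0)
  have hF : Continuous fun ξ : K → ℝ => (fun y => ∑ l, L y l * ξ l + ψ y) := by fun_prop
  have hG1 : ContDiff ℝ 1 (fderiv ℝ G) := hG.fderiv_right (by norm_num)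
  have c1 : Continuous (fderiv ℝ G) := hG1.continuous
  have c2 : Continuous (fderiv ℝ (fderiv ℝ G)) := hG1.continuous_fderiv (by norm_num)
  have e1 : ‖(Pi.single x 1 : X → ℝ)‖ ≤ 1 := by simp [Pi.norm_single]
  have h := stdGauss_stein (K := K) k
    (H := fun ξ => fderiv ℝ G (fun y => ∑ l, L y l * ξ l + ψ y) (Pi.single x 1))
    (H' := fun ξ => fderiv ℝ (fderiv ℝ G) (fun y => ∑ l, L y l * ξ l + ψ y)
      (fun y => L y k) (Pi.single x 1)) ?_ ?_ ?_
      (C := C + C * ‖fun y => L y k‖) ?_ ?_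
  · rw [h]
    simp_rw [clm_pi_apply_eq_sum (fderiv ℝ (fderiv ℝ G) _) (fun y => L y k)]
    simp only [_root_.sum_apply, _root_.smul_apply, smul_eq_mul]
    rw [integral_finsetSum]
    · simp_rw [integral_const_mul]
    · intro y _
      refine Integrable.const_mul ?_ _
      refine Integrable.of_bound (C := C) ?_ ?_
      · exact (((c2.comp hF).clm_apply continuous_const).clm_apply
          continuous_const).aestronglyMeasurable
      · refine Eventually.of_forall fun ξ => ?_
        have e2 : ‖(Pi.single y 1 : X → ℝ)‖ ≤ 1 := by simp [Pi.norm_single]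
        refine (ContinuousLinearMap.le_opNorm₂ _ _ _).trans ?_
        calc _ ≤ C * 1 * 1 := by gcongr; exact hC2 _
          _ = C := by ring
  · intro ξ
    have hγ : HasDerivAt (fun t => (fun y => ∑ l, L y l * (Function.update ξ k t) l + ψ y))
        (fun y => L y k) (ξ k) := by
      refine hasDerivAt_pi.2 fun y => ?_
      have : (fun t => ∑ l, L y l * (Function.update ξ k t) l + ψ y)
          = fun t => L y k * t + (∑ l ∈ Finset.univ.erase k, L y l * ξ l + ψ y) := by
        ext t
        rw [← Finset.add_sum_erase _ _ (Finset.mem_univ k), Function.update_self, add_assoc]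
        congr 2
        refine Finset.sum_congr rfl fun l hl => ?_
        rw [Function.update_of_ne (Finset.ne_of_mem_erase hl)]
      rw [this]
      simpa using ((hasDerivAt_id (ξ k)).const_mul (L y k)).add_const
        (∑ l ∈ Finset.univ.erase k, L y l * ξ l + ψ y)
    have hd : HasFDerivAt (fderiv ℝ G) (fderiv ℝ (fderiv ℝ G) (fun y => ∑ l, L y l * ξ l + ψ y))
        ((fun t => (fun y => ∑ l, L y l * (Function.update ξ k t) l + ψ y)) (ξ k)) := by
      simp only [Function.update_eq_self]
      exact (hG1.differentiable (by norm_num) _).hasFDerivAt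
    have h3 := hd.comp_hasDerivAt (ξ k) hγ
    exact (ContinuousLinearMap.apply ℝ ℝ
      (Pi.single x 1 : X → ℝ)).hasFDerivAt.comp_hasDerivAt (ξ k) h3
  · exact ((c1.comp hF).clm_apply continuous_const).measurable
  · exact (((c2.comp hF).clm_apply continuous_const).clm_apply continuous_const).measurable
  · intro ξ
    rw [← Real.norm_eq_abs]
    refine (ContinuousLinearMap.le_opNorm _ _).trans ?_
    calc _ ≤ C * 1 := by gcongr; exact hC1 _
      _ ≤ _ := by have := mul_nonneg hC0 (norm_nonneg fun y => L y k); linarith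
  · intro ξ
    rw [← Real.norm_eq_abs]
    refine (ContinuousLinearMap.le_opNorm₂ _ _ _).trans ?_
    calc _ ≤ C * ‖fun y => L y k‖ * 1 := by gcongr; exact hC2 _
      _ ≤ _ := by linarith

lemma gaussian_comparison {X K : Type*} [Fintype X] [Fintype K] (a b : X → K → ℝ) (ψ : X → ℝ)
    {G : (X → ℝ) → ℝ} (hG : ContDiff ℝ 2 G) {C : ℝ} (hC : ∀ v, |G v| ≤ C)
    (hC1 : ∀ v, ‖fderiv ℝ G v‖ ≤ C) (hC2 : ∀ v, ‖fderiv ℝ (fderiv ℝ G) v‖ ≤ C)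
    (hort : ∀ x y, ∑ k, a x k * b y k = 0)
    (hsign : ∀ v x y, 0 ≤ (∑ k, a x k * a y k - ∑ k, b x k * b y k) *
      fderiv ℝ (fderiv ℝ G) v (Pi.single y 1) (Pi.single x 1)) :
    ∫ ξ, G (fun x => ∑ k, b x k * ξ k + ψ x) ∂stdGauss K
      ≤ ∫ ξ, G (fun x => ∑ k, a x k * ξ k + ψ x) ∂stdGauss K := by
  set L : ℝ → X → K → ℝ := fun θ x k => Real.sin θ * a x k + Real.cos θ * b x k with hL
  set L' : ℝ → X → K → ℝ := fun θ x k => Real.cos θ * a x k - Real.sin θ * b x k with hL'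
  set F : ℝ → (K → ℝ) → X → ℝ := fun θ ξ x => ∑ k, L θ x k * ξ k + ψ x with hF
  set F' : ℝ → (K → ℝ) → X → ℝ := fun θ ξ x => ∑ k, L' θ x k * ξ k with hF'
  have hC0 : 0 ≤ C := (abs_nonneg _).trans (hC 0)
  have hG1 : ContDiff ℝ 1 (fderiv ℝ G) := hG.fderiv_right (by norm_num)
  have c0 : Continuous G := hG.continuous
  have c1 : Continuous (fderiv ℝ G) := hG1.continuous
  have c2 : Continuous (fderiv ℝ (fderiv ℝ G)) := hG1.continuous_fderiv (by norm_num)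
  have cF : ∀ θ, Continuous (F θ) := fun θ => by simp only [hF]; fun_prop
  have cF' : ∀ θ, Continuous (F' θ) := fun θ => by simp only [hF']; fun_prop
  have hbd : ∀ θ ξ, ‖F' θ ξ‖ ≤ ∑ x, ∑ k, (|a x k| + |b x k|) * |ξ k| := by
    intro θ ξ
    have hnn : ∀ x, 0 ≤ ∑ k, (|a x k| + |b x k|) * |ξ k| :=
      fun x => Finset.sum_nonneg fun k _ => by positivity
    refine (pi_norm_le_iff_of_nonneg (Finset.sum_nonneg fun x _ => hnn x)).2 fun x => ?_
    refine le_trans ?_ (Finset.single_le_sum (fun x _ => hnn x) (Finset.mem_univ x))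
    refine (norm_sum_le _ _).trans (Finset.sum_le_sum fun k _ => ?_)
    rw [norm_mul, Real.norm_eq_abs, Real.norm_eq_abs]
    gcongr
    refine (abs_sub _ _).trans ?_
    rw [abs_mul, abs_mul]
    have h1 := Real.abs_cos_le_one θ
    have h2 := Real.abs_sin_le_one θ
    nlinarith [abs_nonneg (a x k), abs_nonneg (b x k)]
  have h_integrable : ∀ θ, Integrable (fun ξ => G (F θ ξ)) (stdGauss K) := fun θ =>
    Integrable.of_bound (c0.comp (cF θ)).aestronglyMeasurable C (Eventually.of_forall fun ξ => hC _)
  have hderiv : ∀ θ, HasDerivAt (fun θ => ∫ ξ, G (F θ ξ) ∂stdGauss K)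
      (∫ ξ, fderiv ℝ G (F θ ξ) (F' θ ξ) ∂stdGauss K) θ := by
    intro θ
    refine (hasDerivAt_integral_of_dominated_loc_of_deriv_le (μ := stdGauss K)
      (s := univ) (F := fun θ ξ => G (F θ ξ)) (F' := fun θ ξ => fderiv ℝ G (F θ ξ) (F' θ ξ))
      (bound := fun ξ => C * ∑ x, ∑ k, (|a x k| + |b x k|) * |ξ k|)
      univ_mem ?_ (h_integrable θ) ?_ ?_ ?_ ?_).2
    · exact Eventually.of_forall fun θ => (c0.comp (cF θ)).aestronglyMeasurable
    · exact ((c1.comp (cF θ)).clm_apply (cF' θ)).aestronglyMeasurable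
    · refine Eventually.of_forall fun ξ θ _ => ?_
      refine (ContinuousLinearMap.le_opNorm _ _).trans ?_
      gcongr
      · exact hC1 _
      · exact hbd _ _
    · refine Integrable.const_mul ?_ _
      refine integrable_finsetSum _ fun x _ => integrable_finsetSum _ fun k _ => ?_
      exact ((stdGauss_integrable_eval k).abs).const_mul _
    · refine Eventually.of_forall fun ξ θ _ => ?_
      have hγ : HasDerivAt (fun θ => F θ ξ) (F' θ ξ) θ := by
        refine hasDerivAt_pi.2 fun x => ?_
        have : HasDerivAt (fun θ => ∑ k, L θ x k * ξ k) (∑ k, L' θ x k * ξ k) θ := by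
          refine HasDerivAt.fun_sum fun k _ => ?_
          refine HasDerivAt.mul_const ?_ _
          have := ((Real.hasDerivAt_sin θ).mul_const (a x k)).add
            ((Real.hasDerivAt_cos θ).mul_const (b x k))
          refine this.congr_deriv ?_
          simp only [hL']; ring
        exact this.add_const _
      exact ((hG.differentiable (by norm_num) _).hasFDerivAt).comp_hasDerivAt θ hγ
  have hval : ∀ θ, ∫ ξ, fderiv ℝ G (F θ ξ) (F' θ ξ) ∂stdGauss K
      = Real.sin θ * Real.cos θ * ∑ x, ∑ y, (∑ k, a x k * a y k - ∑ k, b x k * b y k) *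
        ∫ ξ, fderiv ℝ (fderiv ℝ G) (F θ ξ) (Pi.single y 1) (Pi.single x 1) ∂stdGauss K := by
    intro θ
    have e1 : ∀ ξ, fderiv ℝ G (F θ ξ) (F' θ ξ)
        = ∑ x, ∑ k, L' θ x k * (ξ k * fderiv ℝ G (F θ ξ) (Pi.single x 1)) := by
      intro ξ
      rw [clm_pi_apply_eq_sum (fderiv ℝ G (F θ ξ)) (F' θ ξ)]
      refine Finset.sum_congr rfl fun x _ => ?_
      simp only [hF', smul_eq_mul, Finset.sum_mul]
      exact Finset.sum_congr rfl fun k _ => by ring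
    have i1 : ∀ x k, Integrable (fun ξ => ξ k * fderiv ℝ G (F θ ξ) (Pi.single x 1))
        (stdGauss K) := by
      intro x k
      refine ((stdGauss_integrable_eval k).bdd_mul (c := C)
        (f := fun ξ => fderiv ℝ G (F θ ξ) (Pi.single x 1))
        ((c1.comp (cF θ)).clm_apply continuous_const).aestronglyMeasurable
        (Eventually.of_forall fun ξ => ?_)).congr (Eventually.of_forall fun ξ => by simp [mul_comm])
      refine (ContinuousLinearMap.le_opNorm _ _).trans ?_
      have e1 : ‖(Pi.single x 1 : X → ℝ)‖ ≤ 1 := by simp [Pi.norm_single]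
      calc _ ≤ C * 1 := by gcongr; exact hC1 _
        _ = C := mul_one C
    simp_rw [e1]
    rw [integral_finsetSum _ fun x _ => integrable_finsetSum _ fun k _ => (i1 x k).const_mul _]
    rw [Finset.mul_sum]
    refine Finset.sum_congr rfl fun x _ => ?_
    rw [integral_finsetSum _ fun k _ => (i1 x k).const_mul _]
    simp_rw [integral_const_mul]
    have e2 : ∀ k, ∫ ξ, ξ k * fderiv ℝ G (F θ ξ) (Pi.single x 1) ∂stdGauss K
      = ∑ y, L θ y k * ∫ ξ, fderiv ℝ (fderiv ℝ G) (F θ ξ)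
          (Pi.single y 1) (Pi.single x 1) ∂stdGauss K :=
      fun k => stdGauss_stein_affine (L θ) ψ hG hC1 hC2 x k
    simp_rw [e2, Finset.mul_sum]
    rw [Finset.sum_comm]
    refine Finset.sum_congr rfl fun y _ => ?_
    simp_rw [← mul_assoc]
    rw [← Finset.sum_mul]
    congr 1
    have e3 : ∀ k, L' θ x k * L θ y k = Real.sin θ * Real.cos θ * (a x k * a y k)
        - Real.sin θ * Real.cos θ * (b x k * b y k)
        + Real.cos θ ^ 2 * (a x k * b y k) - Real.sin θ ^ 2 * (a y k * b x k) := by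
      intro k; simp only [hL, hL']; ring
    simp_rw [e3, Finset.sum_sub_distrib, Finset.sum_add_distrib, Finset.sum_sub_distrib,
      ← Finset.mul_sum, hort]
    ring
  have hmono : MonotoneOn (fun θ => ∫ ξ, G (F θ ξ) ∂stdGauss K) (Icc 0 (Real.pi / 2)) := by
    refine monotoneOn_of_deriv_nonneg (convex_Icc _ _)
      (fun θ _ => (hderiv θ).continuousAt.continuousWithinAt)
      (fun θ _ => (hderiv θ).differentiableAt.differentiableWithinAt) fun θ hθ => ?_
    rw [interior_Icc] at hθ
    rw [(hderiv θ).deriv, hval θ]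
    have h1 : 0 ≤ Real.sin θ := Real.sin_nonneg_of_nonneg_of_le_pi hθ.1.le (by linarith [hθ.2, Real.pi_pos])
    have h2 : 0 ≤ Real.cos θ := Real.cos_nonneg_of_neg_pi_div_two_le_of_le
      (by linarith [hθ.1, Real.pi_pos]) hθ.2.le
    refine mul_nonneg (mul_nonneg h1 h2) (Finset.sum_nonneg fun x _ => Finset.sum_nonneg fun y _ => ?_)
    rw [← integral_const_mul]
    exact integral_nonneg fun ξ => hsign _ x y
  have hpi : (0 : ℝ) ≤ Real.pi / 2 := by positivity
  have := hmono (left_mem_Icc.2 hpi) (right_mem_Icc.2 hpi) hpi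
  simpa [hF, hL] using this

/-- A `C²` function which is bounded together with its derivatives of order at most two. -/
def BddC2 {E : Type*} [NormedAddCommGroup E] [NormedSpace ℝ E] (f : E → ℝ) : Prop :=
  ContDiff ℝ 2 f ∧ ∃ C : ℝ, ∀ k : ℕ, k ≤ 2 → ∀ v, ‖iteratedFDeriv ℝ k f v‖ ≤ C

namespace BddC2

variable {E F : Type*} [NormedAddCommGroup E] [NormedSpace ℝ E]
  [NormedAddCommGroup F] [NormedSpace ℝ F]

lemma const (c : ℝ) : BddC2 (fun _ : E => c) := by
  refine ⟨contDiff_const, |c|, fun k _ v => ?_⟩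
  rcases Nat.eq_zero_or_pos k with rfl | hk
  · simp
  · rw [iteratedFDeriv_const_of_ne hk.ne']; simp

lemma sub {f g : E → ℝ} (hf : BddC2 f) (hg : BddC2 g) : BddC2 (fun v => f v - g v) := by
  obtain ⟨hf, C, hC⟩ := hf
  obtain ⟨hg, D, hD⟩ := hg
  refine ⟨hf.sub hg, C + D, fun k hk v => ?_⟩
  have hk' : (k : WithTop ℕ∞) ≤ 2 := by exact_mod_cast hk
  have := iteratedFDeriv_sub_apply (𝕜 := ℝ) (i := k) (f := f) (g := g) (x := v)
    (hf.of_le hk').contDiffAt (hg.of_le hk').contDiffAt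
  have h2 : (fun v => f v - g v) = f - g := rfl
  rw [h2, this]
  exact (norm_sub_le _ _).trans (add_le_add (hC k hk v) (hD k hk v))

lemma mul {f g : E → ℝ} (hf : BddC2 f) (hg : BddC2 g) : BddC2 (fun v => f v * g v) := by
  obtain ⟨hf, C, hC⟩ := hf
  obtain ⟨hg, D, hD⟩ := hg
  have hC0 : 0 ≤ C := (norm_nonneg _).trans (hC 0 (by norm_num) 0)
  have hD0 : 0 ≤ D := (norm_nonneg _).trans (hD 0 (by norm_num) 0)
  refine ⟨hf.mul hg, 4 * (C * D), fun k hk v => ?_⟩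
  have hk' : (k : WithTop ℕ∞) ≤ 2 := by exact_mod_cast hk
  refine (norm_iteratedFDeriv_mul_le hf hg v hk').trans ?_
  calc _ ≤ ∑ i ∈ Finset.range (k + 1), (k.choose i : ℝ) * (C * D) := by
        refine Finset.sum_le_sum fun i hi => ?_
        have hi' : i ≤ k := by simpa [Nat.lt_succ_iff] using hi
        rw [mul_assoc]
        refine mul_le_mul_of_nonneg_left ?_ (by positivity)
        exact mul_le_mul (hC i (hi'.trans hk) v) (hD _ ((Nat.sub_le _ _).trans hk) v)
          (norm_nonneg _) hC0
    _ = 2 ^ k * (C * D) := by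
        rw [← Finset.sum_mul]
        congr 1
        exact_mod_cast Nat.sum_range_choose k
    _ ≤ 4 * (C * D) := by
        refine mul_le_mul_of_nonneg_right ?_ (by positivity)
        calc (2 : ℝ) ^ k ≤ 2 ^ 2 := pow_le_pow_right₀ (by norm_num) hk
          _ = 4 := by norm_num

lemma prod {ι : Type*} (s : Finset ι) {f : ι → E → ℝ} (hf : ∀ i, BddC2 (f i)) :
    BddC2 (fun v => ∏ i ∈ s, f i v) := by
  induction s using Finset.induction_on with
  | empty => simpa using const (E := E) 1
  | insert a s ha ih =>
    simp only [Finset.prod_insert ha]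
    exact (hf a).mul ih

lemma comp_clm {f : F → ℝ} (hf : BddC2 f) (L : E →L[ℝ] F) : BddC2 (fun v => f (L v)) := by
  obtain ⟨hf, C, hC⟩ := hf
  have hC0 : 0 ≤ C := (norm_nonneg _).trans (hC 0 (by norm_num) 0)
  refine ⟨hf.comp L.contDiff, C * (1 + ‖L‖) ^ 2, fun k hk v => ?_⟩
  have hk' : (k : WithTop ℕ∞) ≤ 2 := by exact_mod_cast hk
  have := L.iteratedFDeriv_comp_right hf v (i := k) hk'
  have h2 : (fun v => f (L v)) = f ∘ L := rfl
  rw [h2, this]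
  refine (ContinuousMultilinearMap.norm_compContinuousLinearMap_le _ _).trans ?_
  rw [Finset.prod_const, Finset.card_univ, Fintype.card_fin]
  have hL : ‖L‖ ^ k ≤ (1 + ‖L‖) ^ 2 :=
    calc ‖L‖ ^ k ≤ (1 + ‖L‖) ^ k := by gcongr; linarith [norm_nonneg L]
      _ ≤ (1 + ‖L‖) ^ 2 := pow_le_pow_right₀ (by linarith [norm_nonneg L]) hk
  exact mul_le_mul (hC k hk _) hL (by positivity) hC0

lemma bounds {f : E → ℝ} (hf : BddC2 f) : ∃ C : ℝ, (∀ v, |f v| ≤ C) ∧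
    (∀ v, ‖fderiv ℝ f v‖ ≤ C) ∧ (∀ v, ‖fderiv ℝ (fderiv ℝ f) v‖ ≤ C) := by
  obtain ⟨hf, C, hC⟩ := hf
  refine ⟨C, fun v => ?_, fun v => ?_, fun v => ?_⟩
  · simpa using hC 0 (by norm_num) v
  · simpa [norm_iteratedFDeriv_one] using hC 1 (by norm_num) v
  · rw [← norm_iteratedFDeriv_one, norm_iteratedFDeriv_fderiv]
    exact hC 2 le_rfl v

end BddC2

lemma bddC2_smoothTransition : BddC2 Real.smoothTransition := by
  have hcd : ContDiff ℝ 2 Real.smoothTransition := Real.smoothTransition.contDiff (n := 2)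
  refine ⟨hcd, ?_⟩
  have hbd : ∀ k : ℕ, k ≤ 2 → ∃ C : ℝ, ∀ v, ‖iteratedFDeriv ℝ k Real.smoothTransition v‖ ≤ C := by
    intro k hk
    have hk' : (k : WithTop ℕ∞) ≤ 2 := by exact_mod_cast hk
    have hcont : Continuous (iteratedFDeriv ℝ k Real.smoothTransition) :=
      hcd.continuous_iteratedFDeriv hk'
    obtain ⟨C, hC⟩ := (isCompact_Icc (a := (0 : ℝ)) (b := 1)).exists_bound_of_continuousOn
      hcont.continuousOn
    obtain ⟨D0, hD0⟩ := (BddC2.const (E := ℝ) 0).2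
    obtain ⟨D1, hD1⟩ := (BddC2.const (E := ℝ) 1).2
    refine ⟨max C (max D0 D1), fun v => ?_⟩
    rcases lt_or_ge v 0 with h0 | h0
    · have he : Real.smoothTransition =ᶠ[𝓝 v] fun _ => 0 := by
        filter_upwards [Iio_mem_nhds h0] with y hy
        exact Real.smoothTransition.zero_of_nonpos (le_of_lt hy)
      rw [(he.iteratedFDeriv ℝ k).eq_of_nhds]
      exact (hD0 k hk v).trans (by simp)
    rcases lt_or_ge 1 v with h1 | h1
    · have he : Real.smoothTransition =ᶠ[𝓝 v] fun _ => 1 := by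
        filter_upwards [Ioi_mem_nhds h1] with y hy
        exact Real.smoothTransition.one_of_one_le (le_of_lt hy)
      rw [(he.iteratedFDeriv ℝ k).eq_of_nhds]
      exact (hD1 k hk v).trans (by simp)
    · exact (hC v ⟨h0, h1⟩).trans (le_max_left _ _)
  obtain ⟨C0, h0⟩ := hbd 0 (by norm_num)
  obtain ⟨C1, h1⟩ := hbd 1 (by norm_num)
  obtain ⟨C2, h2⟩ := hbd 2 (by norm_num)
  refine ⟨max C0 (max C1 C2), fun k hk v => ?_⟩
  interval_cases k
  · exact (h0 v).trans (by simp)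
  · exact (h1 v).trans (by simp)
  · exact (h2 v).trans (by simp)

/-- Smoothed indicator of `[c, ∞)`. -/
noncomputable def smoothStep (c d x : ℝ) : ℝ := Real.smoothTransition (d⁻¹ * x - c / d)

lemma smoothStep_mono {c d : ℝ} (hd : 0 < d) : Monotone (smoothStep c d) := fun x y h => by
  refine Real.smoothTransition.monotone ?_
  have := mul_le_mul_of_nonneg_left h (inv_nonneg.2 hd.le)
  linarith

lemma smoothStep_nonneg (c d x : ℝ) : 0 ≤ smoothStep c d x := Real.smoothTransition.nonneg _

lemma smoothStep_le_one (c d x : ℝ) : smoothStep c d x ≤ 1 := Real.smoothTransition.le_one _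

lemma smoothStep_eq_zero {c d x : ℝ} (hd : 0 < d) (h : x ≤ c) : smoothStep c d x = 0 := by
  refine Real.smoothTransition.zero_of_nonpos ?_
  rw [show d⁻¹ * x - c / d = (x - c) / d by ring]
  exact div_nonpos_of_nonpos_of_nonneg (by linarith) hd.le

lemma smoothStep_eq_one {c d x : ℝ} (hd : 0 < d) (h : c + d ≤ x) : smoothStep c d x = 1 := by
  refine Real.smoothTransition.one_of_one_le ?_
  rw [show d⁻¹ * x - c / d = (x - c) / d by ring, le_div_iff₀ hd]
  linarith

lemma BddC2.comp_sub_const {f : ℝ → ℝ} (hf : BddC2 f) (a : ℝ) : BddC2 (fun x => f (x - a)) := by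
  obtain ⟨hf, C, hC⟩ := hf
  refine ⟨hf.comp (contDiff_id.sub contDiff_const), C, fun k hk v => ?_⟩
  rw [iteratedFDeriv_comp_sub]
  exact hC k hk _

lemma bddC2_smoothStep (c d : ℝ) : BddC2 (smoothStep c d) := by
  have := (bddC2_smoothTransition.comp_sub_const (c / d)).comp_clm (d⁻¹ • ContinuousLinearMap.id ℝ ℝ)
  have h2 : smoothStep c d = fun v => Real.smoothTransition ((d⁻¹ • ContinuousLinearMap.id ℝ ℝ) v - c / d) := by
    funext v; simp [smoothStep]
  rw [h2]; exact this

/-- Smoothed indicator of `∀ i, ∃ j, c ≤ v (i, j)`. -/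
noncomputable def smoothMinMax {I J : Type*} [Fintype I] [Fintype J] (c d : ℝ)
    (v : I × J → ℝ) : ℝ :=
  ∏ i, (1 - ∏ j, (1 - smoothStep c d (v (i, j))))

lemma bddC2_smoothMinMax {I J : Type*} [Fintype I] [Fintype J] (c d : ℝ) :
    BddC2 (smoothMinMax (I := I) (J := J) c d) := by
  refine BddC2.prod _ fun i => (BddC2.const 1).sub (BddC2.prod _ fun j => (BddC2.const 1).sub ?_)
  exact (bddC2_smoothStep c d).comp_clm (ContinuousLinearMap.proj (R := ℝ) (φ := fun _ : I × J => ℝ) (i, j))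

/-- Monotone increments force a nonnegative mixed second derivative. -/
lemma fderiv_fderiv_nonneg_of_increments {E : Type*} [NormedAddCommGroup E] [NormedSpace ℝ E]
    {G : E → ℝ} (hG : ContDiff ℝ 2 G) (v a b : E)
    (h : ∀ s t t' : ℝ, 0 ≤ s → t ≤ t' → 
      G (v + t • a + s • b) - G (v + t • a) ≤ G (v + t' • a + s • b) - G (v + t' • a)) :
    0 ≤ fderiv ℝ (fderiv ℝ G) v a b := by
  have hG1 : ContDiff ℝ 1 (fderiv ℝ G) := hG.fderiv_right (by norm_num)
  have hd : Differentiable ℝ G := hG.differentiable (by norm_num)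
  have hd1 : Differentiable ℝ (fderiv ℝ G) := hG1.differentiable (by norm_num)
  have hdir : ∀ w : E, HasDerivAt (fun s : ℝ => G (w + s • b)) (fderiv ℝ G w b) 0 := by
    intro w
    have h1 : HasDerivAt (fun s : ℝ => w + s • b) b 0 := by
      simpa using ((hasDerivAt_id (0 : ℝ)).smul_const b).const_add w
    have h2 : HasFDerivAt G (fderiv ℝ G w) (w + (0 : ℝ) • b) := by
      simpa using (hd w).hasFDerivAt
    exact h2.comp_hasDerivAt _ h1
  have hmono : Monotone (fun t : ℝ => fderiv ℝ G (v + t • a) b) := by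
    intro t t' htt
    have h3 := ((hdir (v + t' • a)).sub (hdir (v + t • a)))
    have h4 := h3.tendsto_slope_zero_right
    suffices hh : 0 ≤ fderiv ℝ G (v + t' • a) b - fderiv ℝ G (v + t • a) b by
      simpa using hh
    refine ge_of_tendsto h4 ?_
    filter_upwards [self_mem_nhdsWithin] with s hs
    have hs' : 0 < s := hs
    have := h s t t' hs'.le htt
    refine smul_nonneg (inv_nonneg.2 hs'.le) ?_
    simp only [Pi.sub_apply, zero_add, zero_smul, add_zero]
    linarith
  have h5 : HasDerivAt (fun t : ℝ => fderiv ℝ G (v + t • a) b) (fderiv ℝ (fderiv ℝ G) v a b) 0 := by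
    have h1 : HasDerivAt (fun s : ℝ => v + s • a) a 0 := by
      simpa using ((hasDerivAt_id (0 : ℝ)).smul_const a).const_add v
    have h2 : HasFDerivAt (fderiv ℝ G) (fderiv ℝ (fderiv ℝ G) v) (v + (0 : ℝ) • a) := by
      simpa using (hd1 v).hasFDerivAt
    have h6 := h2.comp_hasDerivAt _ h1
    exact (ContinuousLinearMap.apply ℝ ℝ b).hasFDerivAt.comp_hasDerivAt _ h6
  have h7 := h5.deriv
  rw [← h7, ← derivWithin_univ]
  exact (hmono.monotoneOn univ).derivWithin_nonneg

lemma one_sub_prod_smoothStep_mono {J : Type*} [Fintype J] {c d : ℝ} (hd : 0 < d)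
    {u v : J → ℝ} (h : u ≤ v) :
    1 - ∏ j, (1 - smoothStep c d (u j)) ≤ 1 - ∏ j, (1 - smoothStep c d (v j)) := by
  refine sub_le_sub_left (Finset.prod_le_prod (fun j _ => ?_) fun j _ => ?_) 1
  · linarith [smoothStep_le_one c d (v j)]
  · linarith [smoothStep_mono (c := c) hd (h j)]

lemma one_sub_prod_smoothStep_nonneg {J : Type*} [Fintype J] (c d : ℝ) (u : J → ℝ) :
    0 ≤ 1 - ∏ j, (1 - smoothStep c d (u j)) := by
  have : ∏ j, (1 - smoothStep c d (u j)) ≤ 1 :=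
    Finset.prod_le_one (fun j _ => by linarith [smoothStep_le_one c d (u j)])
      (fun j _ => by linarith [smoothStep_nonneg c d (u j)])
  linarith

lemma smoothMinMax_increments {I J : Type*} [Fintype I] [Fintype J] [DecidableEq (I × J)]
    {c d : ℝ} (hd : 0 < d)
    (v : I × J → ℝ) {x y : I × J} (hxy : x.1 ≠ y.1) {s t t' : ℝ} (hs : 0 ≤ s) (ht : t ≤ t') :
    smoothMinMax c d (v + t • Pi.single y (1 : ℝ) + s • Pi.single x (1 : ℝ))
        - smoothMinMax c d (v + t • Pi.single y (1 : ℝ))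
      ≤ smoothMinMax c d (v + t' • Pi.single y (1 : ℝ) + s • Pi.single x (1 : ℝ))
        - smoothMinMax c d (v + t' • Pi.single y (1 : ℝ)) := by
  set H : (J → ℝ) → ℝ := fun u => 1 - ∏ j, (1 - smoothStep c d (u j)) with hH
  have hG : ∀ w : I × J → ℝ, smoothMinMax c d w =
      H (fun j => w (x.1, j)) * (H (fun j => w (y.1, j)) *
        ∏ i ∈ (Finset.univ.erase x.1).erase y.1, H (fun j => w (i, j))) := by
    intro w
    rw [Finset.mul_prod_erase (Finset.univ.erase x.1) (fun i => H (fun j => w (i, j)))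
      (Finset.mem_erase.2 ⟨hxy.symm, Finset.mem_univ _⟩),
      Finset.mul_prod_erase Finset.univ (fun i => H (fun j => w (i, j))) (Finset.mem_univ _)]
    rfl
  have hx : ∀ r r' : ℝ, (fun j => (v + r • Pi.single y (1 : ℝ) + r' • Pi.single x (1 : ℝ) : I × J → ℝ) (x.1, j))
      = fun j => (v + r' • Pi.single x (1 : ℝ) : I × J → ℝ) (x.1, j) := by
    intro r r'; funext j
    have : (x.1, j) ≠ y := fun h => hxy (by rw [← h])
    simp [Pi.single_eq_of_ne this]
  have hy : ∀ r r' : ℝ, (fun j => (v + r • Pi.single y (1 : ℝ) + r' • Pi.single x (1 : ℝ) : I × J → ℝ) (y.1, j))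
      = fun j => (v + r • Pi.single y (1 : ℝ) : I × J → ℝ) (y.1, j) := by
    intro r r'; funext j
    have : (y.1, j) ≠ x := fun h => hxy (by rw [← h])
    simp [Pi.single_eq_of_ne this]
  have hz : ∀ r r' : ℝ, ∏ i ∈ (Finset.univ.erase x.1).erase y.1,
      H (fun j => (v + r • Pi.single y (1 : ℝ) + r' • Pi.single x (1 : ℝ) : I × J → ℝ) (i, j)) =
      ∏ i ∈ (Finset.univ.erase x.1).erase y.1, H (fun j => v (i, j)) := by
    intro r r'
    refine Finset.prod_congr rfl fun i hi => ?_
    simp only [Finset.mem_erase] at hi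
    congr 1; funext j
    have h1 : (i, j) ≠ x := fun h => hi.2.1 (by rw [← h])
    have h2 : (i, j) ≠ y := fun h => hi.1 (by rw [← h])
    simp [Pi.single_eq_of_ne h1, Pi.single_eq_of_ne h2]
  have hsingle : ∀ (z : I × J) (r r' : ℝ), r ≤ r' →
      v + r • Pi.single z (1 : ℝ) ≤ v + r' • Pi.single z (1 : ℝ) := by
    intro z r r' hr
    refine add_le_add_right (smul_le_smul_of_nonneg_right hr ?_) v
    intro k
    by_cases hk : k = z
    · subst hk; simp
    · simp [Pi.single_eq_of_ne hk]
  have h0' : ∀ r : ℝ, smoothMinMax c d (v + r • Pi.single y (1 : ℝ)) =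
      smoothMinMax c d (v + r • Pi.single y (1 : ℝ) + (0 : ℝ) • Pi.single x (1 : ℝ)) := by
    intro r; simp
  rw [h0' t, h0' t', hG, hG, hG, hG]
  simp only [hx, hy, hz]
  have e1 : H (fun j => (v + (0 : ℝ) • Pi.single x (1 : ℝ) : I × J → ℝ) (x.1, j)) ≤
      H (fun j => (v + s • Pi.single x (1 : ℝ) : I × J → ℝ) (x.1, j)) :=
    one_sub_prod_smoothStep_mono hd fun j => hsingle x 0 s hs _
  have e2 : H (fun j => (v + t • Pi.single y (1 : ℝ) : I × J → ℝ) (y.1, j)) ≤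
      H (fun j => (v + t' • Pi.single y (1 : ℝ) : I × J → ℝ) (y.1, j)) :=
    one_sub_prod_smoothStep_mono hd fun j => hsingle y t t' ht _
  have e3 : 0 ≤ ∏ i ∈ (Finset.univ.erase x.1).erase y.1, H (fun j => v (i, j)) :=
    Finset.prod_nonneg fun i _ => one_sub_prod_smoothStep_nonneg c d _
  rw [← sub_mul, ← sub_mul]
  exact mul_le_mul_of_nonneg_left (mul_le_mul_of_nonneg_right e2 e3) (sub_nonneg.2 e1)

lemma smoothMinMax_nonneg {I J : Type*} [Fintype I] [Fintype J] (c d : ℝ) (v : I × J → ℝ) :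
    0 ≤ smoothMinMax c d v :=
  Finset.prod_nonneg fun _ _ => one_sub_prod_smoothStep_nonneg c d _

lemma smoothMinMax_le_one {I J : Type*} [Fintype I] [Fintype J] (c d : ℝ) (v : I × J → ℝ) :
    smoothMinMax c d v ≤ 1 := by
  refine Finset.prod_le_one (fun _ _ => one_sub_prod_smoothStep_nonneg c d _) fun i _ => ?_
  have : 0 ≤ ∏ j, (1 - smoothStep c d (v (i, j))) :=
    Finset.prod_nonneg fun j _ => by linarith [smoothStep_le_one c d (v (i, j))]
  linarith

lemma smoothMinMax_eq_one {I J : Type*} [Fintype I] [Fintype J] {c d : ℝ} (hd : 0 < d)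
    {v : I × J → ℝ} (h : ∀ i, ∃ j, c + d ≤ v (i, j)) : smoothMinMax c d v = 1 := by
  refine Finset.prod_eq_one fun i _ => ?_
  obtain ⟨j, hj⟩ := h i
  rw [Finset.prod_eq_zero (Finset.mem_univ j), sub_zero]
  rw [smoothStep_eq_one hd hj, sub_self]

lemma smoothMinMax_eq_zero {I J : Type*} [Fintype I] [Fintype J] {c d : ℝ} (hd : 0 < d)
    {v : I × J → ℝ} (h : ¬ ∀ i, ∃ j, c < v (i, j)) : smoothMinMax c d v = 0 := by
  push Not at h
  obtain ⟨i, hi⟩ := h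
  refine Finset.prod_eq_zero (Finset.mem_univ i) ?_
  rw [Finset.prod_eq_one, sub_self]
  intro j _
  rw [smoothStep_eq_zero hd (hi j), sub_zero]

lemma fderiv_fderiv_smoothMinMax_nonneg {I J : Type*} [Fintype I] [Fintype J]
    [inst : DecidableEq (I × J)] {c d : ℝ} (hd : 0 < d) (v : I × J → ℝ) {x y : I × J}
    (hxy : x.1 ≠ y.1) : 0 ≤ fderiv ℝ (fderiv ℝ (smoothMinMax (I := I) (J := J) c d)) v
      (Pi.single y (1 : ℝ)) (Pi.single x (1 : ℝ)) :=
  fderiv_fderiv_nonneg_of_increments (bddC2_smoothMinMax c d).1 v _ _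
    fun _ _ _ hs ht => smoothMinMax_increments hd v hxy hs ht

/-- **Gordon's comparison inequality** for finitely many indices. -/
lemma gordon_finite {I J K : Type*} [Fintype I] [Fintype J] [Fintype K]
    (a b : I × J → K → ℝ) (ψ : I × J → ℝ)
    (hort : ∀ x y, ∑ k, a x k * b y k = 0)
    (heq : ∀ x y, x.1 = y.1 → ∑ k, a x k * a y k = ∑ k, b x k * b y k)
    (hle : ∀ x y, x.1 ≠ y.1 → ∑ k, b x k * b y k ≤ ∑ k, a x k * a y k)
    {c c' : ℝ} (hc : c < c') :
    stdGauss K {ξ | ∀ i, ∃ j, c' ≤ ∑ k, b (i, j) k * ξ k + ψ (i, j)}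
      ≤ stdGauss K {ξ | ∀ i, ∃ j, c < ∑ k, a (i, j) k * ξ k + ψ (i, j)} := by
  have hd : 0 < c' - c := sub_pos.2 hc
  have hG : BddC2 (smoothMinMax (I := I) (J := J) c (c' - c)) := bddC2_smoothMinMax c (c' - c)
  have hG2 := fun v (x y : I × J) (hxy : x.1 ≠ y.1) =>
    fderiv_fderiv_smoothMinMax_nonneg (c := c) (inst := fun a b => Classical.propDecidable (a = b))
      hd v hxy
  have hG0 : ∀ v, 0 ≤ smoothMinMax (I := I) (J := J) c (c' - c) v := smoothMinMax_nonneg c _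
  have hGle : ∀ v, smoothMinMax (I := I) (J := J) c (c' - c) v ≤ 1 := smoothMinMax_le_one c _
  have hGone : ∀ v : I × J → ℝ, (∀ i, ∃ j, c' ≤ v (i, j)) → smoothMinMax c (c' - c) v = 1 :=
    fun v h => smoothMinMax_eq_one hd (by simpa using h)
  have hGzero : ∀ v : I × J → ℝ, (¬ ∀ i, ∃ j, c < v (i, j)) → smoothMinMax c (c' - c) v = 0 :=
    fun v h => smoothMinMax_eq_zero hd h
  generalize smoothMinMax (I := I) (J := J) c (c' - c) = G at hG hG2 hG0 hGle hGone hGzero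
  obtain ⟨C, hC, hC1, hC2⟩ := hG.bounds
  have key := gaussian_comparison a b ψ hG.1 hC hC1 hC2 hort fun v x y => by
    by_cases hxy : x.1 = y.1
    · rw [heq x y hxy]; simp
    · refine mul_nonneg (sub_nonneg.2 (hle x y hxy)) ?_
      exact hG2 v x y hxy
  have hcont : ∀ e : I × J → K → ℝ,
      Continuous fun ξ : K → ℝ => G (fun x => ∑ k, e x k * ξ k + ψ x) := fun e =>
    hG.1.continuous.comp (by fun_prop)
  have h_integrable : ∀ e : I × J → K → ℝ,
      Integrable (fun ξ : K → ℝ => G (fun x => ∑ k, e x k * ξ k + ψ x)) (stdGauss K) := fun e =>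
    Integrable.of_bound (hcont e).aestronglyMeasurable 1 (Eventually.of_forall fun ξ => by
      rw [Real.norm_eq_abs, abs_of_nonneg (hG0 _)]
      exact hGle _)
  have hmB : MeasurableSet {ξ : K → ℝ | ∀ i, ∃ j, c' ≤ ∑ k, b (i, j) k * ξ k + ψ (i, j)} := by
    rw [ofPred_forall]
    refine MeasurableSet.iInter fun i => ?_
    rw [ofPred_exists]
    exact MeasurableSet.iUnion fun j => measurableSet_le measurable_const (by fun_prop)
  have hmA : MeasurableSet {ξ : K → ℝ | ∀ i, ∃ j, c < ∑ k, a (i, j) k * ξ k + ψ (i, j)} := by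
    rw [ofPred_forall]
    refine MeasurableSet.iInter fun i => ?_
    rw [ofPred_exists]
    exact MeasurableSet.iUnion fun j => measurableSet_lt measurable_const (by fun_prop)
  rw [← ENNReal.toReal_le_toReal (measure_ne_top _ _) (measure_ne_top _ _)]
  change (stdGauss K).real _ ≤ (stdGauss K).real _
  rw [← integral_indicator_one hmB, ← integral_indicator_one hmA]
  refine le_trans (integral_mono ((integrable_const 1).indicator hmB) (h_integrable b) fun ξ => ?_)
    (key.trans (integral_mono (h_integrable a) ((integrable_const 1).indicator hmA) fun ξ => ?_))
  · by_cases h : ∀ i, ∃ j, c' ≤ ∑ k, b (i, j) k * ξ k + ψ (i, j)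
    · rw [indicator_of_mem (by exact h)]
      exact (hGone _ h).ge
    · rw [indicator_of_notMem (by exact h)]
      exact hG0 _
  · by_cases h : ∀ i, ∃ j, c < ∑ k, a (i, j) k * ξ k + ψ (i, j)
    · rw [indicator_of_mem (by exact h)]
      exact hGle _
    · rw [indicator_of_notMem (by exact h)]
      exact (hGzero _ h).le

/-- **Gordon's comparison inequality** for countably many indices. -/
lemma gordon_countable {I J K : Type*} [Countable I] [Countable J] [Fintype K]
    (a b : I → J → K → ℝ) (ψ : I → J → ℝ)
    (hort : ∀ i j i' j', ∑ k, a i j k * b i' j' k = 0)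
    (heq : ∀ i j j', ∑ k, a i j k * a i j' k = ∑ k, b i j k * b i j' k)
    (hle : ∀ i j i' j', ∑ k, b i j k * b i' j' k ≤ ∑ k, a i j k * a i' j' k)
    {c c' : ℝ} (hc : c < c') :
    stdGauss K {ξ | ∀ i, ∃ j, c' ≤ ∑ k, b i j k * ξ k + ψ i j}
      ≤ stdGauss K {ξ | ∀ i, ∃ j, c < ∑ k, a i j k * ξ k + ψ i j} := by
  have hm : ∀ i j, MeasurableSet {ξ : K → ℝ | c < ∑ k, a i j k * ξ k + ψ i j} := fun i j =>
    measurableSet_lt measurable_const (by fun_prop)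
  have hA : {ξ : K → ℝ | ∀ i, ∃ j, c < ∑ k, a i j k * ξ k + ψ i j} =
      ⋂ s : Finset I, {ξ | ∀ i ∈ s, ∃ j, c < ∑ k, a i j k * ξ k + ψ i j} := by
    ext ξ
    simp only [mem_ofPred_eq, mem_iInter]
    exact ⟨fun h s i _ => h i, fun h i => h {i} i (Finset.mem_singleton_self i)⟩
  have hfin : ∀ s : Finset I,
      stdGauss K {ξ | ∀ i, ∃ j, c' ≤ ∑ k, b i j k * ξ k + ψ i j} ≤
      stdGauss K {ξ | ∀ i ∈ s, ∃ j, c < ∑ k, a i j k * ξ k + ψ i j} := by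
    intro s
    have hB : {ξ : K → ℝ | ∀ i ∈ s, ∃ j, c' ≤ ∑ k, b i j k * ξ k + ψ i j} =
        ⋃ t : Finset J, {ξ | ∀ i ∈ s, ∃ j ∈ t, c' ≤ ∑ k, b i j k * ξ k + ψ i j} := by
      ext ξ
      simp only [mem_ofPred_eq, mem_iUnion]
      constructor
      · intro h
        choose f hf using h
        exact ⟨s.attach.image fun i => f i.1 i.2, fun i hi => ⟨f i hi,
          Finset.mem_image_of_mem (fun i : s => f i.1 i.2) (Finset.mem_attach s ⟨i, hi⟩), hf i hi⟩⟩
      · rintro ⟨t, ht⟩ i hi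
        obtain ⟨j, _, hj⟩ := ht i hi
        exact ⟨j, hj⟩
    calc _ ≤ stdGauss K {ξ | ∀ i ∈ s, ∃ j, c' ≤ ∑ k, b i j k * ξ k + ψ i j} :=
          measure_mono fun ξ (h : ∀ i, ∃ j, _) i _ => h i
      _ = ⨆ t : Finset J, stdGauss K
            {ξ | ∀ i ∈ s, ∃ j ∈ t, c' ≤ ∑ k, b i j k * ξ k + ψ i j} := by
          rw [hB]
          refine Directed.measure_iUnion ?_
          refine Monotone.directed_le fun t t' htt ξ h i hi => ?_
          obtain ⟨j, hj, h'⟩ := h i hi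
          exact ⟨j, htt hj, h'⟩
      _ ≤ _ := by
          refine iSup_le fun t => ?_
          have := gordon_finite (I := s) (J := t) (fun x => a x.1 x.2) (fun x => b x.1 x.2)
            (fun x => ψ x.1 x.2) (fun x y => hort _ _ _ _)
            (fun x y hxy => by
              obtain ⟨x1, x2⟩ := x
              obtain ⟨y1, y2⟩ := y
              simp only at hxy
              subst hxy
              exact heq _ _ _) (fun x y _ => hle _ _ _ _) hc
          refine (measure_mono ?_).trans (this.trans (measure_mono ?_))
          · intro ξ h i
            obtain ⟨j, hj, h'⟩ := h i i.2
            exact ⟨⟨j, hj⟩, h'⟩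
          · intro ξ h i hi
            obtain ⟨j, h'⟩ := h ⟨i, hi⟩
            exact ⟨j, h'⟩
  rw [hA, Directed.measure_iInter]
  · exact le_iInf hfin
  · intro s
    refine MeasurableSet.nullMeasurableSet ?_
    have : {ξ : K → ℝ | ∀ i ∈ s, ∃ j, c < ∑ k, a i j k * ξ k + ψ i j} =
      ⋂ i ∈ s, ⋃ j, {ξ | c < ∑ k, a i j k * ξ k + ψ i j} := by ext; simp
    rw [this]
    exact Finset.measurableSet_biInter _ fun i _ => MeasurableSet.iUnion fun j => hm i j
  · exact Antitone.directed_ge fun s t hst ξ h i hi => h i (Finset.mem_of_subset hst hi)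
  · exact ⟨∅, measure_ne_top _ _⟩

/-- Gordon's comparison inequality with a random offset and random constraint set,
both independent of the Gaussian vector. -/
lemma gordon_prod {B I J K : Type*} [MeasurableSpace B] [Countable I] [Countable J] [Fintype K]
    (μ : Measure B) [SFinite μ] (a b : I → J → K → ℝ) (ψ : B → I → J → ℝ) (D : I → B → Prop)
    (hψ : ∀ i j, Measurable fun β => ψ β i j) (hD : ∀ i, MeasurableSet {β | D i β})
    (hort : ∀ i j i' j', ∑ k, a i j k * b i' j' k = 0)
    (heq : ∀ i j j', ∑ k, a i j k * a i j' k = ∑ k, b i j k * b i j' k)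
    (hle : ∀ i j i' j', ∑ k, b i j k * b i' j' k ≤ ∑ k, a i j k * a i' j' k)
    {c c' : ℝ} (hc : c < c') :
    μ.prod (stdGauss K) {z | ∀ i, D i z.1 → ∃ j, c' ≤ ∑ k, b i j k * z.2 k + ψ z.1 i j}
      ≤ μ.prod (stdGauss K)
        {z | ∀ i, D i z.1 → ∃ j, c < ∑ k, a i j k * z.2 k + ψ z.1 i j} := by
  have hD' : ∀ i, MeasurableSet {z : B × (K → ℝ) | D i z.1} := fun i => measurable_fst (hD i)
  have hψ' : ∀ i j, Measurable fun z : B × (K → ℝ) => ψ z.1 i j :=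
    fun i j => (hψ i j).comp measurable_fst
  rw [Measure.prod_apply, Measure.prod_apply]
  · refine lintegral_mono fun β => ?_
    have := gordon_countable (I := {i // D i β}) (J := J) (fun i => a i) (fun i => b i)
      (fun i => ψ β i) (fun _ _ _ _ => hort _ _ _ _) (fun _ _ _ => heq _ _ _)
      (fun _ _ _ _ => hle _ _ _ _) hc
    refine (measure_mono ?_).trans (this.trans (measure_mono ?_))
    · intro ξ hξ i
      exact hξ i.1 i.2
    · intro ξ hξ i hi
      exact hξ ⟨i, hi⟩
  · have : {z : B × (K → ℝ) | ∀ i, D i z.1 → ∃ j, c < ∑ k, a i j k * z.2 k + ψ z.1 i j} =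
        ⋂ i, ({z | D i z.1}ᶜ ∪ ⋃ j, {z | c < ∑ k, a i j k * z.2 k + ψ z.1 i j}) := by
      ext z; simp [imp_iff_not_or]
    rw [this]
    refine MeasurableSet.iInter fun i => (hD' i).compl.union (MeasurableSet.iUnion fun j => ?_)
    exact measurableSet_lt measurable_const (by have := hψ' i j; fun_prop)
  · have : {z : B × (K → ℝ) | ∀ i, D i z.1 → ∃ j, c' ≤ ∑ k, b i j k * z.2 k + ψ z.1 i j} =
        ⋂ i, ({z | D i z.1}ᶜ ∪ ⋃ j, {z | c' ≤ ∑ k, b i j k * z.2 k + ψ z.1 i j}) := by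
      ext z; simp [imp_iff_not_or]
    rw [this]
    refine MeasurableSet.iInter fun i => (hD' i).compl.union (MeasurableSet.iUnion fun j => ?_)
    exact measurableSet_le measurable_const (by have := hψ' i j; fun_prop)

/-- The Euclidean norm of a finite real vector. -/
noncomputable def l2 {A : Type*} [Fintype A] (x : A → ℝ) : ℝ := √(∑ a, x a ^ 2)

section l2

variable {A : Type*} [Fintype A]

lemma l2_nonneg (x : A → ℝ) : 0 ≤ l2 x := Real.sqrt_nonneg _

lemma sq_l2 (x : A → ℝ) : l2 x ^ 2 = ∑ a, x a ^ 2 :=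
  Real.sq_sqrt (Finset.sum_nonneg fun _ _ => sq_nonneg _)

lemma l2_eq_norm (x : A → ℝ) : l2 x = ‖WithLp.toLp 2 x‖ := by
  rw [EuclideanSpace.norm_eq]; simp [l2]

lemma sum_mul_le_l2 (x y : A → ℝ) : ∑ a, x a * y a ≤ l2 x * l2 y :=
  Real.sum_mul_le_sqrt_mul_sqrt _ _ _

lemma l2_neg (x : A → ℝ) : l2 (-x) = l2 x := by simp [l2]

lemma l2_add_le (x y : A → ℝ) : l2 (x + y) ≤ l2 x + l2 y := by
  simp only [l2_eq_norm, WithLp.toLp_add]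
  exact norm_add_le _ _

lemma l2_smul (c : ℝ) (x : A → ℝ) : l2 (c • x) = |c| * l2 x := by
  simp only [l2_eq_norm, WithLp.toLp_smul, norm_smul, Real.norm_eq_abs]

lemma continuous_l2 : Continuous (l2 : (A → ℝ) → ℝ) := by unfold l2; fun_prop

end l2

/-- The index set of the Gaussian coordinates: a matrix, two vectors and a scalar. -/
abbrev GIdx (R S : Type*) := (R × S) ⊕ (R ⊕ (S ⊕ Unit))

section vectors

variable {R S : Type*} [Fintype R] [Fintype S]

/-- Coefficients of the primary process `xᵀ G y + z ‖x‖ ‖y‖`. -/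
noncomputable def priVec (x : R → ℝ) (y : S → ℝ) : GIdx R S → ℝ :=
  Sum.elim (fun k => x k.1 * y k.2) (Sum.elim 0 (Sum.elim 0 fun _ => l2 x * l2 y))

/-- Coefficients of the auxiliary process `‖y‖ gᵀ x - ‖x‖ hᵀ y`. -/
noncomputable def auxVec (x : R → ℝ) (y : S → ℝ) : GIdx R S → ℝ :=
  Sum.elim 0 (Sum.elim (fun r => l2 y * x r) (Sum.elim (fun s => -(l2 x * y s)) 0))

lemma sum_priVec (x : R → ℝ) (y : S → ℝ) (ξ : GIdx R S → ℝ) :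
    ∑ k, priVec x y k * ξ k = ∑ r, x r * (∑ s, ξ (.inl (r, s)) * y s)
      + ξ (.inr (.inr (.inr ()))) * (l2 x * l2 y) := by
  simp only [priVec, Fintype.sum_sum_type, Sum.elim_inl, Sum.elim_inr, Fintype.sum_prod_type,
    Pi.zero_apply, zero_mul, Finset.sum_const_zero, zero_add, Finset.univ_unique,
    Finset.sum_singleton, Finset.mul_sum]
  congr 1
  · exact Finset.sum_congr rfl fun r _ => Finset.sum_congr rfl fun s _ => by ring
  · rw [mul_comm]

lemma sum_auxVec (x : R → ℝ) (y : S → ℝ) (ξ : GIdx R S → ℝ) :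
    ∑ k, auxVec x y k * ξ k = l2 y * ∑ r, ξ (.inr (.inl r)) * x r
      - l2 x * ∑ s, ξ (.inr (.inr (.inl s))) * y s := by
  simp only [auxVec, Fintype.sum_sum_type, Sum.elim_inl, Sum.elim_inr,
    Pi.zero_apply, zero_mul, Finset.sum_const_zero, zero_add, add_zero, Finset.mul_sum]
  rw [sub_eq_add_neg, ← Finset.sum_neg_distrib]
  congr 1
  · exact Finset.sum_congr rfl fun r _ => by ring
  · exact Finset.sum_congr rfl fun r _ => by ring

lemma sum_priVec_priVec (x x' : R → ℝ) (y y' : S → ℝ) :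
    ∑ k, priVec x y k * priVec x' y' k
      = (∑ r, x r * x' r) * (∑ s, y s * y' s) + l2 x * l2 x' * (l2 y * l2 y') := by
  rw [sum_priVec]
  simp only [priVec, Sum.elim_inl, Sum.elim_inr]
  congr 1
  · rw [Finset.sum_mul_sum]
    refine Finset.sum_congr rfl fun r _ => ?_
    rw [Finset.mul_sum]
    exact Finset.sum_congr rfl fun s _ => by ring
  · ring

lemma sum_auxVec_auxVec (x x' : R → ℝ) (y y' : S → ℝ) :
    ∑ k, auxVec x y k * auxVec x' y' k
      = l2 y * l2 y' * (∑ r, x r * x' r) + l2 x * l2 x' * (∑ s, y s * y' s) := by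
  rw [sum_auxVec]
  simp only [auxVec, Sum.elim_inl, Sum.elim_inr]
  rw [sub_eq_add_neg, ← mul_neg, ← Finset.sum_neg_distrib]
  simp only [Finset.mul_sum]
  congr 1
  · exact Finset.sum_congr rfl fun s _ => by ring
  · exact Finset.sum_congr rfl fun s _ => by ring

lemma sum_priVec_auxVec (x x' : R → ℝ) (y y' : S → ℝ) :
    ∑ k, priVec x y k * auxVec x' y' k = 0 := by
  rw [sum_priVec]
  simp [auxVec]

lemma sum_auxVec_le_sum_priVec (x x' : R → ℝ) (y y' : S → ℝ) :
    ∑ k, auxVec x y k * auxVec x' y' k ≤ ∑ k, priVec x y k * priVec x' y' k := by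
  rw [sum_auxVec_auxVec, sum_priVec_priVec]
  nlinarith [mul_nonneg (sub_nonneg.2 (sum_mul_le_l2 x x')) (sub_nonneg.2 (sum_mul_le_l2 y y'))]

lemma sum_priVec_eq_left (x : R → ℝ) (y y' : S → ℝ) :
    ∑ k, priVec x y k * priVec x y' k = ∑ k, auxVec x y k * auxVec x y' k := by
  rw [sum_auxVec_auxVec, sum_priVec_priVec]
  have : ∑ r, x r * x r = l2 x * l2 x := by
    rw [← sq, sq_l2]; exact Finset.sum_congr rfl fun _ _ => by ring
  rw [this]; ring

lemma sum_priVec_eq_right (x x' : R → ℝ) (y : S → ℝ) :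
    ∑ k, priVec x y k * priVec x' y k = ∑ k, auxVec x y k * auxVec x' y k := by
  rw [sum_auxVec_auxVec, sum_priVec_priVec]
  have : ∑ r, y r * y r = l2 y * l2 y := by
    rw [← sq, sq_l2]; exact Finset.sum_congr rfl fun _ _ => by ring
  rw [this]; ring

end vectors

lemma exists_mem_compact_of_dense {X Y : Type*} [TopologicalSpace X] [TopologicalSpace Y]
    {φ : X → Y → ℝ} (hφ : Continuous fun z : X × Y => φ z.1 z.2) {C : Set Y} (hC : IsCompact C)
    {U Q : Set X} (hU : IsOpen U) (hQ : Dense Q) {c : ℝ}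
    (h : ∀ x ∈ Q, x ∈ U → ∃ y ∈ C, c ≤ φ x y) : ∀ x ∈ U, ∃ y ∈ C, c ≤ φ x y := by
  have hcl : IsClosed {x | ∃ y ∈ C, c ≤ φ x y} := by
    have : CompactSpace C := isCompact_iff_compactSpace.1 hC
    have h1 : IsClosed {z : X × C | c ≤ φ z.1 z.2} :=
      isClosed_le continuous_const (hφ.comp (continuous_fst.prodMk (continuous_subtype_val.comp continuous_snd)))
    have h2 := isClosedMap_fst_of_compactSpace _ h1
    convert h2 using 1
    ext x
    simp only [Set.mem_ofPred_eq, Set.mem_image, Prod.exists, Subtype.exists]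
    constructor
    · rintro ⟨y, hy, hxy⟩; exact ⟨x, y, hy, hxy, rfl⟩
    · rintro ⟨_, y, hy, hxy, rfl⟩; exact ⟨y, hy, hxy⟩
  intro x hx
  have h1 : x ∈ closure (U ∩ Q) := hQ.open_subset_closure_inter hU hx
  exact hcl.closure_subset_iff.2 (fun y hy => h y hy.2 hy.1) h1

/-- Gordon's comparison inequality for continuous processes on separable spaces. -/
lemma gordon_continuous {B X Y K : Type*} [MeasurableSpace B] [Fintype K]
    [TopologicalSpace X] [TopologicalSpace.SeparableSpace X] [Nonempty X]
    [TopologicalSpace Y] [TopologicalSpace.SeparableSpace Y] [Nonempty Y]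
    (μ : Measure B) [SFinite μ] (a b : X → Y → K → ℝ) (ψ : B → X → Y → ℝ) (D : X → B → Prop)
    (ha : ∀ k, Continuous fun z : X × Y => a z.1 z.2 k)
    (hb : ∀ k, Continuous fun z : X × Y => b z.1 z.2 k)
    (hψc : ∀ β, Continuous fun z : X × Y => ψ β z.1 z.2)
    (hψ : ∀ i j, Measurable fun β => ψ β i j) (hD : ∀ i, MeasurableSet {β | D i β})
    (hDo : ∀ β, IsOpen {x | D x β})
    (hort : ∀ i j i' j', ∑ k, a i j k * b i' j' k = 0)
    (heq : ∀ i j j', ∑ k, a i j k * a i j' k = ∑ k, b i j k * b i j' k)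
    (hle : ∀ i j i' j', ∑ k, b i j k * b i' j' k ≤ ∑ k, a i j k * a i' j' k)
    {V C : Set Y} (hV : IsOpen V) (hC : IsCompact C) (hVC : V ⊆ C) 
    {c c' : ℝ} (hc : c < c') :
    μ.prod (stdGauss K)
        {z | ∀ x, D x z.1 → ∃ y ∈ V, c' < ∑ k, b x y k * z.2 k + ψ z.1 x y}
      ≤ μ.prod (stdGauss K)
        {z | ∀ x, D x z.1 → ∃ y ∈ C, c ≤ ∑ k, a x y k * z.2 k + ψ z.1 x y} := by
  obtain ⟨QX, hQXc, hQX⟩ := TopologicalSpace.exists_countable_dense X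
  obtain ⟨QY, hQYc, hQY⟩ := TopologicalSpace.exists_countable_dense Y
  have : Countable QX := hQXc
  have : Countable (QY ∩ V : Set Y) := (hQYc.mono inter_subset_left)
  have key := gordon_prod (I := QX) (J := (QY ∩ V : Set Y)) μ (fun i j => a i j)
    (fun i j => b i j) (fun β i j => ψ β i j) (fun i => D i) (fun _ _ => hψ _ _) (fun _ => hD _)
    (fun _ _ _ _ => hort _ _ _ _) (fun _ _ _ => heq _ _ _) (fun _ _ _ _ => hle _ _ _ _) hc
  refine (measure_mono ?_).trans (key.trans (measure_mono ?_))
  · intro z hz x hx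
    obtain ⟨y, hyV, hy⟩ := hz x hx
    have hcy : Continuous fun y => ∑ k, b x y k * z.2 k + ψ z.1 x y := by
      have h1 : ∀ k, Continuous fun y => b x y k := fun k => (hb k).comp (Continuous.prodMk_right _)
      have h2 : Continuous fun y => ψ z.1 x y := (hψc z.1).comp (Continuous.prodMk_right _)
      fun_prop
    obtain ⟨y', hy'Q, hy'⟩ := hQY.exists_mem_open
      (hV.inter (isOpen_lt continuous_const hcy)) ⟨y, hyV, hy⟩
    exact ⟨⟨y', hy'Q, hy'.1⟩, hy'.2.le⟩
  · intro z hz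
    have hcy : Continuous fun w : X × Y => ∑ k, a w.1 w.2 k * z.2 k + ψ z.1 w.1 w.2 := by
      have := hψc z.1
      fun_prop
    refine exists_mem_compact_of_dense
      (φ := fun x y => ∑ k, a x y k * z.2 k + ψ z.1 x y) hcy hC (hDo z.1) hQX ?_
    intro x hxQ hxU
    obtain ⟨⟨y, hy⟩, hxy⟩ := hz ⟨x, hxQ⟩ hxU
    exact ⟨y, hVC hy.2, hxy.le⟩

lemma abs_apply_le_l2 {A : Type*} [Fintype A] (x : A → ℝ) (a : A) : |x a| ≤ l2 x := by
  rw [l2, ← Real.sqrt_sq_eq_abs]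
  exact Real.sqrt_le_sqrt (Finset.single_le_sum (f := fun a => x a ^ 2)
    (fun a _ => sq_nonneg _) (Finset.mem_univ a))

lemma isCompact_l2_le {A : Type*} [Fintype A] (B : ℝ) : IsCompact {x : A → ℝ | l2 x ≤ B} := by
  refine Metric.isCompact_of_isClosed_isBounded (isClosed_le continuous_l2 continuous_const) ?_
  refine (Metric.isBounded_closedBall (x := (0 : A → ℝ)) (r := |B|)).subset fun x hx => ?_
  rw [mem_closedBall_zero_iff]
  refine (pi_norm_le_iff_of_nonneg (abs_nonneg B)).2 fun a => ?_
  exact (abs_apply_le_l2 x a).trans (le_trans hx (le_abs_self B))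

lemma isOpen_l2_lt {A : Type*} [Fintype A] (B : ℝ) : IsOpen {x : A → ℝ | l2 x < B} :=
  isOpen_lt continuous_l2 continuous_const

lemma convex_l2_le {A : Type*} [Fintype A] (B : ℝ) : Convex ℝ {x : A → ℝ | l2 x ≤ B} := by
  intro x hx y hy a b ha hb hab
  calc l2 (a • x + b • y) ≤ l2 (a • x) + l2 (b • y) := l2_add_le _ _
    _ = a * l2 x + b * l2 y := by rw [l2_smul, l2_smul, abs_of_nonneg ha, abs_of_nonneg hb]
    _ ≤ a * B + b * B := by
        have hx' : l2 x ≤ B := hx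
        have hy' : l2 y ≤ B := hy
        gcongr
    _ = B := by rw [← add_mul, hab, one_mul]

lemma continuous_priVec {Z R S : Type*} [TopologicalSpace Z] [Fintype R] [Fintype S]
    {x : Z → R → ℝ} {y : Z → S → ℝ} (hx : Continuous x) (hy : Continuous y) (k : GIdx R S) :
    Continuous fun z => priVec (x z) (y z) k := by
  have h1 := continuous_l2.comp hx
  have h2 := continuous_l2.comp hy
  rcases k with k | k | k | k <;> simp only [priVec, Sum.elim_inl, Sum.elim_inr, Pi.zero_apply]
  · exact ((continuous_apply _).comp hx).mul ((continuous_apply _).comp hy)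
  · exact continuous_const
  · exact continuous_const
  · exact h1.mul h2

lemma continuous_auxVec {Z R S : Type*} [TopologicalSpace Z] [Fintype R] [Fintype S]
    {x : Z → R → ℝ} {y : Z → S → ℝ} (hx : Continuous x) (hy : Continuous y) (k : GIdx R S) :
    Continuous fun z => auxVec (x z) (y z) k := by
  have h1 := continuous_l2.comp hx
  have h2 := continuous_l2.comp hy
  rcases k with k | k | k | k <;> simp only [auxVec, Sum.elim_inl, Sum.elim_inr, Pi.zero_apply]
  · exact continuous_const
  · exact h2.mul ((continuous_apply _).comp hx)
  · exact (h1.mul ((continuous_apply _).comp hy)).neg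
  · exact continuous_const

section lasso

variable {n p : ℕ}

/-- Error vector rescaled and extended by the noise level. -/
noncomputable def extVec (n : ℕ) (σ : ℝ) (w : Fin p → ℝ) : Option (Fin p) → ℝ :=
  fun o => o.elim σ fun j => w j / √n

lemma sum_mul_extVec (σ : ℝ) (w : Fin p → ℝ) (h : Option (Fin p) → ℝ) :
    ∑ s, h s * extVec n σ w s = h none * σ + (∑ j, h (some j) * w j) / √n := by
  rw [Fintype.sum_option, Finset.sum_div]
  simp only [extVec, Option.elim]
  congr 1
  exact Finset.sum_congr rfl fun j _ => by ring

lemma sq_l2_extVec (σ : ℝ) (w : Fin p → ℝ) :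
    l2 (extVec n σ w) ^ 2 = σ ^ 2 + l2 w ^ 2 / n := by
  rw [sq_l2, sq_l2, Fintype.sum_option, Finset.sum_div]
  simp only [extVec, Option.elim]
  congr 1
  exact Finset.sum_congr rfl fun j _ => by rw [div_pow, Real.sq_sqrt (Nat.cast_nonneg n)]

lemma continuous_extVec (σ : ℝ) (s : Option (Fin p)) :
    Continuous fun w : Fin p → ℝ => extVec n σ w s := by
  cases s with
  | none => exact continuous_const
  | some j => exact (continuous_apply j).div_const _

/-- The Gaussian residual `X w - ζ`. -/
noncomputable def resid (σ : ℝ) (ξ : GIdx (Fin n) (Option (Fin p)) → ℝ) (w : Fin p → ℝ) :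
    Fin n → ℝ := fun i => ∑ s, ξ (.inl (i, s)) * extVec n σ w s

/-- The Lasso objective in terms of the error vector `w = b - β`. -/
noncomputable def lcost (σ lam : ℝ) (β : Fin p → ℝ) (ξ : GIdx (Fin n) (Option (Fin p)) → ℝ)
    (w : Fin p → ℝ) : ℝ :=
  (1 / 2) * ∑ i, resid σ ξ w i ^ 2 + lam * ∑ j, |β j + w j|

lemma continuous_resid (σ : ℝ) (ξ : GIdx (Fin n) (Option (Fin p)) → ℝ) (i : Fin n) :
    Continuous fun w => resid σ ξ w i := by
  unfold resid
  exact continuous_finsetSum _ fun s _ => (continuous_extVec σ s).const_mul _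

lemma continuous_lcost (σ lam : ℝ) (β : Fin p → ℝ) (ξ : GIdx (Fin n) (Option (Fin p)) → ℝ) :
    Continuous (lcost σ lam β ξ) := by
  unfold lcost
  have := continuous_resid σ ξ
  fun_prop

lemma resid_lineMap (σ : ℝ) (ξ : GIdx (Fin n) (Option (Fin p)) → ℝ) (w w' : Fin p → ℝ) (t : ℝ)
    (i : Fin n) : resid σ ξ ((1 - t) • w + t • w') i
      = (1 - t) * resid σ ξ w i + t * resid σ ξ w' i := by
  simp only [resid, sum_mul_extVec (n := n) σ _ (fun s => ξ (.inl (i, s)))]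
  have : ∑ j, ξ (.inl (i, some j)) * ((1 - t) • w + t • w') j =
      (1 - t) * ∑ j, ξ (.inl (i, some j)) * w j + t * ∑ j, ξ (.inl (i, some j)) * w' j := by
    rw [Finset.mul_sum, Finset.mul_sum, ← Finset.sum_add_distrib]
    refine Finset.sum_congr rfl fun j _ => ?_
    simp only [Pi.add_apply, Pi.smul_apply, smul_eq_mul]; ring
  rw [this]; ring

lemma l1_lineMap_le (β w w' : Fin p → ℝ) {t : ℝ} (ht0 : 0 ≤ t) (ht1 : t ≤ 1) :
    ∑ j, |β j + ((1 - t) • w + t • w') j|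
      ≤ (1 - t) * ∑ j, |β j + w j| + t * ∑ j, |β j + w' j| := by
  rw [Finset.mul_sum, Finset.mul_sum, ← Finset.sum_add_distrib]
  refine Finset.sum_le_sum fun j _ => ?_
  have : β j + ((1 - t) • w + t • w') j = (1 - t) * (β j + w j) + t * (β j + w' j) := by
    simp only [Pi.add_apply, Pi.smul_apply, smul_eq_mul]; ring
  rw [this]
  refine (abs_add_le _ _).trans ?_
  rw [abs_mul, abs_mul, abs_of_nonneg ht0, abs_of_nonneg (sub_nonneg.2 ht1)]

lemma lcost_lineMap_le {σ lam : ℝ} (hlam : 0 ≤ lam) (β : Fin p → ℝ)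
    (ξ : GIdx (Fin n) (Option (Fin p)) → ℝ) (w w' : Fin p → ℝ) {t : ℝ} (ht0 : 0 ≤ t) (ht1 : t ≤ 1) :
    lcost σ lam β ξ ((1 - t) • w + t • w')
      ≤ (1 - t) * lcost σ lam β ξ w + t * lcost σ lam β ξ w' := by
  have h1 := mul_le_mul_of_nonneg_left (l1_lineMap_le β w w' ht0 ht1) hlam
  have h2 : ∑ i, resid σ ξ ((1 - t) • w + t • w') i ^ 2
      ≤ (1 - t) * ∑ i, resid σ ξ w i ^ 2 + t * ∑ i, resid σ ξ w' i ^ 2 := by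
    rw [Finset.mul_sum, Finset.mul_sum, ← Finset.sum_add_distrib]
    refine Finset.sum_le_sum fun i _ => ?_
    rw [resid_lineMap]
    nlinarith [mul_nonneg (mul_nonneg ht0 (sub_nonneg.2 ht1))
      (sq_nonneg (resid σ ξ w i - resid σ ξ w' i))]
  unfold lcost
  nlinarith

/-- The saddle function whose maximum over `u` is the Lasso objective. -/
lemma saddle_le_lcost (σ lam : ℝ) (β : Fin p → ℝ) (ξ : GIdx (Fin n) (Option (Fin p)) → ℝ)
    (w : Fin p → ℝ) (u : Fin n → ℝ) :
    ∑ i, u i * resid σ ξ w i - (1 / 2) * ∑ i, u i ^ 2 + lam * ∑ j, |β j + w j|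
      ≤ lcost σ lam β ξ w := by
  have : ∑ i, u i * resid σ ξ w i ≤ ∑ i, ((1 / 2) * u i ^ 2 + (1 / 2) * resid σ ξ w i ^ 2) :=
    Finset.sum_le_sum fun i _ => by nlinarith [sq_nonneg (u i - resid σ ξ w i)]
  rw [Finset.sum_add_distrib, ← Finset.mul_sum, ← Finset.mul_sum] at this
  unfold lcost
  linarith

/-- A constrained minimizer of the Lasso objective is part of a saddle point. -/
lemma lcost_le_saddle {σ lam : ℝ} (hlam : 0 ≤ lam) {β : Fin p → ℝ}
    {ξ : GIdx (Fin n) (Option (Fin p)) → ℝ} {C : Set (Fin p → ℝ)} (hC : Convex ℝ C)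
    {w₀ : Fin p → ℝ} (hw₀ : w₀ ∈ C) (hmin : ∀ w ∈ C, lcost σ lam β ξ w₀ ≤ lcost σ lam β ξ w)
    {w : Fin p → ℝ} (hw : w ∈ C) :
    lcost σ lam β ξ w₀ ≤ ∑ i, resid σ ξ w₀ i * resid σ ξ w i
      - (1 / 2) * ∑ i, resid σ ξ w₀ i ^ 2 + lam * ∑ j, |β j + w j| := by
  set r₀ := resid σ ξ w₀
  set r := resid σ ξ w
  set A := ∑ i, r₀ i * r i
  set P := ∑ i, r₀ i ^ 2
  set Q := ∑ i, r i ^ 2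
  set l₀ := ∑ j, |β j + w₀ j|
  set l := ∑ j, |β j + w j|
  have key : ∀ t : ℝ, 0 < t → t ≤ 1 →
      0 ≤ (A - P + lam * (l - l₀)) + t * ((1 / 2) * (P - 2 * A + Q)) := by
    intro t ht ht1
    have h1 := hmin _ (hC hw₀ hw (sub_nonneg.2 ht1) ht.le (by ring))
    have h2 := mul_le_mul_of_nonneg_left (l1_lineMap_le β w₀ w ht.le ht1) hlam
    have h3 : ∑ i, resid σ ξ ((1 - t) • w₀ + t • w) i ^ 2
        = (1 - t) ^ 2 * P + 2 * (t * (1 - t)) * A + t ^ 2 * Q := by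
      simp only [P, A, Q, Finset.mul_sum]
      rw [← Finset.sum_add_distrib, ← Finset.sum_add_distrib]
      refine Finset.sum_congr rfl fun i _ => ?_
      rw [resid_lineMap]; ring
    unfold lcost at h1
    rw [h3] at h1
    have h4 : 0 ≤ t * ((A - P + lam * (l - l₀)) + t * ((1 / 2) * (P - 2 * A + Q))) := by
      change (1 / 2) * P + lam * l₀ ≤ _ at h1
      nlinarith
    exact nonneg_of_mul_nonneg_right (by linarith) ht
  have hlim : Tendsto (fun t : ℝ => (A - P + lam * (l - l₀)) + t * ((1 / 2) * (P - 2 * A + Q)))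
      (𝓝[>] 0) (𝓝 ((A - P + lam * (l - l₀)) + 0 * ((1 / 2) * (P - 2 * A + Q)))) := by
    refine Tendsto.mono_left ?_ nhdsWithin_le_nhds
    exact Continuous.tendsto (by fun_prop) 0
  have := ge_of_tendsto hlim (by
    filter_upwards [Ioc_mem_nhdsGT (show (0 : ℝ) < 1 by norm_num)] with t ht
    exact key t ht.1 ht.2)
  change (1 / 2) * P + lam * l₀ ≤ _
  linarith

/-- Gordon's inequality for the upper bound on the Lasso objective. -/
lemma lasso_gordon_upper (μ : Measure (Fin p → ℝ)) [SFinite μ] (σ lam R B : ℝ) {c c' : ℝ}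
    (hc : c < c') :
    μ.prod (stdGauss (GIdx (Fin n) (Option (Fin p))))
      {z | ∀ u : Fin n → ℝ, l2 u < R → ∃ w : Fin p → ℝ, l2 w < B ∧
        c' < -(l2 (extVec n σ w) * ∑ r, z.2 (.inr (.inl r)) * u r
          - l2 u * ∑ s, z.2 (.inr (.inr (.inl s))) * extVec n σ w s)
          + ((1 / 2) * ∑ r, u r ^ 2 - lam * ∑ j, |z.1 j + w j|)}
    ≤ μ.prod (stdGauss (GIdx (Fin n) (Option (Fin p))))
      {z | ∀ u : Fin n → ℝ, l2 u < R → ∃ w : Fin p → ℝ, l2 w ≤ B ∧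
        c ≤ -(∑ r, u r * resid σ z.2 w r
            + z.2 (.inr (.inr (.inr ()))) * (l2 u * l2 (extVec n σ w)))
          + ((1 / 2) * ∑ r, u r ^ 2 - lam * ∑ j, |z.1 j + w j|)} := by
  have hext : Continuous (extVec n σ : (Fin p → ℝ) → _) :=
    continuous_pi fun s => continuous_extVec σ s
  have := gordon_continuous (X := Fin n → ℝ) (Y := Fin p → ℝ) μ
    (fun u w => -priVec u (extVec n σ w)) (fun u w => -auxVec u (extVec n σ w))
    (fun β u w => (1 / 2) * ∑ r, u r ^ 2 - lam * ∑ j, |β j + w j|)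
    (fun u _ => l2 u < R)
    (fun k => (continuous_priVec continuous_fst (hext.comp continuous_snd) k).neg)
    (fun k => (continuous_auxVec continuous_fst (hext.comp continuous_snd) k).neg)
    (fun β => by fun_prop) (fun u w => by fun_prop) (fun u => MeasurableSet.const _)
    (fun _ => isOpen_l2_lt R)
    (fun _ _ _ _ => by
      simp only [Pi.neg_apply, neg_mul_neg]; exact sum_priVec_auxVec _ _ _ _)
    (fun _ _ _ => by
      simp only [Pi.neg_apply, neg_mul_neg]; exact sum_priVec_eq_left _ _ _)
    (fun _ _ _ _ => by
      simp only [Pi.neg_apply, neg_mul_neg]; exact sum_auxVec_le_sum_priVec _ _ _ _)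
    (isOpen_l2_lt B) (isCompact_l2_le B)
    (fun w (hw : l2 w < B) => (hw.le : l2 w ≤ B)) hc
  simp only [Pi.neg_apply, neg_mul, Finset.sum_neg_distrib, sum_priVec, sum_auxVec] at this
  exact this

/-- Gordon's inequality for the lower bound on the Lasso objective. -/
lemma lasso_gordon_lower (μ : Measure (Fin p → ℝ)) [SFinite μ] (σ lam R : ℝ)
    (D : (Fin p → ℝ) → (Fin p → ℝ) → Prop) (hD : ∀ w, MeasurableSet {β | D w β})
    (hDo : ∀ β, IsOpen {w | D w β}) {c c' : ℝ} (hc : c < c') :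
    μ.prod (stdGauss (GIdx (Fin n) (Option (Fin p))))
      {z | ∀ w : Fin p → ℝ, D w z.1 → ∃ u : Fin n → ℝ, l2 u < R ∧
        c' < (l2 (extVec n σ w) * ∑ r, z.2 (.inr (.inl r)) * u r
          - l2 u * ∑ s, z.2 (.inr (.inr (.inl s))) * extVec n σ w s)
          + (-((1 / 2) * ∑ r, u r ^ 2) + lam * ∑ j, |z.1 j + w j|)}
    ≤ μ.prod (stdGauss (GIdx (Fin n) (Option (Fin p))))
      {z | ∀ w : Fin p → ℝ, D w z.1 → ∃ u : Fin n → ℝ, l2 u ≤ R ∧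
        c ≤ (∑ r, u r * resid σ z.2 w r
            + z.2 (.inr (.inr (.inr ()))) * (l2 u * l2 (extVec n σ w)))
          + (-((1 / 2) * ∑ r, u r ^ 2) + lam * ∑ j, |z.1 j + w j|)} := by
  have hext : Continuous (extVec n σ : (Fin p → ℝ) → _) :=
    continuous_pi fun s => continuous_extVec σ s
  have := gordon_continuous (X := Fin p → ℝ) (Y := Fin n → ℝ) μ
    (fun w u => priVec u (extVec n σ w)) (fun w u => auxVec u (extVec n σ w))
    (fun β w u => -((1 / 2) * ∑ r, u r ^ 2) + lam * ∑ j, |β j + w j|) D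
    (fun k => continuous_priVec continuous_snd (hext.comp continuous_fst) k)
    (fun k => continuous_auxVec continuous_snd (hext.comp continuous_fst) k)
    (fun β => by fun_prop) (fun u w => by fun_prop) hD hDo
    (fun _ _ _ _ => sum_priVec_auxVec _ _ _ _)
    (fun _ _ _ => sum_priVec_eq_right _ _ _)
    (fun _ _ _ _ => sum_auxVec_le_sum_priVec _ _ _ _)
    (isOpen_l2_lt R) (isCompact_l2_le R)
    (fun w (hw : l2 w < R) => (hw.le : l2 w ≤ R)) hc
  simp only [sum_priVec, sum_auxVec] at this
  exact this

end lasso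

section whp

variable {Ω : ℕ → Type*} [∀ p, MeasurableSpace (Ω p)]

/-- The filter of events holding with probability tending to one. -/
def whp (M : ∀ p, Measure (Ω p)) : Filter (Σ p, Ω p) where
  sets := {S | Tendsto (fun p => M p {x | (⟨p, x⟩ : Σ p, Ω p) ∉ S}) atTop (𝓝 0)}
  univ_sets := by
    have : ∀ p, {x : Ω p | (⟨p, x⟩ : Σ p, Ω p) ∉ (univ : Set (Σ p, Ω p))} = ∅ := by
      intro p; ext; simp
    change Tendsto _ _ _
    simp only [this, measure_empty]
    exact tendsto_const_nhds
  sets_of_superset := fun {S T} hS hST =>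
    tendsto_of_tendsto_of_tendsto_of_le_of_le tendsto_const_nhds hS (fun _ => zero_le)
      fun p => measure_mono fun x hx h => hx (hST h)
  inter_sets := fun {S T} hS hT => by
    have h := Tendsto.add (show Tendsto _ _ _ from hS) (show Tendsto _ _ _ from hT)
    rw [add_zero] at h
    refine tendsto_of_tendsto_of_tendsto_of_le_of_le tendsto_const_nhds h (fun _ => zero_le)
      fun p => (measure_mono ?_).trans (measure_union_le _ _)
    intro x hx
    by_cases hxS : (⟨p, x⟩ : Σ p, Ω p) ∈ S
    · exact Or.inr fun hxT => hx ⟨hxS, hxT⟩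
    · exact Or.inl hxS

lemma eventually_whp_iff {M : ∀ p, Measure (Ω p)} {Q : (Σ p, Ω p) → Prop} :
    (∀ᶠ x in whp M, Q x) ↔ Tendsto (fun p => M p {x | ¬ Q ⟨p, x⟩}) atTop (𝓝 0) := Iff.rfl

lemma tendsto_fst_whp (M : ∀ p, Measure (Ω p)) : Tendsto Sigma.fst (whp M) atTop := by
  refine tendsto_atTop.2 fun N => eventually_whp_iff.2 ?_
  refine tendsto_const_nhds.congr' ?_
  filter_upwards [eventually_ge_atTop N] with p hp
  simp [hp]

lemma tendsto_whp_map {M : ∀ p, Measure (Ω p)} {Ω' : ℕ → Type*} [∀ p, MeasurableSpace (Ω' p)]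
    {M' : ∀ p, Measure (Ω' p)} {T : ∀ p, Ω p → Ω' p} (hT : ∀ p, MeasurePreserving (T p) (M p) (M' p)) :
    Tendsto (fun x : Σ p, Ω p => (⟨x.1, T x.1 x.2⟩ : Σ p, Ω' p)) (whp M) (whp M') := by
  intro S hS
  refine tendsto_of_tendsto_of_tendsto_of_le_of_le tendsto_const_nhds hS (fun _ => zero_le)
    fun p => ?_
  rw [← (hT p).map_eq]
  exact Measure.le_map_apply (hT p).measurable.aemeasurable _

lemma eventually_whp_of_tendsto_one {M : ∀ p, Measure (Ω p)} [∀ p, IsProbabilityMeasure (M p)]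
    {S : ∀ p, Set (Ω p)} (hS : ∀ p, MeasurableSet (S p))
    (h : Tendsto (fun p => M p (S p)) atTop (𝓝 1)) : ∀ᶠ x in whp M, x.2 ∈ S x.1 := by
  refine eventually_whp_iff.2 ?_
  have h1 : ∀ p, M p {x | ¬ x ∈ S p} = 1 - M p (S p) := fun p => prob_compl_eq_one_sub (hS p)
  simp only [h1]
  have := ENNReal.Tendsto.sub (tendsto_const_nhds (x := (1 : ℝ≥0∞))) h (Or.inl (by simp))
  simpa using this

lemma tendsto_one_of_eventually_whp {M : ∀ p, Measure (Ω p)} [∀ p, IsProbabilityMeasure (M p)]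
    {Q : (Σ p, Ω p) → Prop} (h : ∀ᶠ x in whp M, Q x) :
    Tendsto (fun p => M p {x | Q ⟨p, x⟩}) atTop (𝓝 1) := by
  have h1 : Tendsto (fun p => 1 - M p {x | ¬ Q ⟨p, x⟩}) atTop (𝓝 1) := by
    have := ENNReal.Tendsto.sub (tendsto_const_nhds (x := (1 : ℝ≥0∞))) (eventually_whp_iff.1 h)
      (Or.inl (by simp))
    simpa using this
  refine tendsto_of_tendsto_of_tendsto_of_le_of_le h1 tendsto_const_nhds (fun p => ?_)
    fun p => prob_le_one
  refine tsub_le_iff_right.2 ?_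
  rw [← measure_univ (μ := M p)]
  refine (measure_mono ?_).trans (measure_union_le _ _)
  intro x _
  exact em _

lemma tendsto_whp_of_variance {M : ∀ p, Measure (Ω p)} [∀ p, IsProbabilityMeasure (M p)]
    {f : ∀ p, Ω p → ℝ} {c : ℝ} (hf : ∀ p, MemLp (f p) 2 (M p)) (hc : ∀ᶠ p in atTop, ∫ x, f p x ∂M p = c)
    (hv : Tendsto (fun p => Var[f p; M p]) atTop (𝓝 0)) :
    Tendsto (fun x : Σ p, Ω p => f x.1 x.2) (whp M) (𝓝 c) := by
  refine Metric.tendsto_nhds.2 fun r hr => eventually_whp_iff.2 ?_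
  have h1 : Tendsto (fun p => ENNReal.ofReal (Var[f p; M p] / r ^ 2)) atTop (𝓝 0) := by
    have := ENNReal.tendsto_ofReal (hv.div_const (r ^ 2))
    simpa using this
  refine tendsto_of_tendsto_of_tendsto_of_le_of_le' tendsto_const_nhds h1
    (Eventually.of_forall fun _ => zero_le) ?_
  filter_upwards [hc] with p hp
  refine le_trans (measure_mono ?_) (meas_ge_le_variance_div_sq (hf p) hr)
  intro x hx
  have hx' : ¬ dist (f p x) c < r := hx
  rw [Real.dist_eq, not_lt] at hx'
  change r ≤ |_ - _|
  rw [hp]; exact hx'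

lemma memLp_mean_pi {E : Type*} [MeasurableSpace E] (μ : Measure E) [IsProbabilityMeasure μ]
    {f : E → ℝ} (hf : MemLp f 2 μ) (m : ℕ) :
    MemLp (fun x : Fin m → E => (∑ i, f (x i)) / m) 2 (Measure.pi fun _ : Fin m => μ) := by
  simp only [div_eq_mul_inv]
  exact (memLp_finsetSum Finset.univ fun i _ =>
    hf.comp_measurePreserving (measurePreserving_eval (fun _ : Fin m => μ) i)).mul_const _

lemma integral_mean_pi {E : Type*} [MeasurableSpace E] (μ : Measure E) [IsProbabilityMeasure μ]
    {f : E → ℝ} (hf : MemLp f 2 μ) {m : ℕ} (hm : 1 ≤ m) :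
    ∫ x : Fin m → E, (∑ i, f (x i)) / m ∂(Measure.pi fun _ : Fin m => μ) = ∫ x, f x ∂μ := by
  have hi : ∀ i : Fin m, Integrable (fun x : Fin m → E => f (x i))
      (Measure.pi fun _ : Fin m => μ) := fun i =>
    (hf.comp_measurePreserving (measurePreserving_eval (fun _ : Fin m => μ) i)).integrable
      (by norm_num)
  rw [integral_div, integral_finsetSum _ fun i _ => hi i]
  have : ∀ i : Fin m, ∫ x : Fin m → E, f (x i) ∂(Measure.pi fun _ : Fin m => μ)
      = ∫ x, f x ∂μ := fun i => integral_comp_eval (μ := fun _ : Fin m => μ) hf.1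
  simp only [this, Finset.sum_const, Finset.card_univ, Fintype.card_fin, nsmul_eq_mul]
  have : (m : ℝ) ≠ 0 := by positivity
  field_simp

lemma variance_mean_pi {E : Type*} [MeasurableSpace E] (μ : Measure E) [IsProbabilityMeasure μ]
    {f : E → ℝ} (hf : MemLp f 2 μ) (m : ℕ) :
    Var[fun x : Fin m → E => (∑ i, f (x i)) / m; Measure.pi fun _ : Fin m => μ]
      = Var[f; μ] * (m : ℝ)⁻¹ := by
  have h2 : (fun x : Fin m → E => (∑ i, f (x i)) / m)
      = fun x => (m : ℝ)⁻¹ * (∑ i, fun x : Fin m → E => f (x i)) x := by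
    ext x; simp [div_eq_inv_mul]
  rw [h2, variance_const_mul, variance_sum_pi (X := fun (_ : Fin m) => f) fun _ => hf]
  simp only [Finset.sum_const, Finset.card_univ, Fintype.card_fin, nsmul_eq_mul]
  by_cases h0 : (m : ℝ) = 0
  · simp [h0]
  · field_simp

/-- The weak law of large numbers for triangular arrays of i.i.d. variables. -/
lemma tendsto_whp_mean {E : Type*} [MeasurableSpace E] (μ : Measure E) [IsProbabilityMeasure μ]
    {f : E → ℝ} (hf : MemLp f 2 μ) {m : ℕ → ℕ} (hm : Tendsto m atTop atTop) :
    Tendsto (fun x : Σ p, (Fin (m p) → E) => (∑ i, f (x.2 i)) / m x.1)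
      (whp fun p => Measure.pi fun _ : Fin (m p) => μ) (𝓝 (∫ x, f x ∂μ)) := by
  refine tendsto_whp_of_variance (Ω := fun p => Fin (m p) → E)
    (M := fun p => Measure.pi fun _ : Fin (m p) => μ) (f := fun p x => (∑ i, f (x i)) / m p)
    (fun p => memLp_mean_pi μ hf (m p)) ?_ ?_
  · filter_upwards [hm.eventually_ge_atTop 1] with p hp using integral_mean_pi μ hf hp
  · simp only [variance_mean_pi μ hf]
    have h3 : Tendsto (fun p => ((m p : ℝ))⁻¹) atTop (𝓝 0) :=
      tendsto_inv_atTop_zero.comp (tendsto_natCast_atTop_atTop.comp hm)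
    simpa using h3.const_mul (Var[f; μ])

end whp

/-- Selecting distinct coordinates of an i.i.d. family gives an i.i.d. family. -/
lemma measurePreserving_pi_comp {K A E : Type*} [Fintype K] [Fintype A] [MeasurableSpace E]
    (μ : Measure E) [IsProbabilityMeasure μ] {ι : A → K} (hι : Function.Injective ι) :
    MeasurePreserving (fun (x : K → E) a => x (ι a)) (Measure.pi fun _ : K => μ)
      (Measure.pi fun _ : A => μ) := by
  refine ⟨measurable_pi_lambda _ fun a => measurable_pi_apply _, ?_⟩
  have h := (iIndepFun_pi (μ := fun _ : K => μ) (X := fun _ x => x)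
    fun _ => aemeasurable_id).precomp hι
  rw [iIndepFun_iff_map_fun_eq_pi_map fun i => (measurable_pi_apply _).aemeasurable] at h
  rw [h]
  congr 1
  ext1 a
  exact (measurePreserving_eval (fun _ : K => μ) (ι a)).map_eq

lemma variance_eval_stdGauss {K : Type*} [Fintype K] (a : K) :
    Var[fun x : K → ℝ => x a; stdGauss K] = 1 := by
  have hmp := measurePreserving_eval (fun _ : K => gaussianReal 0 1) a
  have h := variance_map (μ := stdGauss K) (X := fun x : ℝ => x) (Y := fun x : K → ℝ => x a)
    aemeasurable_id (measurable_pi_apply a).aemeasurable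
  have h' : Measure.map (fun x : K → ℝ => x a) (stdGauss K) = gaussianReal 0 1 := hmp.map_eq
  rw [h'] at h
  exact h.symm.trans (variance_fun_id_gaussianReal.trans (by simp))

lemma memLp_eval_stdGauss {K : Type*} [Fintype K] (a : K) :
    MemLp (fun x : K → ℝ => x a) 2 (stdGauss K) :=
  (memLp_id_gaussianReal 2).comp_measurePreserving (f := fun x : K → ℝ => x a)
    (measurePreserving_eval (fun _ : K => gaussianReal 0 1) a)

lemma integral_eval_stdGauss {K : Type*} [Fintype K] (a : K) :
    ∫ x, x a ∂(stdGauss K) = 0 :=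
  (integral_comp_eval (μ := fun _ : K => gaussianReal 0 1)
      (f := fun x => x) aestronglyMeasurable_id).trans (by simp)

lemma tendsto_whp_gaussian_div {K : ℕ → Type*} [∀ p, Fintype (K p)] {m : ℕ → ℕ}
    (hm : Tendsto m atTop atTop) (a : ∀ p, K p) :
    Tendsto (fun x : Σ p, (K p → ℝ) => x.2 (a x.1) / √(m x.1))
      (whp fun p => stdGauss (K p)) (𝓝 0) := by
  refine tendsto_whp_of_variance (Ω := fun p => K p → ℝ)
    (M := fun p => stdGauss (K p)) (f := fun p x => x (a p) / √(m p)) (fun p => ?_)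
    (Eventually.of_forall fun p => ?_) ?_
  · simp only [div_eq_mul_inv]
    exact (memLp_eval_stdGauss (a p)).mul_const _
  · rw [integral_div, integral_eval_stdGauss, zero_div]
  · have h1 : ∀ p, Var[fun x : K p → ℝ => x (a p) / √(m p); stdGauss (K p)] = ((m p : ℝ))⁻¹ := by
      intro p
      simp only [div_eq_inv_mul]
      rw [variance_const_mul, variance_eval_stdGauss, mul_one, inv_pow,
        Real.sq_sqrt (Nat.cast_nonneg _)]
    simp only [h1]
    exact tendsto_inv_atTop_zero.comp (tendsto_natCast_atTop_atTop.comp hm)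

lemma softThr_cases {θ : ℝ} (hθ : 0 ≤ θ) (y : ℝ) :
    (θ < y ∧ softThr θ y = y - θ) ∨ (y < -θ ∧ softThr θ y = y + θ)
      ∨ (|y| ≤ θ ∧ softThr θ y = 0) := by
  rcases le_or_gt |y| θ with h | h
  · exact Or.inr (Or.inr ⟨h, by rw [softThr, max_eq_right (by linarith), mul_zero]⟩)
  · rcases lt_abs.1 h with h1 | h1
    · refine Or.inl ⟨h1, ?_⟩
      have hy : 0 < y := by linarith
      rw [softThr, Real.sign_of_pos hy, abs_of_pos hy, max_eq_left (by linarith), one_mul]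
    · refine Or.inr (Or.inl ⟨by linarith, ?_⟩)
      have hy : y < 0 := by linarith
      rw [softThr, Real.sign_of_neg hy, abs_of_neg hy, max_eq_left (by linarith)]
      ring

lemma softThr_eq_max_add_min {θ : ℝ} (hθ : 0 ≤ θ) (y : ℝ) :
    softThr θ y = max (y - θ) 0 + min (y + θ) 0 := by
  rcases softThr_cases hθ y with ⟨h, e⟩ | ⟨h, e⟩ | ⟨h, e⟩
  · rw [e, max_eq_left (by linarith), min_eq_right (by linarith), add_zero]
  · rw [e, max_eq_right (by linarith), min_eq_left (by linarith), zero_add]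
  · rw [e, max_eq_right (by linarith [(abs_le.1 h).2]), min_eq_right (by linarith [(abs_le.1 h).1]),
      add_zero]

lemma continuous_softThr {θ : ℝ} (hθ : 0 ≤ θ) : Continuous (softThr θ) := by
  rw [funext (softThr_eq_max_add_min hθ)]
  fun_prop

lemma abs_softThr_sub_le {θ : ℝ} (hθ : 0 ≤ θ) (y : ℝ) : |softThr θ y - y| ≤ θ := by
  rcases softThr_cases hθ y with ⟨h, e⟩ | ⟨h, e⟩ | ⟨h, e⟩ <;> rw [e]
  · rw [show y - θ - y = -θ by ring, abs_neg, abs_of_nonneg hθ]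
  · rw [show y + θ - y = θ by ring, abs_of_nonneg hθ]
  · rwa [zero_sub, abs_neg]

/-- Soft thresholding is the proximal map of the absolute value, with strong convexity gap. -/
lemma softThr_prox {θ : ℝ} (hθ : 0 ≤ θ) (x y : ℝ) :
    (1 / 2) * (softThr θ y - y) ^ 2 + θ * |softThr θ y| + (1 / 2) * (x - softThr θ y) ^ 2
      ≤ (1 / 2) * (x - y) ^ 2 + θ * |x| := by
  have h1 := mul_le_mul_of_nonneg_left (le_abs_self x) hθ
  have h2 := mul_le_mul_of_nonneg_left (neg_abs_le x) hθ
  rcases softThr_cases hθ y with ⟨h, e⟩ | ⟨h, e⟩ | ⟨h, e⟩ <;> rw [e]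
  · rw [abs_of_pos (by linarith : 0 < y - θ)]; nlinarith
  · rw [abs_of_neg (by linarith : y + θ < 0)]; nlinarith
  · have h3 : x * y ≤ θ * |x| := by
      calc x * y ≤ |x * y| := le_abs_self _
        _ = |y| * |x| := by rw [abs_mul, mul_comm]
        _ ≤ θ * |x| := by gcongr
    rw [abs_zero]; nlinarith

lemma scalar_objective_ge {κ τ lam θ : ℝ} (hκ : 0 < κ) (hτ : 0 < τ) (hθ : 0 ≤ θ)
    (hlam : lam * τ = κ * θ) (b h w : ℝ) :
    κ / (2 * τ) * (softThr θ (b + τ * h) - b) ^ 2 - κ * (h * (softThr θ (b + τ * h) - b))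
        + lam * |b + (softThr θ (b + τ * h) - b)|
        + κ / (2 * τ) * (w - (softThr θ (b + τ * h) - b)) ^ 2
      ≤ κ / (2 * τ) * w ^ 2 - κ * (h * w) + lam * |b + w| := by
  have h1 := mul_le_mul_of_nonneg_left (softThr_prox hθ (b + w) (b + τ * h))
    (div_pos hκ hτ).le
  rw [show lam = κ / τ * θ by field_simp; linarith]
  set e := softThr θ (b + τ * h)
  rw [show b + (e - b) = e by ring]
  have h2 : κ / (2 * τ) = κ / τ * (1 / 2) := by field_simp
  have h3 : κ = κ / τ * τ := by field_simp
  set r := κ / τ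
  rw [h2, h3]
  nlinarith

lemma abs_sqrt_sub_sqrt_le {σ b x y : ℝ} (hσ : 0 < σ) (hx : 0 ≤ x) (hy : 0 ≤ y)
    (hxb : x ≤ b) (hyb : y ≤ b) :
    |√(σ ^ 2 + x ^ 2) - √(σ ^ 2 + y ^ 2)| ≤ b / √(σ ^ 2 + b ^ 2) * |x - y| := by
  have hb : 0 ≤ b := hx.trans hxb
  have key : ∀ z, 0 ≤ z → z ≤ b → z ≤ b / √(σ ^ 2 + b ^ 2) * √(σ ^ 2 + z ^ 2) := by
    intro z hz hzb
    rw [div_mul_eq_mul_div, le_div_iff₀ (by positivity)]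
    refine abs_le_of_sq_le_sq' ?_ (by positivity) |>.2
    rw [mul_pow, mul_pow, Real.sq_sqrt (by positivity), Real.sq_sqrt (by positivity)]
    nlinarith [mul_le_mul hzb hzb hz hb, sq_nonneg σ]
  set ρ := b / √(σ ^ 2 + b ^ 2)
  have hsx : 0 < √(σ ^ 2 + x ^ 2) := by positivity
  have hsy : 0 < √(σ ^ 2 + y ^ 2) := by positivity
  have e : (√(σ ^ 2 + x ^ 2) - √(σ ^ 2 + y ^ 2)) * (√(σ ^ 2 + x ^ 2) + √(σ ^ 2 + y ^ 2))
      = (x - y) * (x + y) := by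
    have h1 := Real.sq_sqrt (show 0 ≤ σ ^ 2 + x ^ 2 by positivity)
    have h2 := Real.sq_sqrt (show 0 ≤ σ ^ 2 + y ^ 2 by positivity)
    nlinarith
  have h3 := congrArg abs e
  rw [abs_mul, abs_mul, abs_of_pos (add_pos hsx hsy), abs_of_nonneg (add_nonneg hx hy)] at h3
  refine le_of_mul_le_mul_right ?_ (add_pos hsx hsy)
  rw [h3]
  have := mul_le_mul_of_nonneg_left (add_le_add (key x hx hxb) (key y hy hyb)) (abs_nonneg (x - y))
  linarith

section auxiliary

variable {n p : ℕ}

/-- The error vector of the scalar denoising problems. -/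
noncomputable def softErr (θ τ : ℝ) (β h : Fin p → ℝ) : Fin p → ℝ :=
  fun i => softThr θ (β i + τ * h i) - β i

lemma sum_scalar_objective_ge {κ τ lam θ : ℝ} (hκ : 0 < κ) (hτ : 0 < τ) (hθ : 0 ≤ θ)
    (hlam : lam * τ = κ * θ) (β h w : Fin p → ℝ) :
    κ / (2 * τ) * l2 (softErr θ τ β h) ^ 2 - κ * ∑ i, h i * softErr θ τ β h i
        + lam * ∑ i, |β i + softErr θ τ β h i| + κ / (2 * τ) * l2 (w - softErr θ τ β h) ^ 2
      ≤ κ / (2 * τ) * l2 w ^ 2 - κ * ∑ i, h i * w i + lam * ∑ i, |β i + w i| := by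
  have := Finset.sum_le_sum fun i (_ : i ∈ Finset.univ) =>
    scalar_objective_ge hκ hτ hθ hlam (β i) (h i) (w i)
  simp only [Finset.sum_add_distrib, Finset.sum_sub_distrib, ← Finset.mul_sum] at this
  simp only [sq_l2, Pi.sub_apply]
  exact this

lemma l2_extVec_eq_sqrt (σ : ℝ) (w : Fin p → ℝ) :
    l2 (extVec n σ w) = √(σ ^ 2 + (l2 w / √n) ^ 2) := by
  rw [div_pow, Real.sq_sqrt (Nat.cast_nonneg n), ← sq_l2_extVec, Real.sqrt_sq (l2_nonneg _)]

lemma abs_l2_sub_le (x y : Fin p → ℝ) : |l2 x - l2 y| ≤ l2 (x - y) := by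
  have h1 := l2_add_le (x - y) y
  have h2 := l2_add_le (y - x) x
  rw [sub_add_cancel] at h1 h2
  rw [← neg_sub x y, l2_neg] at h2
  exact abs_le.2 ⟨by linarith, by linarith⟩

set_option maxHeartbeats 1000000 in
/-- Deterministic lower bound on the auxiliary objective around the denoising error. -/
lemma aux_objective_ge {κ τ lam θ σ b : ℝ} (hκ : 0 < κ) (hτ : 0 < τ) (hθ : 0 ≤ θ)
    (hlam : lam * τ = κ * θ) (hσ : 0 < σ) (hn : 0 < n) (β h w : Fin p → ℝ) (G H : ℝ)
    (hw : l2 w / √n ≤ b) (hw' : l2 (softErr θ τ β h) / √n ≤ b) :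
    (κ * (l2 (extVec n σ (softErr θ τ β h)) ^ 2 / (2 * τ) + τ / 2
          - (∑ i, h i * softErr θ τ β h i) / n) - κ ^ 2 / 2
        + lam * ((∑ i, |β i + softErr θ τ β h i|) / n))
      + κ / (2 * τ) * ((1 - (b / √(σ ^ 2 + b ^ 2)) ^ 2) * (l2 (w - softErr θ τ β h) / √n) ^ 2
        - 2 * (2 * b) * |l2 (extVec n σ (softErr θ τ β h)) - τ|
        - (l2 (extVec n σ (softErr θ τ β h)) - τ) ^ 2)
      - κ * √(σ ^ 2 + b ^ 2) * |G - 1| - κ * |H|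
    ≤ κ * (l2 (extVec n σ w) * G - H - (∑ i, h i * w i) / n) - κ ^ 2 / 2
        + lam * ((∑ i, |β i + w i|) / n) := by
  have hn' : (0 : ℝ) < n := by exact_mod_cast hn
  have hsn : 0 < √(n : ℝ) := Real.sqrt_pos.2 hn'
  set w' := softErr θ τ β h
  have h1 := div_le_div_of_nonneg_right (sum_scalar_objective_ge hκ hτ hθ hlam β h w) hn'.le
  change (κ / (2 * τ) * l2 w' ^ 2 - κ * ∑ i, h i * w' i
        + lam * ∑ i, |β i + w' i| + κ / (2 * τ) * l2 (w - w') ^ 2) / n ≤ _ at h1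
  set N := l2 (extVec n σ w) with hN
  set N' := l2 (extVec n σ w') with hN'
  have hNsq : N ^ 2 = σ ^ 2 + l2 w ^ 2 / n := sq_l2_extVec σ w
  have hNsq' : N' ^ 2 = σ ^ 2 + l2 w' ^ 2 / n := sq_l2_extVec σ w'
  have hN0 : 0 ≤ N := l2_nonneg _
  set d := l2 (w - w') / √n with hd
  have hd0 : 0 ≤ d := div_nonneg (l2_nonneg _) hsn.le
  have hdsq : d ^ 2 = l2 (w - w') ^ 2 / n := by
    rw [hd, div_pow, Real.sq_sqrt hn'.le]
  set ρ := b / √(σ ^ 2 + b ^ 2) with hρ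
  have hb0 : 0 ≤ b := (div_nonneg (l2_nonneg _) hsn.le).trans hw
  have hρ0 : 0 ≤ ρ := by positivity
  have hρ1 : ρ ≤ 1 := by
    rw [hρ, div_le_one (by positivity)]
    exact Real.le_sqrt_of_sq_le (by nlinarith [sq_nonneg σ])
  have hlip : |N - N'| ≤ ρ * d := by
    rw [hN, hN', l2_extVec_eq_sqrt, l2_extVec_eq_sqrt]
    refine (abs_sqrt_sub_sqrt_le hσ (div_nonneg (l2_nonneg _) hsn.le)
      (div_nonneg (l2_nonneg _) hsn.le) hw hw').trans ?_
    rw [← sub_div, abs_div, abs_of_pos hsn]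
    exact mul_le_mul_of_nonneg_left (div_le_div_of_nonneg_right (abs_l2_sub_le w w') hsn.le) hρ0
  have hNle : N ≤ √(σ ^ 2 + b ^ 2) := by
    rw [hN, l2_extVec_eq_sqrt]
    refine Real.sqrt_le_sqrt ?_
    have := div_nonneg (l2_nonneg w) hsn.le
    gcongr
  have hd2 : d ≤ 2 * b := by
    have h2 : l2 (w - w') ≤ l2 w + l2 w' := by
      have := l2_add_le w (-w')
      rwa [l2_neg, ← sub_eq_add_neg] at this
    have := div_le_div_of_nonneg_right h2 hsn.le
    rw [add_div] at this
    linarith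
  have hsq : (N - τ) ^ 2 ≤ ρ ^ 2 * d ^ 2 + 2 * (2 * b) * |N' - τ| + (N' - τ) ^ 2 := by
    have h3 : |N - τ| ≤ ρ * d + |N' - τ| := by
      calc |N - τ| = |(N - N') + (N' - τ)| := by ring_nf
        _ ≤ _ := (abs_add_le _ _).trans (by linarith)
    have h4 : |N - τ| ^ 2 ≤ (ρ * d + |N' - τ|) ^ 2 := by gcongr
    rw [sq_abs] at h4
    have h5 : ρ * d ≤ 2 * b := by nlinarith
    have h6 := mul_le_mul_of_nonneg_right h5 (abs_nonneg (N' - τ))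
    have h7 := sq_abs (N' - τ)
    nlinarith
  have hG : -(√(σ ^ 2 + b ^ 2) * |G - 1|) ≤ N * (G - 1) := by
    have h8 := mul_le_mul hNle le_rfl (abs_nonneg (G - 1)) (Real.sqrt_nonneg _)
    have h9 : |N * (G - 1)| = N * |G - 1| := by rw [abs_mul, abs_of_nonneg hN0]
    linarith [neg_abs_le (N * (G - 1))]
  have hH : -|H| ≤ -H := neg_le_neg (le_abs_self H)
  have hNform : N = N ^ 2 / (2 * τ) + τ / 2 - (N - τ) ^ 2 / (2 * τ) := by field_simp; ring
  have h10 : (κ / (2 * τ) * l2 w' ^ 2 - κ * ∑ i, h i * w' i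
        + lam * ∑ i, |β i + w' i| + κ / (2 * τ) * l2 (w - w') ^ 2) / n
      = κ / (2 * τ) * (N' ^ 2 - σ ^ 2) - κ * ((∑ i, h i * w' i) / n)
        + lam * ((∑ i, |β i + w' i|) / n) + κ / (2 * τ) * d ^ 2 := by
    rw [hdsq, hNsq']; ring
  have h11 : (κ / (2 * τ) * l2 w ^ 2 - κ * ∑ i, h i * w i + lam * ∑ i, |β i + w i|) / n
      = κ / (2 * τ) * (N ^ 2 - σ ^ 2) - κ * ((∑ i, h i * w i) / n)
        + lam * ((∑ i, |β i + w i|) / n) := by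
    rw [hNsq]; ring
  rw [h10, h11] at h1
  have hk : 0 < κ / (2 * τ) := by positivity
  have h12 := mul_le_mul_of_nonneg_left hsq hk.le
  have h13 := mul_le_mul_of_nonneg_left hG hκ.le
  have h14 := mul_le_mul_of_nonneg_left hH hκ.le
  have h15 : κ * N = κ / (2 * τ) * N ^ 2 + κ * (τ / 2) - κ / (2 * τ) * (N - τ) ^ 2 := by
    conv_lhs => rw [hNform]
    ring
  have h16 : κ * (N' ^ 2 / (2 * τ)) = κ / (2 * τ) * N' ^ 2 := by ring
  have e : ∀ Q : ℝ, κ * (N' ^ 2 / (2 * τ) + τ / 2 - Q) = κ * (N' ^ 2 / (2 * τ)) + κ * (τ / 2) - κ * Q :=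
    fun Q => by ring
  rw [e, h16]
  generalize κ / (2 * τ) = k at *
  generalize √(σ ^ 2 + b ^ 2) = s at *
  generalize |N' - τ| = a1 at *
  generalize |G - 1| = a2 at *
  generalize |H| = a3 at *
  generalize (∑ i, h i * w i) / (n : ℝ) = S at *
  generalize (∑ i, |β i + w i|) / (n : ℝ) = T at *
  generalize (∑ i, h i * w' i) / (n : ℝ) = S' at *
  generalize (∑ i, |β i + w' i|) / (n : ℝ) = T' at *
  clear_value d ρ N N'
  clear * - h1 h12 h13 h14 h15
  linarith

end auxiliary

/-- Coefficients and Gaussian coordinates of the coupled Lasso problem. -/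
abbrev LassoSpace (n p : ℕ) := (Fin p → ℝ) × (GIdx (Fin n) (Option (Fin p)) → ℝ)

/-- Law of the coefficients and of the Gaussian coordinates. -/
noncomputable abbrev lassoLaw (μ : Measure ℝ) (n p : ℕ) : Measure (LassoSpace n p) :=
  (Measure.pi fun _ : Fin p => μ).prod (stdGauss (GIdx (Fin n) (Option (Fin p))))

section coords

variable {n p : ℕ}

/-- The auxiliary Gaussian vector indexed by observations. -/
def gVec (ξ : GIdx (Fin n) (Option (Fin p)) → ℝ) : Fin n → ℝ := fun r => ξ (.inr (.inl r))

/-- The auxiliary Gaussian vector indexed by covariates. -/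
def hVec (ξ : GIdx (Fin n) (Option (Fin p)) → ℝ) : Fin p → ℝ :=
  fun j => ξ (.inr (.inr (.inl (some j))))

/-- The auxiliary Gaussian coordinate paired with the noise. -/
def hNoise (ξ : GIdx (Fin n) (Option (Fin p)) → ℝ) : ℝ := ξ (.inr (.inr (.inl none)))

/-- The auxiliary Gaussian scalar. -/
def zScal (ξ : GIdx (Fin n) (Option (Fin p)) → ℝ) : ℝ := ξ (.inr (.inr (.inr ())))

/-- The linear part of the normalized auxiliary problem. -/
noncomputable def auxLin (σ : ℝ) (ξ : GIdx (Fin n) (Option (Fin p)) → ℝ) (w : Fin p → ℝ) : ℝ :=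
  l2 (extVec n σ w) * (l2 (gVec ξ) / √n) - σ * (hNoise ξ / √n) - (∑ i, hVec ξ i * w i) / n

lemma auxLin_mul_sqrt (hn : 0 < n) (σ : ℝ) (ξ : GIdx (Fin n) (Option (Fin p)) → ℝ)
    (w : Fin p → ℝ) :
    auxLin σ ξ w * √n = l2 (extVec n σ w) * l2 (gVec ξ)
      - ∑ s, ξ (.inr (.inr (.inl s))) * extVec n σ w s := by
  have hn' : (0 : ℝ) < √n := Real.sqrt_pos.2 (by exact_mod_cast hn)
  rw [sum_mul_extVec σ w fun s => ξ (.inr (.inr (.inl s)))]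
  unfold auxLin hNoise hVec
  have h : (n : ℝ) = √n * √n := (Real.mul_self_sqrt (Nat.cast_nonneg n)).symm
  generalize (∑ j, ξ (.inr (.inr (.inl (some j)))) * w j) = S
  rw [show S / (n : ℝ) = S / (√n * √n) by rw [← h]]
  field_simp
  ring

lemma continuous_lcost_prod (σ lam : ℝ) : Continuous fun z : LassoSpace n p × (Fin p → ℝ) =>
    lcost σ lam z.1.1 z.1.2 z.2 := by
  unfold lcost resid
  have : ∀ s, Continuous fun z : LassoSpace n p × (Fin p → ℝ) => extVec n σ z.2 s :=
    fun s => (continuous_extVec σ s).comp continuous_snd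
  fun_prop

lemma measurable_lcost (σ lam : ℝ) (w : Fin p → ℝ) :
    Measurable fun z : LassoSpace n p => lcost σ lam z.1 z.2 w :=
  ((continuous_lcost_prod σ lam).comp (Continuous.prodMk_left w)).measurable

lemma measurableSet_exists_lcost_le (σ lam B c : ℝ) :
    MeasurableSet {z : LassoSpace n p | ∃ w, l2 w ≤ B ∧ lcost σ lam z.1 z.2 w ≤ c} := by
  have hf := continuous_lcost_prod (n := n) (p := p) σ lam
  generalize lcost (n := n) (p := p) σ lam = f at hf
  have hC : IsCompact {w : Fin p → ℝ | l2 w ≤ B} := isCompact_l2_le B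
  have : CompactSpace {w : Fin p → ℝ | l2 w ≤ B} := isCompact_iff_compactSpace.1 hC
  have h0 : Continuous fun z : LassoSpace n p × {w : Fin p → ℝ | l2 w ≤ B} =>
      f z.1.1 z.1.2 z.2.1 :=
    hf.comp (continuous_fst.prodMk (continuous_subtype_val.comp continuous_snd))
  have h1 : IsClosed {z : LassoSpace n p × {w : Fin p → ℝ | l2 w ≤ B} |
      f z.1.1 z.1.2 z.2.1 ≤ c} := isClosed_le h0 continuous_const
  have h2 := isClosedMap_fst_of_compactSpace _ h1
  have h3 : {z : LassoSpace n p | ∃ w, l2 w ≤ B ∧ f z.1 z.2 w ≤ c}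
    = Prod.fst '' {z : LassoSpace n p × {w : Fin p → ℝ | l2 w ≤ B} |
      f z.1.1 z.1.2 z.2.1 ≤ c} := ?_
  · rw [h3]; exact h2.measurableSet
  ext x
  simp only [Set.mem_ofPred_eq, Set.mem_image]
  constructor
  · rintro ⟨w, hw, hxw⟩; exact ⟨(x, ⟨w, hw⟩), hxw, rfl⟩
  · rintro ⟨⟨_, w, hw⟩, hxw, rfl⟩; exact ⟨w, hw, hxw⟩

lemma measurableSet_forall_le_lcost (σ lam : ℝ) (D : (Fin p → ℝ) → (Fin p → ℝ) → Prop)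
    (hD : ∀ w, MeasurableSet {β | D w β}) (hDo : ∀ β, IsOpen {w | D w β})
    {f : LassoSpace n p → ℝ} (hf : Measurable f) :
    MeasurableSet {z : LassoSpace n p | ∀ w, D w z.1 → f z ≤ lcost σ lam z.1 z.2 w} := by
  obtain ⟨Q, hQc, hQ⟩ := TopologicalSpace.exists_countable_dense (Fin p → ℝ)
  have : {z : LassoSpace n p | ∀ w, D w z.1 → f z ≤ lcost σ lam z.1 z.2 w}
      = ⋂ w ∈ Q, {z : LassoSpace n p | D w z.1 → f z ≤ lcost σ lam z.1 z.2 w} := by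
    ext z
    simp only [Set.mem_ofPred_eq, Set.mem_iInter]
    refine ⟨fun h w _ => h w, fun h w hw => ?_⟩
    by_contra hlt
    rw [not_le] at hlt
    obtain ⟨w', hw'Q, hw'⟩ := hQ.exists_mem_open
      ((hDo z.1).inter (isOpen_lt (continuous_lcost σ lam z.1 z.2) continuous_const)) ⟨w, hw, hlt⟩
    exact absurd (h w' hw'Q hw'.1) (not_le.2 hw'.2)
  rw [this]
  refine MeasurableSet.biInter hQc fun w _ => ?_
  have h1 : MeasurableSet {z : LassoSpace n p | D w z.1} := measurable_fst (hD w)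
  have h2 : MeasurableSet {z : LassoSpace n p | f z ≤ lcost σ lam z.1 z.2 w} :=
    measurableSet_le hf (measurable_lcost σ lam w)
  have h3 : {z : LassoSpace n p | D w z.1 → f z ≤ lcost σ lam z.1 z.2 w}
      = {z | D w z.1}ᶜ ∪ {z | f z ≤ lcost σ lam z.1 z.2 w} := by
    ext z; simp only [Set.mem_ofPred_eq, Set.mem_union, Set.mem_compl_iff]; tauto
  rw [h3]
  exact h1.compl.union h2

lemma l2_extVec_le_of_le (hn : 0 < n) {σ b : ℝ} {w : Fin p → ℝ} (hw : l2 w ≤ b * √n) :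
    l2 (extVec n σ w) ≤ √(σ ^ 2 + b ^ 2) := by
  have hn' : (0 : ℝ) < √n := Real.sqrt_pos.2 (by exact_mod_cast hn)
  rw [l2_extVec_eq_sqrt]
  refine Real.sqrt_le_sqrt ?_
  have h1 : l2 w / √n ≤ b := (div_le_iff₀ hn').2 hw
  have h2 : 0 ≤ l2 w / √n := div_nonneg (l2_nonneg _) hn'.le
  gcongr

end coords

section gordon

variable (μ : Measure ℝ) [IsProbabilityMeasure μ] {n : ℕ → ℕ} {σ lam κ b : ℝ}

lemma tendsto_measure_one_of_subset {M : ∀ p, Measure (LassoSpace (n p) p)}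
    [∀ p, IsProbabilityMeasure (M p)] {Q : (Σ p, LassoSpace (n p) p) → Prop}
    (hQ : ∀ᶠ x in whp M, Q x) {S : ∀ p, Set (LassoSpace (n p) p)}
    (hS : ∀ p x, Q ⟨p, x⟩ → x ∈ S p) : Tendsto (fun p => M p (S p)) atTop (𝓝 1) :=
  tendsto_of_tendsto_of_tendsto_of_le_of_le (tendsto_one_of_eventually_whp hQ)
    tendsto_const_nhds (fun p => measure_mono fun x hx => hS p x hx) fun _ => prob_le_one

/-- A lower bound on the auxiliary objective on a set transfers to the Lasso objective. -/
lemma eventually_lt_lcost (hn : Tendsto n atTop atTop) (hκ : 0 < κ)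
    (hg : ∀ᶠ x in whp fun p => lassoLaw μ (n p) p, 0 < l2 (gVec x.2.2))
    (hz : Tendsto (fun x : Σ p, LassoSpace (n p) p => zScal x.2.2 / √(n x.1))
      (whp fun p => lassoLaw μ (n p) p) (𝓝 0))
    (D : ∀ p, (Fin p → ℝ) → (Fin p → ℝ) → Prop)
    (hD : ∀ p w, MeasurableSet {β | D p w β}) (hDo : ∀ p β, IsOpen {w | D p w β})
    (hDb : ∀ᶠ p in atTop, ∀ w β, D p w β → l2 w ≤ b * √(n p)) {K₁ K₂ : ℝ} (hK : K₁ < K₂)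
    (haux : ∀ᶠ x in whp fun p => lassoLaw μ (n p) p, ∀ w, D x.1 w x.2.1 →
      K₂ < κ * auxLin σ x.2.2 w - κ ^ 2 / 2 + lam * ((∑ i, |x.2.1 i + w i|) / n x.1)) :
    ∀ᶠ x in whp fun p => lassoLaw μ (n p) p, ∀ w, D x.1 w x.2.1 →
      n x.1 * K₁ < lcost σ lam x.2.1 x.2.2 w := by
  set K₃ := (K₁ + K₂) / 2 with hK₃
  have hnev : ∀ᶠ x in whp fun p => lassoLaw μ (n p) p, 0 < n x.1 :=
    (tendsto_fst_whp _).eventually (hn.eventually_gt_atTop 0)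
  have hauxset : Tendsto (fun p => lassoLaw μ (n p) p
      {z | ∀ w : Fin p → ℝ, D p w z.1 → ∃ u : Fin (n p) → ℝ, l2 u < (κ + 1) * √(n p) ∧
        n p * K₂ < (l2 (extVec (n p) σ w) * ∑ r, z.2 (.inr (.inl r)) * u r
          - l2 u * ∑ s, z.2 (.inr (.inr (.inl s))) * extVec (n p) σ w s)
          + (-((1 / 2) * ∑ r, u r ^ 2) + lam * ∑ j, |z.1 j + w j|)}) atTop (𝓝 1) := by
    refine tendsto_measure_one_of_subset (hnev.and (hg.and haux)) ?_
    rintro p z ⟨hnp, hgp, hz⟩ w hw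
    have hnp' : (0 : ℝ) < n p := by exact_mod_cast hnp
    have hsn : (0 : ℝ) < √(n p) := Real.sqrt_pos.2 hnp'
    change 0 < l2 (gVec z.2) at hgp
    set c := κ * √(n p) / l2 (gVec z.2) with hc
    have hc0 : 0 < c := by positivity
    have hl : l2 (c • gVec z.2) = κ * √(n p) := by
      rw [l2_smul, abs_of_pos hc0, hc]; field_simp
    refine ⟨c • gVec z.2, by rw [hl]; nlinarith, ?_⟩
    have h1 : ∑ r, z.2 (.inr (.inl r)) * (c • gVec z.2) r = κ * √(n p) * l2 (gVec z.2) := by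
      have : ∑ r, z.2 (.inr (.inl r)) * (c • gVec z.2) r = c * l2 (gVec z.2) ^ 2 := by
        rw [sq_l2, Finset.mul_sum]
        refine Finset.sum_congr rfl fun r _ => ?_
        simp only [Pi.smul_apply, smul_eq_mul, gVec]; ring
      rw [this, hc]; field_simp
    have h2 : ∑ r, (c • gVec z.2) r ^ 2 = κ ^ 2 * n p := by
      rw [← sq_l2, hl, mul_pow, Real.sq_sqrt hnp'.le]
    have h3 := auxLin_mul_sqrt hnp σ z.2 w
    rw [h1, h2, hl]
    have h4 := mul_lt_mul_of_pos_left (hz w hw) hnp'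
    refine h4.trans_eq ?_
    have h5 : (n p : ℝ) = √(n p) * √(n p) := (Real.mul_self_sqrt hnp'.le).symm
    calc (n p : ℝ) * (κ * auxLin σ z.2 w - κ ^ 2 / 2 + lam * ((∑ i, |z.1 i + w i|) / n p))
        = κ * √(n p) * (auxLin σ z.2 w * √(n p)) - (κ ^ 2 / 2) * n p
          + lam * (∑ i, |z.1 i + w i|) := by
            have : (n p : ℝ) * (lam * ((∑ i, |z.1 i + w i|) / n p))
              = lam * (∑ i, |z.1 i + w i|) := by field_simp
            rw [mul_add, this, mul_sub]
            have : (n p : ℝ) * (κ * auxLin σ z.2 w)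
              = κ * √(n p) * (auxLin σ z.2 w * √(n p)) := by
              conv_lhs => rw [h5]
              ring
            rw [this]; ring
      _ = _ := by rw [h3]; ring
  set r := √(σ ^ 2 + b ^ 2) with hr
  have hpri : Tendsto (fun p => lassoLaw μ (n p) p
      {z | ∀ w, D p w z.1 → n p * K₃ - |zScal z.2| * ((κ + 1) * √(n p) * r)
          ≤ lcost σ lam z.1 z.2 w}) atTop (𝓝 1) := by
    refine tendsto_of_tendsto_of_tendsto_of_le_of_le' hauxset tendsto_const_nhds ?_
      (Eventually.of_forall fun _ => prob_le_one)
    filter_upwards [hn.eventually_gt_atTop 0, hDb] with p hp hDb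
    have hp' : (0 : ℝ) < n p := by exact_mod_cast hp
    have hlt : n p * K₃ < n p * K₂ := mul_lt_mul_of_pos_left (by linarith) hp'
    refine (lasso_gordon_lower (Measure.pi fun _ : Fin p => μ) σ lam ((κ + 1) * √(n p)) (D p)
      (hD p) (hDo p) hlt).trans (measure_mono ?_)
    intro z hz w hw
    obtain ⟨u, hu, hz⟩ := hz w hw
    have h1 := saddle_le_lcost σ lam z.1 z.2 w u
    have h2 : z.2 (.inr (.inr (.inr ()))) * (l2 u * l2 (extVec (n p) σ w))
        ≤ |zScal z.2| * ((κ + 1) * √(n p) * r) := by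
      have h3 := l2_nonneg (extVec (n p) σ w)
      have h4 := l2_nonneg u
      have h5 : z.2 (.inr (.inr (.inr ()))) ≤ |zScal z.2| := le_abs_self _
      have h6 : l2 (extVec (n p) σ w) ≤ r := l2_extVec_le_of_le hp (hDb w z.1 hw)
      gcongr
    linarith
  have hmeas : ∀ p, MeasurableSet {z : LassoSpace (n p) p | ∀ w, D p w z.1 →
      n p * K₃ - |zScal z.2| * ((κ + 1) * √(n p) * r) ≤ lcost σ lam z.1 z.2 w} := fun p => by
    refine measurableSet_forall_le_lcost σ lam (D p) (hD p) (hDo p) ?_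
    unfold zScal
    fun_prop
  have hev := eventually_whp_of_tendsto_one hmeas hpri
  have hz' : Tendsto (fun x : Σ p, LassoSpace (n p) p =>
      |zScal x.2.2 / √(n x.1)| * ((κ + 1) * r)) (whp fun p => lassoLaw μ (n p) p) (𝓝 0) := by
    have := hz.abs.mul_const ((κ + 1) * r)
    rwa [abs_zero, zero_mul] at this
  filter_upwards [hev, hnev, hz'.eventually (gt_mem_nhds (show 0 < K₃ - K₁ by linarith))]
    with x hx hnx hzx w hw
  have hnx' : (0 : ℝ) < n x.1 := by exact_mod_cast hnx
  have hsn : (0 : ℝ) < √(n x.1) := Real.sqrt_pos.2 hnx'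
  have h1 := hx w hw
  have h2 := mul_lt_mul_of_pos_left hzx hnx'
  have h3 : (n x.1 : ℝ) * (|zScal x.2.2 / √(n x.1)| * ((κ + 1) * r))
      = |zScal x.2.2| * ((κ + 1) * √(n x.1) * r) := by
    rw [abs_div, abs_of_pos hsn]
    have h : (n x.1 : ℝ) = √(n x.1) * √(n x.1) := (Real.mul_self_sqrt hnx'.le).symm
    nth_rewrite 1 [h]
    field_simp
  rw [h3] at h2
  linarith

/-- An upper bound on the auxiliary objective at a point transfers to the Lasso objective. -/
lemma eventually_exists_lcost_le (hn : Tendsto n atTop atTop) (hlam : 0 ≤ lam)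
    {R : ℝ} (hR : 0 < R) (hb : 0 < b)
    (hz : Tendsto (fun x : Σ p, LassoSpace (n p) p => zScal x.2.2 / √(n x.1))
      (whp fun p => lassoLaw μ (n p) p) (𝓝 0))
    (h0 : ∀ᶠ x in whp fun p => lassoLaw μ (n p) p,
      2 * lcost σ lam x.2.1 x.2.2 0 < R ^ 2 * n x.1)
    (W : (Σ p, LassoSpace (n p) p) → ∀ p : ℕ, Fin p → ℝ)
    (hW : ∀ᶠ x in whp fun p => lassoLaw μ (n p) p, l2 (W x x.1) < b * √(n x.1))
    {K₁ K₂ : ℝ} (hK : K₁ < K₂)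
    (haux : ∀ᶠ x in whp fun p => lassoLaw μ (n p) p,
      auxLin σ x.2.2 (W x x.1) ^ 2 / 2 + lam * ((∑ i, |x.2.1 i + W x x.1 i|) / n x.1) < K₁) :
    ∀ᶠ x in whp fun p => lassoLaw μ (n p) p, ∃ w, l2 w ≤ b * √(n x.1) ∧
      lcost σ lam x.2.1 x.2.2 w ≤ n x.1 * K₂ := by
  set K₃ := (K₁ + K₂) / 2 with hK₃
  set r := √(σ ^ 2 + b ^ 2) with hr
  have hnev : ∀ᶠ x in whp fun p => lassoLaw μ (n p) p, 0 < n x.1 :=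
    (tendsto_fst_whp _).eventually (hn.eventually_gt_atTop 0)
  have hauxset : Tendsto (fun p => lassoLaw μ (n p) p
      {z | ∀ u : Fin (n p) → ℝ, l2 u < R * √(n p) → ∃ w : Fin p → ℝ, l2 w < b * √(n p) ∧
        -(n p * K₁) < -(l2 (extVec (n p) σ w) * ∑ r, z.2 (.inr (.inl r)) * u r
          - l2 u * ∑ s, z.2 (.inr (.inr (.inl s))) * extVec (n p) σ w s)
          + ((1 / 2) * ∑ r, u r ^ 2 - lam * ∑ j, |z.1 j + w j|)}) atTop (𝓝 1) := by
    refine tendsto_measure_one_of_subset (hnev.and (hW.and haux)) ?_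
    rintro p z ⟨hnp, hWp, hz⟩ u hu
    have hnp' : (0 : ℝ) < n p := by exact_mod_cast hnp
    change 0 < n p at hnp
    refine ⟨W ⟨p, z⟩ p, hWp, ?_⟩
    set w := W ⟨p, z⟩ p
    have h3 := auxLin_mul_sqrt hnp σ z.2 w
    change auxLin σ z.2 w ^ 2 / 2 + lam * ((∑ i, |z.1 i + w i|) / n p) < K₁ at hz
    have h4 := mul_lt_mul_of_pos_left hz hnp'
    have h5 : (n p : ℝ) * (lam * ((∑ i, |z.1 i + w i|) / n p)) = lam * (∑ i, |z.1 i + w i|) := by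
      field_simp
    rw [mul_add, h5] at h4
    have h6 : (n p : ℝ) * (auxLin σ z.2 w ^ 2 / 2) = (auxLin σ z.2 w * √(n p)) ^ 2 / 2 := by
      rw [mul_pow, Real.sq_sqrt hnp'.le]; ring
    rw [h6] at h4
    have h7 : ∑ r, z.2 (.inr (.inl r)) * u r ≤ l2 (gVec z.2) * l2 u := sum_mul_le_l2 (gVec z.2) u
    have h8 := mul_le_mul_of_nonneg_left h7 (l2_nonneg (extVec (n p) σ w))
    have h9 := sq_l2 u
    generalize auxLin σ z.2 w * √(n p) = a at h3 h4
    have h10 : l2 (extVec (n p) σ w) * (l2 (gVec z.2) * l2 u)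
        - l2 u * ∑ s, z.2 (.inr (.inr (.inl s))) * extVec (n p) σ w s = a * l2 u := by
      rw [h3]; ring
    nlinarith [sq_nonneg (l2 u - a)]
  have hmeas : ∀ p, MeasurableSet ({z : LassoSpace (n p) p | ∃ w, l2 w ≤ b * √(n p) ∧
        lcost σ lam z.1 z.2 w ≤ n p * K₂} ∪ ({z | R ^ 2 * n p ≤ 2 * lcost σ lam z.1 z.2 0} ∪
        {z | n p * (K₂ - K₃) ≤ |zScal z.2| * (R * √(n p) * r)})) := fun p => by
    refine (measurableSet_exists_lcost_le σ lam _ _).union (MeasurableSet.union ?_ ?_)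
    · exact measurableSet_le measurable_const ((measurable_lcost σ lam 0).const_mul 2)
    · refine measurableSet_le measurable_const ?_
      unfold zScal
      fun_prop
  have hpri : Tendsto (fun p => lassoLaw μ (n p) p
      ({z : LassoSpace (n p) p | ∃ w, l2 w ≤ b * √(n p) ∧
        lcost σ lam z.1 z.2 w ≤ n p * K₂} ∪ ({z | R ^ 2 * n p ≤ 2 * lcost σ lam z.1 z.2 0} ∪
        {z | n p * (K₂ - K₃) ≤ |zScal z.2| * (R * √(n p) * r)}))) atTop (𝓝 1) := by
    refine tendsto_of_tendsto_of_tendsto_of_le_of_le' hauxset tendsto_const_nhds ?_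
      (Eventually.of_forall fun _ => prob_le_one)
    filter_upwards [hn.eventually_gt_atTop 0] with p hp
    have hp' : (0 : ℝ) < n p := by exact_mod_cast hp
    have hlt : -(n p * K₃) < -(n p * K₁) :=
      neg_lt_neg (mul_lt_mul_of_pos_left (by linarith) hp')
    refine (lasso_gordon_upper (Measure.pi fun _ : Fin p => μ) σ lam (R * √(n p)) (b * √(n p))
      hlt).trans (measure_mono ?_)
    intro z hz
    simp only [Set.mem_union, Set.mem_ofPred_eq] at hz ⊢
    by_contra! hcon
    obtain ⟨hc1, hc2, hc3⟩ := hcon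
    have hne : {w : Fin p → ℝ | l2 w ≤ b * √(n p)}.Nonempty := ⟨0, by
      have : l2 (0 : Fin p → ℝ) = 0 := by rw [l2_eq_norm]; simp
      simp only [Set.mem_ofPred_eq, this]; positivity⟩
    obtain ⟨w₀, hw₀, hmin⟩ := (isCompact_l2_le (b * √(n p))).exists_isMinOn hne
      (continuous_lcost σ lam z.1 z.2).continuousOn
    have hmin' : ∀ w ∈ {w : Fin p → ℝ | l2 w ≤ b * √(n p)},
      lcost σ lam z.1 z.2 w₀ ≤ lcost σ lam z.1 z.2 w := fun w hw => hmin hw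
    have h0 : lcost σ lam z.1 z.2 w₀ ≤ lcost σ lam z.1 z.2 0 := hmin' 0 (by
      have : l2 (0 : Fin p → ℝ) = 0 := by rw [l2_eq_norm]; simp
      simp only [Set.mem_ofPred_eq, this]; positivity)
    have hu : l2 (resid σ z.2 w₀) < R * √(n p) := by
      refine lt_of_pow_lt_pow_left₀ 2 (by positivity) ?_
      rw [mul_pow, Real.sq_sqrt hp'.le, sq_l2]
      have : 0 ≤ lam * ∑ j, |z.1 j + w₀ j| := by positivity
      have h1 : lcost σ lam z.1 z.2 w₀
        = (1 / 2) * ∑ i, resid σ z.2 w₀ i ^ 2 + lam * ∑ j, |z.1 j + w₀ j| := rfl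
      linarith
    obtain ⟨w, hw, hzw⟩ := hz _ hu
    have h1 := lcost_le_saddle hlam (convex_l2_le (b * √(n p))) hw₀ hmin' hw
    have h2 : -(z.2 (.inr (.inr (.inr ()))) * (l2 (resid σ z.2 w₀) * l2 (extVec (n p) σ w)))
        ≤ |zScal z.2| * (R * √(n p) * r) := by
      have h3 := l2_nonneg (extVec (n p) σ w)
      have h4 := l2_nonneg (resid σ z.2 w₀)
      have h5 : -z.2 (.inr (.inr (.inr ()))) ≤ |zScal z.2| := neg_le_abs _
      have h6 : l2 (extVec (n p) σ w) ≤ r := l2_extVec_le_of_le hp hw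
      rw [← neg_mul]
      gcongr
    have h3 := hc1 w₀ hw₀
    nlinarith
  have hev := eventually_whp_of_tendsto_one hmeas hpri
  have hz' : Tendsto (fun x : Σ p, LassoSpace (n p) p =>
      |zScal x.2.2 / √(n x.1)| * (R * r)) (whp fun p => lassoLaw μ (n p) p) (𝓝 0) := by
    have := hz.abs.mul_const (R * r)
    rwa [abs_zero, zero_mul] at this
  filter_upwards [hev, hnev, h0, hz'.eventually (gt_mem_nhds (show 0 < K₂ - K₃ by linarith))]
    with x hx hnx h0 hzx
  have hnx' : (0 : ℝ) < n x.1 := by exact_mod_cast hnx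
  have hsn : (0 : ℝ) < √(n x.1) := Real.sqrt_pos.2 hnx'
  rcases hx with hx | hx | hx
  · exact hx
  · exact absurd h0 (not_lt.2 hx)
  · have h2 := mul_lt_mul_of_pos_left hzx hnx'
    have h3 : (n x.1 : ℝ) * (|zScal x.2.2 / √(n x.1)| * (R * r))
        = |zScal x.2.2| * (R * √(n x.1) * r) := by
      rw [abs_div, abs_of_pos hsn]
      have h : (n x.1 : ℝ) = √(n x.1) * √(n x.1) := (Real.mul_self_sqrt hnx'.le).symm
      nth_rewrite 1 [h]
      field_simp
    rw [h3] at h2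
    exact absurd h2 (not_lt.2 hx)

end gordon

lemma integrable_mul_gaussianPDFReal {g : ℝ → ℝ} (hg : Integrable g (gaussianReal 0 1)) :
    Integrable (fun x => g x * gaussianPDFReal 0 1 x) := by
  rw [gaussianReal_of_var_ne_zero 0 one_ne_zero] at hg
  rw [integrable_withDensity_iff (measurable_gaussianPDF 0 1)
    (Eventually.of_forall fun x => gaussianPDF_lt_top)] at hg
  simpa [toReal_gaussianPDF] using hg

lemma integrable_id_gaussian : Integrable (fun x : ℝ => x) (gaussianReal 0 1) :=
  (memLp_id_gaussianReal (μ := 0) (v := 1) 1).integrable le_rfl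

lemma integrable_sq_gaussian : Integrable (fun x : ℝ => x ^ 2) (gaussianReal 0 1) :=
  (memLp_id_gaussianReal (μ := 0) (v := 1) 2).integrable_sq

/-- Gaussian integration by parts for the positive part. -/
lemma integral_mul_max_gaussian (c : ℝ) :
    ∫ x, x * max (x - c) 0 ∂gaussianReal 0 1 = (gaussianReal 0 1).real (Ioi c) := by
  set φ := gaussianPDFReal 0 1
  have iφ : Integrable φ := integrable_gaussianPDFReal 0 1
  have i1 : Integrable (fun x => x * φ x) := integrable_mul_gaussianPDFReal integrable_id_gaussian
  have i2 : Integrable (fun x => x ^ 2 * φ x) :=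
    integrable_mul_gaussianPDFReal integrable_sq_gaussian
  have i3 : Integrable (fun x => (x - c) * φ x) := by
    refine (i1.sub (iφ.const_mul c)).congr (Eventually.of_forall fun x => ?_)
    simp only [Pi.sub_apply]; ring
  have i4 : Integrable (fun x => x * (x - c) * φ x) := by
    refine (i2.sub (i1.const_mul c)).congr (Eventually.of_forall fun x => ?_)
    simp only [Pi.sub_apply]; ring
  have hd : ∀ x, HasDerivAt (fun x => (x - c) * φ x) (φ x - x * (x - c) * φ x) x := fun x => by
    refine (((hasDerivAt_id x).sub_const c).mul (hasDerivAt_gaussianPDFReal x)).congr_deriv ?_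
    simp only [id]; change 1 * φ x + (x - c) * (-x * φ x) = _
    ring
  have i5 : Integrable (fun x => φ x - x * (x - c) * φ x) := iφ.sub i4
  have h0 := tendsto_zero_of_hasDerivAt_of_integrableOn_Ioi (a := c) (fun x _ => hd x)
    i5.integrableOn i3.integrableOn
  have h1 := integral_Ioi_of_hasDerivAt_of_tendsto' (a := c) (fun x _ => hd x) i5.integrableOn h0
  rw [integral_sub iφ.integrableOn i4.integrableOn, sub_self, zero_mul, sub_zero, sub_eq_zero] at h1
  rw [integral_gaussianReal_eq_integral_smul one_ne_zero]
  have h2 : (fun x => φ x • (x * max (x - c) 0))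
      = (Ioi c).indicator fun x => x * (x - c) * φ x := by
    ext x
    by_cases hx : c < x
    · rw [indicator_of_mem (by exact hx), max_eq_left (by linarith), smul_eq_mul]; ring
    · rw [indicator_of_notMem (by exact hx), max_eq_right (by linarith)]; simp
  change ∫ x, φ x • (x * max (x - c) 0) = _
  rw [h2, integral_indicator measurableSet_Ioi, ← h1, measureReal_def,
    gaussianReal_apply_eq_integral 0 one_ne_zero, ENNReal.toReal_ofReal]
  exact integral_nonneg fun x => gaussianPDFReal_nonneg _ _ _

lemma integral_mul_min_gaussian (c : ℝ) :
    ∫ x, x * min (x - c) 0 ∂gaussianReal 0 1 = (gaussianReal 0 1).real (Iio c) := by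
  have hm : (gaussianReal 0 1).map (fun x : ℝ => -x) = gaussianReal 0 1 := by
    rw [gaussianReal_map_neg]; simp
  have hmp : MeasurePreserving (fun x : ℝ => -x) (gaussianReal 0 1) (gaussianReal 0 1) :=
    ⟨measurable_neg, hm⟩
  have h1 := integral_mul_max_gaussian (-c)
  have h2 := hmp.integral_comp (MeasurableEquiv.neg ℝ).measurableEmbedding
    (fun x => x * max (x - -c) 0)
  rw [h1] at h2
  have h3 := hmp.measure_preimage (measurableSet_Ioi (a := -c)).nullMeasurableSet
  have h4 : (fun x : ℝ => -x) ⁻¹' (Ioi (-c)) = Iio c := by ext; simp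
  rw [h4] at h3
  rw [measureReal_def, h3, ← measureReal_def, ← h2]
  congr 1
  ext x
  rw [show -x - -c = -(x - c) by ring, show max (-(x - c)) 0 = - min (x - c) 0 by
    rw [← neg_zero, max_neg_neg, neg_zero]]
  ring

/-- Stein's identity for the soft-thresholding error. -/
lemma integral_mul_softThr_gaussian {θ τ : ℝ} (hθ : 0 ≤ θ) (hτ : 0 < τ) (b : ℝ) :
    ∫ h, h * (softThr θ (b + τ * h) - b) ∂gaussianReal 0 1
      = τ * (gaussianReal 0 1).real {h | θ < |b + τ * h|} := by
  have e : ∀ h, h * (softThr θ (b + τ * h) - b)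
      = τ * (h * max (h - (θ - b) / τ) 0) + τ * (h * min (h - (-θ - b) / τ) 0) - b * h := by
    intro h
    rw [softThr_eq_max_add_min hθ]
    have h1 : max (b + τ * h - θ) 0 = τ * max (h - (θ - b) / τ) 0 := by
      rw [mul_max_of_nonneg _ _ hτ.le, mul_zero]
      congr 1; field_simp; ring
    have h2 : min (b + τ * h + θ) 0 = τ * min (h - (-θ - b) / τ) 0 := by
      rw [mul_min_of_nonneg _ _ hτ.le, mul_zero]
      congr 1; field_simp; ring
    rw [h1, h2]; ring
  have i1 : ∀ c, Integrable (fun h : ℝ => h * max (h - c) 0) (gaussianReal 0 1) := fun c => by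
    refine (integrable_sq_gaussian.add (integrable_id_gaussian.norm.const_mul |c|)).mono'
      (by fun_prop) (Eventually.of_forall fun h => ?_)
    simp only [Real.norm_eq_abs, abs_mul, Pi.add_apply]
    have : |max (h - c) 0| ≤ |h| + |c| := by
      rw [abs_of_nonneg (le_max_right _ _)]
      exact max_le (by linarith [le_abs_self h, neg_abs_le c]) (by positivity)
    calc |h| * |max (h - c) 0| ≤ |h| * (|h| + |c|) := by gcongr
      _ = _ := by rw [← sq_abs h]; ring
  have i2 : ∀ c, Integrable (fun h : ℝ => h * min (h - c) 0) (gaussianReal 0 1) := fun c => by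
    refine (integrable_sq_gaussian.add (integrable_id_gaussian.norm.const_mul |c|)).mono'
      (by fun_prop) (Eventually.of_forall fun h => ?_)
    simp only [Real.norm_eq_abs, abs_mul, Pi.add_apply]
    have : |min (h - c) 0| ≤ |h| + |c| := by
      rw [abs_of_nonpos (min_le_right _ _), neg_le]
      exact le_min (by linarith [neg_abs_le h, le_abs_self c]) (by
        linarith [abs_nonneg h, abs_nonneg c])
    calc |h| * |min (h - c) 0| ≤ |h| * (|h| + |c|) := by gcongr
      _ = _ := by rw [← sq_abs h]; ring
  simp only [e]
  have i3 : Integrable (fun h : ℝ => τ * (h * max (h - (θ - b) / τ) 0)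
      + τ * (h * min (h - (-θ - b) / τ) 0)) (gaussianReal 0 1) :=
    ((i1 _).const_mul τ).add ((i2 _).const_mul τ)
  rw [integral_sub i3 (integrable_id_gaussian.const_mul b), integral_add ((i1 _).const_mul τ) ((i2 _).const_mul τ),
    integral_const_mul, integral_const_mul, integral_const_mul, integral_mul_max_gaussian,
    integral_mul_min_gaussian, integral_id_gaussianReal, mul_zero, sub_zero, ← mul_add]
  congr 1
  have hdisj : Disjoint (Ioi ((θ - b) / τ)) (Iio ((-θ - b) / τ)) := by
    rw [Set.disjoint_left]
    intro h (h1 : _ < h) (h2 : h < _)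
    rw [div_lt_iff₀ hτ] at h1
    rw [lt_div_iff₀ hτ] at h2
    linarith
  rw [← measureReal_union hdisj measurableSet_Iio]
  congr 1
  ext h
  simp only [Set.mem_union, Set.mem_Ioi, Set.mem_Iio, Set.mem_ofPred_eq, lt_abs,
    div_lt_iff₀ hτ, lt_div_iff₀ hτ]
  constructor
  · rintro (h | h)
    · left; linarith
    · right; linarith
  · rintro (h | h)
    · left; linarith
    · right; linarith

section stats

variable (μ : Measure ℝ) [IsProbabilityMeasure μ] {n : ℕ → ℕ} {δ σ θ τ : ℝ}

lemma measurePreserving_lassoLaw_pair (n p : ℕ) :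
    MeasurePreserving (fun (z : LassoSpace n p) (i : Fin p) => (z.1 i, hVec z.2 i))
      (lassoLaw μ n p) (Measure.pi fun _ : Fin p => μ.prod (gaussianReal 0 1)) := by
  have hinj : Function.Injective
      fun i : Fin p => (.inr (.inr (.inl (some i))) : GIdx (Fin n) (Option (Fin p))) := by
    intro i j h
    simpa using h
  have h1 := measurePreserving_pi_comp (gaussianReal 0 1) hinj
  have h2 := (MeasurePreserving.id (Measure.pi fun _ : Fin p => μ)).prod h1
  have h3 := (measurePreserving_arrowProdEquivProdArrow ℝ ℝ (Fin p) (fun _ => μ)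
    (fun _ => gaussianReal 0 1)).symm
  exact h3.comp h2

lemma measurePreserving_lassoLaw_coord {n p m : ℕ}
    {ι : Fin m → GIdx (Fin n) (Option (Fin p))} (hι : Function.Injective ι) :
    MeasurePreserving (fun (z : LassoSpace n p) (i : Fin m) => z.2 (ι i))
      (lassoLaw μ n p) (Measure.pi fun _ : Fin m => gaussianReal 0 1) :=
  (measurePreserving_pi_comp (gaussianReal 0 1) hι).comp measurePreserving_snd

lemma tendsto_whp_stat {f : ℝ × ℝ → ℝ} (hf : MemLp f 2 (μ.prod (gaussianReal 0 1))) :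
    Tendsto (fun x : Σ p, LassoSpace (n p) p => (∑ i, f (x.2.1 i, hVec x.2.2 i)) / x.1)
      (whp fun p => lassoLaw μ (n p) p) (𝓝 (∫ w, f w ∂μ.prod (gaussianReal 0 1))) := by
  have h1 : Tendsto (fun x : Σ p : ℕ, (Fin p → ℝ × ℝ) => (∑ i, f (x.2 i)) / (x.1 : ℝ))
      (whp fun p : ℕ => Measure.pi fun _ : Fin p => μ.prod (gaussianReal 0 1))
      (𝓝 (∫ w, f w ∂μ.prod (gaussianReal 0 1))) :=
    tendsto_whp_mean (μ.prod (gaussianReal 0 1)) hf (m := fun p => p) tendsto_id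
  have h2 := tendsto_whp_map (Ω := fun p => LassoSpace (n p) p) (Ω' := fun p => Fin p → ℝ × ℝ)
    (M := fun p => lassoLaw μ (n p) p)
    (M' := fun p => Measure.pi fun _ : Fin p => μ.prod (gaussianReal 0 1))
    (T := fun p z i => (z.1 i, hVec z.2 i)) fun p => measurePreserving_lassoLaw_pair μ (n p) p
  have h3 := h1.comp h2
  simp only [Function.comp_def] at h3
  exact h3

lemma tendsto_natCast_div_inv (hδ : 0 < δ)
    (hn : Tendsto (fun p => (n p : ℝ) / p) atTop (𝓝 δ)) :
    Tendsto (fun p : ℕ => (p : ℝ) / n p) atTop (𝓝 δ⁻¹) := by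
  refine (hn.inv₀ hδ.ne').congr fun p => ?_
  rw [inv_div]

lemma tendsto_atTop_of_ratio (hδ : 0 < δ)
    (hn : Tendsto (fun p => (n p : ℝ) / p) atTop (𝓝 δ)) : Tendsto n atTop atTop := by
  have h1 : Tendsto (fun p : ℕ => (n p : ℝ) / p * p) atTop atTop :=
    hn.pos_mul_atTop hδ tendsto_natCast_atTop_atTop
  rw [← tendsto_natCast_atTop_iff (R := ℝ)]
  refine h1.congr' ?_
  filter_upwards [eventually_gt_atTop 0] with p hp
  have : (0 : ℝ) < p := by exact_mod_cast hp
  field_simp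

lemma tendsto_whp_stat_div (hδ : 0 < δ) (hn : Tendsto (fun p => (n p : ℝ) / p) atTop (𝓝 δ))
    {f : ℝ × ℝ → ℝ} (hf : MemLp f 2 (μ.prod (gaussianReal 0 1))) :
    Tendsto (fun x : Σ p, LassoSpace (n p) p => (∑ i, f (x.2.1 i, hVec x.2.2 i)) / n x.1)
      (whp fun p => lassoLaw μ (n p) p)
      (𝓝 ((∫ w, f w ∂μ.prod (gaussianReal 0 1)) * δ⁻¹)) := by
  have h1 := tendsto_whp_stat μ (n := n) hf
  have h2 := (tendsto_natCast_div_inv hδ hn).comp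
    (tendsto_fst_whp fun p => lassoLaw μ (n p) p)
  refine (h1.mul h2).congr' ?_
  filter_upwards [(tendsto_fst_whp fun p => lassoLaw μ (n p) p).eventually
    (eventually_gt_atTop 0)] with x hx
  have hx' : (0 : ℝ) < x.1 := by exact_mod_cast hx
  simp only [Function.comp]
  field_simp

lemma tendsto_whp_coord_sq (hn : Tendsto n atTop atTop)
    (ι : ∀ p, Fin (n p) → GIdx (Fin (n p)) (Option (Fin p)))
    (hι : ∀ p, Function.Injective (ι p)) :
    Tendsto (fun x : Σ p, LassoSpace (n p) p => (∑ i, x.2.2 (ι x.1 i) ^ 2) / n x.1)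
      (whp fun p => lassoLaw μ (n p) p) (𝓝 1) := by
  have hf : MemLp (fun x : ℝ => x ^ 2) 2 (gaussianReal 0 1) := by
    rw [memLp_two_iff_integrable_sq (by fun_prop)]
    have := (memLp_id_gaussianReal (μ := 0) (v := 1) 4).integrable_norm_pow (by norm_num)
    refine this.congr (Eventually.of_forall fun x => ?_)
    simp only [id, Real.norm_eq_abs]
    have : |x| ^ 4 = (x ^ 2) ^ 2 := by rw [← sq_abs x]; ring
    simpa using this
  have h1 := (tendsto_whp_mean (gaussianReal 0 1) hf hn).comp
    (tendsto_whp_map fun p => measurePreserving_lassoLaw_coord μ (hι p))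
  have h2 : ∫ x, x ^ 2 ∂gaussianReal 0 1 = 1 := by
    have := variance_fun_id_gaussianReal (μ := 0) (v := 1)
    rw [variance_eq_integral (by fun_prop)] at this
    simpa using this
  rwa [h2] at h1

lemma tendsto_whp_gVec (hn : Tendsto n atTop atTop) :
    Tendsto (fun x : Σ p, LassoSpace (n p) p => l2 (gVec x.2.2) / √(n x.1))
      (whp fun p => lassoLaw μ (n p) p) (𝓝 1) := by
  have h := tendsto_whp_coord_sq μ hn (fun _ i => .inr (.inl i)) (fun _ _ _ h => by simpa using h)
  have := (Real.continuous_sqrt.tendsto 1).comp h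
  rw [Real.sqrt_one] at this
  refine this.congr fun x => ?_
  simp only [Function.comp]
  rw [Real.sqrt_div' _ (Nat.cast_nonneg _)]
  congr 1

lemma tendsto_whp_coord_div (hn : Tendsto n atTop atTop)
    (a : ∀ p, GIdx (Fin (n p)) (Option (Fin p))) :
    Tendsto (fun x : Σ p, LassoSpace (n p) p => x.2.2 (a x.1) / √(n x.1))
      (whp fun p => lassoLaw μ (n p) p) (𝓝 0) :=
  (tendsto_whp_gaussian_div hn a).comp (tendsto_whp_map (M := fun p => lassoLaw μ (n p) p)
    (T := fun _ z => z.2) fun _ => measurePreserving_snd)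

end stats

section moments

variable {μ : Measure ℝ} [IsProbabilityMeasure μ] {θ τ : ℝ}

lemma memLp_fst (hμ : Integrable (fun x => x ^ 2) μ) :
    MemLp (fun w : ℝ × ℝ => w.1) 2 (μ.prod (gaussianReal 0 1)) :=
  ((memLp_two_iff_integrable_sq (f := fun x : ℝ => x) (by fun_prop)).2 hμ).comp_measurePreserving
    (f := fun w : ℝ × ℝ => w.1) measurePreserving_fst

lemma memLp_snd : MemLp (fun w : ℝ × ℝ => w.2) 2 (μ.prod (gaussianReal 0 1)) :=
  (memLp_id_gaussianReal (μ := 0) (v := 1) 2).comp_measurePreserving measurePreserving_snd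

lemma memLp_snd_sq : MemLp (fun w : ℝ × ℝ => w.2 ^ 2) 2 (μ.prod (gaussianReal 0 1)) := by
  have hf : MemLp (fun x : ℝ => x ^ 2) 2 (gaussianReal 0 1) := by
    rw [memLp_two_iff_integrable_sq (by fun_prop)]
    have := (memLp_id_gaussianReal (μ := 0) (v := 1) 4).integrable_norm_pow (by norm_num)
    refine this.congr (Eventually.of_forall fun x => ?_)
    simp only [id, Real.norm_eq_abs]
    have : |x| ^ 4 = (x ^ 2) ^ 2 := by rw [← sq_abs x]; ring
    simpa using this
  exact hf.comp_measurePreserving measurePreserving_snd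

/-- The soft-thresholding error. -/
noncomputable def sErr (θ τ : ℝ) (w : ℝ × ℝ) : ℝ := softThr θ (w.1 + τ * w.2) - w.1

lemma continuous_sErr (hθ : 0 ≤ θ) : Continuous (sErr θ τ) := by
  have := continuous_softThr hθ
  unfold sErr
  fun_prop

lemma abs_sErr_le (hθ : 0 ≤ θ) (hτ : 0 < τ) (w : ℝ × ℝ) : |sErr θ τ w| ≤ θ + τ * |w.2| := by
  have h1 := abs_softThr_sub_le hθ (w.1 + τ * w.2)
  rw [sErr, show softThr θ (w.1 + τ * w.2) - w.1
    = (softThr θ (w.1 + τ * w.2) - (w.1 + τ * w.2)) + τ * w.2 by ring]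
  refine (abs_add_le _ _).trans ?_
  rw [abs_mul, abs_of_pos hτ]
  linarith

lemma memLp_sErr_sq (hθ : 0 ≤ θ) (hτ : 0 < τ) :
    MemLp (fun w => sErr θ τ w ^ 2) 2 (μ.prod (gaussianReal 0 1)) := by
  have hb : MemLp (fun w : ℝ × ℝ => 2 * θ ^ 2 + 2 * τ ^ 2 * w.2 ^ 2) 2
      (μ.prod (gaussianReal 0 1)) := by
    have h1 : MemLp (fun _ : ℝ × ℝ => 2 * θ ^ 2) 2 (μ.prod (gaussianReal 0 1)) := memLp_const _
    have h2 : MemLp (fun w : ℝ × ℝ => (2 * τ ^ 2) * w.2 ^ 2) 2 (μ.prod (gaussianReal 0 1)) :=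
      memLp_snd_sq.const_mul (2 * τ ^ 2)
    exact h1.add h2
  refine hb.mono' ((continuous_sErr hθ).pow 2).aestronglyMeasurable
    (Eventually.of_forall fun w => ?_)
  simp only [Real.norm_eq_abs, abs_pow]
  have h1 := abs_sErr_le hθ hτ w
  calc |sErr θ τ w| ^ 2 ≤ (θ + τ * |w.2|) ^ 2 := by gcongr
    _ ≤ _ := by
      rw [← sq_abs w.2]
      nlinarith [sq_nonneg (θ - τ * |w.2|)]

lemma memLp_mul_sErr (hθ : 0 ≤ θ) (hτ : 0 < τ) :
    MemLp (fun w => w.2 * sErr θ τ w) 2 (μ.prod (gaussianReal 0 1)) := by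
  refine ((memLp_snd.norm.const_mul θ).add (memLp_snd_sq.const_mul τ)).mono'
    (continuous_snd.mul (continuous_sErr hθ)).aestronglyMeasurable (Eventually.of_forall fun w => ?_)
  simp only [Pi.add_apply, Real.norm_eq_abs, abs_mul]
  have h1 := abs_sErr_le hθ hτ w
  calc |w.2| * |sErr θ τ w| ≤ |w.2| * (θ + τ * |w.2|) := by gcongr
    _ = _ := by rw [← sq_abs w.2]; ring

lemma memLp_abs_add_sErr (hμ : Integrable (fun x => x ^ 2) μ) (hθ : 0 ≤ θ) (hτ : 0 < τ) :
    MemLp (fun w => |w.1 + sErr θ τ w|) 2 (μ.prod (gaussianReal 0 1)) := by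
  refine ((memLp_const θ).add ((memLp_fst hμ).norm.add (memLp_snd.norm.const_mul τ))).mono'
    ((continuous_fst.add (continuous_sErr hθ)).abs).aestronglyMeasurable
    (Eventually.of_forall fun w => ?_)
  simp only [Pi.add_apply, Real.norm_eq_abs, abs_abs]
  have h1 := abs_sErr_le hθ hτ w
  linarith [abs_add_le w.1 (sErr θ τ w)]

lemma integral_mul_sErr (hθ : 0 ≤ θ) (hτ : 0 < τ) :
    ∫ w, w.2 * sErr θ τ w ∂μ.prod (gaussianReal 0 1)
      = τ * (μ.prod (gaussianReal 0 1)).real {w : ℝ × ℝ | θ < |w.1 + τ * w.2|} := by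
  have hm : MeasurableSet {w : ℝ × ℝ | θ < |w.1 + τ * w.2|} :=
    measurableSet_lt measurable_const (by fun_prop)
  rw [integral_prod _ ((memLp_mul_sErr hθ hτ).integrable (by norm_num))]
  simp only [sErr, integral_mul_softThr_gaussian hθ hτ]
  rw [integral_const_mul, measureReal_def, Measure.prod_apply hm, ← integral_toReal]
  · rfl
  · exact (measurable_measure_prodMk_left hm).aemeasurable
  · exact Eventually.of_forall fun _ => measure_lt_top _ _

end moments

section limits

variable {μ : Measure ℝ} [IsProbabilityMeasure μ] {n : ℕ → ℕ} {δ σ lam κ θ τ : ℝ}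

/-- The denoising error of the effective scalar model. -/
noncomputable abbrev effErr (θ τ : ℝ) {n p : ℕ} (z : LassoSpace n p) : Fin p → ℝ :=
  softErr θ τ z.1 (hVec z.2)

lemma tendsto_whp_sq_effErr (hδ : 0 < δ) (hn : Tendsto (fun p => (n p : ℝ) / p) atTop (𝓝 δ))
    (hθ : 0 ≤ θ) (hτ : 0 < τ)
    (hfix : τ ^ 2 = σ ^ 2 + δ⁻¹ * ∫ w, sErr θ τ w ^ 2 ∂μ.prod (gaussianReal 0 1)) :
    Tendsto (fun x : Σ p, LassoSpace (n p) p => (l2 (effErr θ τ x.2) / √(n x.1)) ^ 2)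
      (whp fun p => lassoLaw μ (n p) p) (𝓝 (τ ^ 2 - σ ^ 2)) := by
  have h := tendsto_whp_stat_div μ hδ hn (memLp_sErr_sq (μ := μ) hθ hτ)
  rw [show τ ^ 2 - σ ^ 2 = (∫ w, sErr θ τ w ^ 2 ∂μ.prod (gaussianReal 0 1)) * δ⁻¹ by
    rw [hfix]; ring]
  refine h.congr fun x => ?_
  rw [div_pow, sq_l2, Real.sq_sqrt (Nat.cast_nonneg _)]
  simp only [softErr, sErr]

lemma tendsto_whp_l2_ext_effErr (hδ : 0 < δ)
    (hn : Tendsto (fun p => (n p : ℝ) / p) atTop (𝓝 δ)) (hθ : 0 ≤ θ) (hτ : 0 < τ)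
    (hfix : τ ^ 2 = σ ^ 2 + δ⁻¹ * ∫ w, sErr θ τ w ^ 2 ∂μ.prod (gaussianReal 0 1)) :
    Tendsto (fun x : Σ p, LassoSpace (n p) p => l2 (extVec (n x.1) σ (effErr θ τ x.2)))
      (whp fun p => lassoLaw μ (n p) p) (𝓝 τ) := by
  have h := (tendsto_whp_sq_effErr hδ hn hθ hτ hfix).const_add (σ ^ 2)
  have h2 := (Real.continuous_sqrt.tendsto _).comp h
  rw [show σ ^ 2 + (τ ^ 2 - σ ^ 2) = τ ^ 2 by ring, Real.sqrt_sq hτ.le] at h2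
  refine h2.congr fun x => ?_
  rw [l2_extVec_eq_sqrt]
  rfl

lemma eventually_l2_effErr_lt (hδ : 0 < δ)
    (hn : Tendsto (fun p => (n p : ℝ) / p) atTop (𝓝 δ)) (hσ : 0 < σ) (hθ : 0 ≤ θ) (hτ : 0 < τ)
    (hfix : τ ^ 2 = σ ^ 2 + δ⁻¹ * ∫ w, sErr θ τ w ^ 2 ∂μ.prod (gaussianReal 0 1)) :
    ∀ᶠ x in whp fun p => lassoLaw μ (n p) p, l2 (effErr θ τ x.2) < τ * √(n x.1) := by
  have hnev : ∀ᶠ x in whp fun p => lassoLaw μ (n p) p, 0 < n x.1 :=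
    (tendsto_fst_whp _).eventually ((tendsto_atTop_of_ratio hδ hn).eventually_gt_atTop 0)
  have h := tendsto_whp_sq_effErr (n := n) hδ hn hθ hτ hfix
  filter_upwards [hnev, h.eventually (gt_mem_nhds (show τ ^ 2 - σ ^ 2 < τ ^ 2 by
    have := pow_pos hσ 2; linarith))] with x hx hlt
  have hx' : (0 : ℝ) < √(n x.1) := Real.sqrt_pos.2 (by exact_mod_cast hx)
  have := lt_of_pow_lt_pow_left₀ 2 hτ.le hlt
  rwa [div_lt_iff₀ hx'] at this

lemma tendsto_whp_inner_effErr (hδ : 0 < δ)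
    (hn : Tendsto (fun p => (n p : ℝ) / p) atTop (𝓝 δ)) (hθ : 0 ≤ θ) (hτ : 0 < τ)
    (hκ : κ = τ * (1 - δ⁻¹ * (μ.prod (gaussianReal 0 1)).real
      {w : ℝ × ℝ | θ < |w.1 + τ * w.2|})) :
    Tendsto (fun x : Σ p, LassoSpace (n p) p => (∑ i, hVec x.2.2 i * effErr θ τ x.2 i) / n x.1)
      (whp fun p => lassoLaw μ (n p) p) (𝓝 (τ - κ)) := by
  have h := tendsto_whp_stat_div μ hδ hn (memLp_mul_sErr (μ := μ) hθ hτ)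
  rw [integral_mul_sErr hθ hτ] at h
  rw [show τ - κ = τ * (μ.prod (gaussianReal 0 1)).real {w : ℝ × ℝ | θ < |w.1 + τ * w.2|} * δ⁻¹ by
    rw [hκ]; ring]
  refine h.congr fun x => ?_
  simp only [softErr, sErr]

lemma tendsto_whp_abs_effErr (hμ : Integrable (fun x => x ^ 2) μ) (hδ : 0 < δ)
    (hn : Tendsto (fun p => (n p : ℝ) / p) atTop (𝓝 δ)) (hθ : 0 ≤ θ) (hτ : 0 < τ) :
    Tendsto (fun x : Σ p, LassoSpace (n p) p => (∑ i, |x.2.1 i + effErr θ τ x.2 i|) / n x.1)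
      (whp fun p => lassoLaw μ (n p) p)
      (𝓝 ((∫ w, |w.1 + sErr θ τ w| ∂μ.prod (gaussianReal 0 1)) * δ⁻¹)) := by
  have h := tendsto_whp_stat_div μ hδ hn (memLp_abs_add_sErr hμ hθ hτ)
  refine h.congr fun x => ?_
  simp only [softErr, sErr]

lemma tendsto_whp_auxLin (hδ : 0 < δ)
    (hn : Tendsto (fun p => (n p : ℝ) / p) atTop (𝓝 δ)) (hθ : 0 ≤ θ) (hτ : 0 < τ)
    (hfix : τ ^ 2 = σ ^ 2 + δ⁻¹ * ∫ w, sErr θ τ w ^ 2 ∂μ.prod (gaussianReal 0 1))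
    (hκ : κ = τ * (1 - δ⁻¹ * (μ.prod (gaussianReal 0 1)).real
      {w : ℝ × ℝ | θ < |w.1 + τ * w.2|})) :
    Tendsto (fun x : Σ p, LassoSpace (n p) p => auxLin σ x.2.2 (effErr θ τ x.2))
      (whp fun p => lassoLaw μ (n p) p) (𝓝 κ) := by
  have hn' := tendsto_atTop_of_ratio hδ hn
  have h1 := (tendsto_whp_l2_ext_effErr (μ := μ) hδ hn hθ hτ hfix).mul (tendsto_whp_gVec μ hn')
  have h2 := (tendsto_whp_coord_div μ hn' fun p => .inr (.inr (.inl none))).const_mul σ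
  have h3 := (h1.sub h2).sub (tendsto_whp_inner_effErr (μ := μ) hδ hn hθ hτ hκ)
  rw [show τ * 1 - σ * 0 - (τ - κ) = κ by ring] at h3
  exact h3

lemma tendsto_whp_lcost_zero (hμ : Integrable (fun x => x ^ 2) μ) (hδ : 0 < δ)
    (hn : Tendsto (fun p => (n p : ℝ) / p) atTop (𝓝 δ)) :
    Tendsto (fun x : Σ p, LassoSpace (n p) p => lcost σ lam x.2.1 x.2.2 0 / n x.1)
      (whp fun p => lassoLaw μ (n p) p)
      (𝓝 (1 / 2 * (σ ^ 2 * 1) + lam * ((∫ w, |w.1| ∂μ.prod (gaussianReal 0 1)) * δ⁻¹))) := by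
  have hn' := tendsto_atTop_of_ratio hδ hn
  have h1 := tendsto_whp_coord_sq μ hn' (fun p i => .inl (i, none))
    (fun _ _ _ h => by simpa using h)
  have h2 := tendsto_whp_stat_div μ hδ hn (f := fun w => |w.1|) (memLp_fst hμ).norm
  refine (((h1.const_mul (σ ^ 2)).const_mul (1 / 2)).add (h2.const_mul lam)).congr fun x => ?_
  have h3 : ∀ i, resid σ x.2.2 (0 : Fin x.1 → ℝ) i = σ * x.2.2 (.inl (i, none)) := fun i => by
    unfold resid
    rw [sum_mul_extVec σ 0 fun s => x.2.2 (.inl (i, s))]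
    simp [mul_comm]
  simp only [lcost, h3, Pi.zero_apply, add_zero, mul_pow, ← Finset.mul_sum]
  ring

/-- The limiting value of the normalized Lasso objective. -/
noncomputable def lassoValue (μ : Measure ℝ) (δ lam κ θ τ : ℝ) : ℝ :=
  κ ^ 2 / 2 + lam * ((∫ w, |w.1 + sErr θ τ w| ∂μ.prod (gaussianReal 0 1)) * δ⁻¹)

/-- With high probability the Lasso objective reaches its limiting value. -/
lemma eventually_exists_lcost_le_value (hμ : Integrable (fun x => x ^ 2) μ) (hδ : 0 < δ)
    (hn : Tendsto (fun p => (n p : ℝ) / p) atTop (𝓝 δ)) (hσ : 0 < σ) (hlam : 0 < lam)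
    (hθ : 0 ≤ θ) (hτ : 0 < τ)
    (hfix : τ ^ 2 = σ ^ 2 + δ⁻¹ * ∫ w, sErr θ τ w ^ 2 ∂μ.prod (gaussianReal 0 1))
    (hκ : κ = τ * (1 - δ⁻¹ * (μ.prod (gaussianReal 0 1)).real
      {w : ℝ × ℝ | θ < |w.1 + τ * w.2|})) {η : ℝ} (hη : 0 < η) :
    ∀ᶠ x in whp fun p => lassoLaw μ (n p) p, ∃ w, l2 w ≤ τ * √(n x.1) ∧
      lcost σ lam x.2.1 x.2.2 w ≤ n x.1 * (lassoValue μ δ lam κ θ τ + η) := by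
  have hn' := tendsto_atTop_of_ratio hδ hn
  have hnev : ∀ᶠ x in whp fun p => lassoLaw μ (n p) p, 0 < n x.1 :=
    (tendsto_fst_whp _).eventually (hn'.eventually_gt_atTop 0)
  set V := 1 / 2 * (σ ^ 2 * 1) + lam * ((∫ w, |w.1| ∂μ.prod (gaussianReal 0 1)) * δ⁻¹) with hV
  have hV0 : 0 ≤ V := by
    have : 0 ≤ ∫ w : ℝ × ℝ, |w.1| ∂μ.prod (gaussianReal 0 1) :=
      integral_nonneg fun _ => abs_nonneg _
    positivity
  refine eventually_exists_lcost_le μ hn' hlam.le (R := √(2 * V + 1))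
    (Real.sqrt_pos.2 (by linarith)) hτ
    (tendsto_whp_coord_div μ hn' fun p => .inr (.inr (.inr ()))) ?_
    (fun x p => if h : p = x.1 then h ▸ effErr θ τ x.2 else 0) ?_
    (K₁ := lassoValue μ δ lam κ θ τ + η / 2) (by linarith) ?_
  · have h := tendsto_whp_lcost_zero (σ := σ) (lam := lam) hμ hδ hn
    filter_upwards [hnev, h.eventually (gt_mem_nhds (show V < V + 1 / 2 by linarith))] with x hx hlt
    have hx' : (0 : ℝ) < n x.1 := by exact_mod_cast hx
    rw [div_lt_iff₀ hx'] at hlt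
    rw [Real.sq_sqrt (by linarith)]
    linarith
  · simpa using eventually_l2_effErr_lt (n := n) hδ hn hσ hθ hτ hfix
  · have h := (((tendsto_whp_auxLin (n := n) hδ hn hθ hτ hfix hκ).pow 2).div_const 2).add
      ((tendsto_whp_abs_effErr (n := n) hμ hδ hn hθ hτ).const_mul lam)
    have := h.eventually (gt_mem_nhds (show _ < lassoValue μ δ lam κ θ τ + η / 2 by
      unfold lassoValue; linarith))
    simpa using this

/-- The Lasso objective exceeds its limiting value away from the denoising error. -/
lemma eventually_value_lt_lcost (hμ : Integrable (fun x => x ^ 2) μ) (hδ : 0 < δ)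
    (hn : Tendsto (fun p => (n p : ℝ) / p) atTop (𝓝 δ)) (hσ : 0 < σ)
    (hθ : 0 ≤ θ) (hτ : 0 < τ) (hκ0 : 0 < κ) (hlam : lam * τ = κ * θ)
    (hfix : τ ^ 2 = σ ^ 2 + δ⁻¹ * ∫ w, sErr θ τ w ^ 2 ∂μ.prod (gaussianReal 0 1))
    (hκ : κ = τ * (1 - δ⁻¹ * (μ.prod (gaussianReal 0 1)).real
      {w : ℝ × ℝ | θ < |w.1 + τ * w.2|}))
    (D : ∀ p, (Fin p → ℝ) → (Fin p → ℝ) → Prop)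
    (hD : ∀ p w, MeasurableSet {β | D p w β}) (hDo : ∀ p β, IsOpen {w | D p w β})
    {b c : ℝ} (hb : τ ≤ b) (hc : 0 < c)
    (hDb : ∀ p w β, D p w β → l2 w ≤ b * √(n p))
    (hDc : ∀ᶠ x in whp fun p => lassoLaw μ (n p) p, ∀ w, D x.1 w x.2.1 →
      c ≤ l2 (w - effErr θ τ x.2) / √(n x.1)) :
    ∃ η > 0, ∀ᶠ x in whp fun p => lassoLaw μ (n p) p, ∀ w, D x.1 w x.2.1 →
      n x.1 * (lassoValue μ δ lam κ θ τ + η) < lcost σ lam x.2.1 x.2.2 w := by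
  have hn' := tendsto_atTop_of_ratio hδ hn
  have hnev : ∀ᶠ x in whp fun p => lassoLaw μ (n p) p, 0 < n x.1 :=
    (tendsto_fst_whp _).eventually (hn'.eventually_gt_atTop 0)
  have hb0 : 0 < b := hτ.trans_le hb
  set s := √(σ ^ 2 + b ^ 2) with hs
  have hs0 : 0 < s := Real.sqrt_pos.2 (by positivity)
  have hρ : 0 < 1 - (b / s) ^ 2 := by
    rw [div_pow, hs, Real.sq_sqrt (by positivity), sub_pos, div_lt_one (by positivity)]
    have := pow_pos hσ 2
    linarith
  set G := κ / (2 * τ) * ((1 - (b / s) ^ 2) * c ^ 2) with hG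
  have hG0 : 0 < G := by positivity
  have hN := tendsto_whp_l2_ext_effErr (n := n) (μ := μ) hδ hn hθ hτ hfix
  have hI := tendsto_whp_inner_effErr (n := n) (μ := μ) hδ hn hθ hτ hκ
  have hA := tendsto_whp_abs_effErr (n := n) hμ hδ hn hθ hτ
  have hg := tendsto_whp_gVec μ hn'
  have hh := (tendsto_whp_coord_div μ hn' fun p => .inr (.inr (.inl none))).const_mul σ
  have hlim := ((((((hN.pow 2).div_const (2 * τ)).add_const (τ / 2)).sub hI).const_mul κ).sub_const
      (κ ^ 2 / 2)).add (hA.const_mul lam)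
  have hr := ((((hN.sub_const τ).abs.const_mul (2 * (2 * b))).const_sub
    ((1 - (b / s) ^ 2) * c ^ 2)).sub ((hN.sub_const τ).pow 2)).const_mul (κ / (2 * τ))
  have htot := ((hlim.add hr).sub ((hg.sub_const 1).abs.const_mul (κ * s))).sub
    (hh.abs.const_mul κ)
  have hval : (κ * (τ ^ 2 / (2 * τ) + τ / 2 - (τ - κ)) - κ ^ 2 / 2 +
      lam * ((∫ w, |w.1 + sErr θ τ w| ∂μ.prod (gaussianReal 0 1)) * δ⁻¹) +
      κ / (2 * τ) * ((1 - (b / s) ^ 2) * c ^ 2 - 2 * (2 * b) * |τ - τ| - (τ - τ) ^ 2)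
      - κ * s * |(1 : ℝ) - 1| - κ * |σ * 0|) = lassoValue μ δ lam κ θ τ + G := by
    rw [sub_self, sub_self, mul_zero, abs_zero, hG, lassoValue]
    field_simp
    ring
  rw [hval] at htot
  refine ⟨G / 4, by positivity, eventually_lt_lcost μ hn' hκ0 (b := b) ?_
    (tendsto_whp_coord_div μ hn' fun p => .inr (.inr (.inr ()))) D hD hDo
    (Eventually.of_forall hDb) (K₂ := lassoValue μ δ lam κ θ τ + G / 2) (by linarith) ?_⟩
  · filter_upwards [hnev, hg.eventually (lt_mem_nhds (show (0 : ℝ) < 1 by norm_num))]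
      with x hx hgx
    have hx' : (0 : ℝ) < √(n x.1) := Real.sqrt_pos.2 (by exact_mod_cast hx)
    by_contra hcon
    have : l2 (gVec x.2.2) / √(n x.1) ≤ 0 := div_nonpos_of_nonpos_of_nonneg (not_lt.1 hcon) hx'.le
    linarith
  · filter_upwards [hnev, hDc, eventually_l2_effErr_lt (n := n) hδ hn hσ hθ hτ hfix,
      htot.eventually (lt_mem_nhds (show lassoValue μ δ lam κ θ τ + G / 2
        < lassoValue μ δ lam κ θ τ + G by linarith))] with x hx hcx heff hlt w hw
    have hx' : (0 : ℝ) < √(n x.1) := Real.sqrt_pos.2 (by exact_mod_cast hx)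
    have h1 := aux_objective_ge hκ0 hτ hθ hlam hσ hx x.2.1 (hVec x.2.2) w
      (l2 (gVec x.2.2) / √(n x.1)) (σ * (hNoise x.2.2 / √(n x.1)))
      ((div_le_iff₀ hx').2 (hDb x.1 w x.2.1 hw))
      ((div_le_iff₀ hx').2 (heff.le.trans (by gcongr)))
    refine hlt.trans_le (le_trans ?_ h1)
    have h2 := hcx w hw
    have h3 : c ^ 2 ≤ (l2 (w - effErr θ τ x.2) / √(n x.1)) ^ 2 := by gcongr
    rw [← hs]
    simp only [hNoise]
    gcongr

end limits

section stat

variable {n p : ℕ} {k χ : ℝ → ℝ} {K : ℝ}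

/-- The empirical average of `k(βᵢ) χ(βᵢ + wᵢ)`. -/
noncomputable def errStat (k χ : ℝ → ℝ) (β w : Fin p → ℝ) : ℝ :=
  (∑ i, k (β i) * χ (β i + w i)) / p

lemma sum_abs_le_sqrt_mul_l2 (d : Fin p → ℝ) : ∑ i, |d i| ≤ √p * l2 d := by
  have h1 := sum_mul_le_l2 (fun _ : Fin p => (1 : ℝ)) fun i => |d i|
  have h2 : l2 (fun _ : Fin p => (1 : ℝ)) = √p := by simp [l2]
  have h3 : l2 (fun i => |d i|) = l2 d := by simp [l2]
  rw [h2, h3] at h1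
  simpa using h1

lemma abs_errStat_sub_le (hK : 0 ≤ K) (hk : ∀ x, |k x| ≤ 1)
    (hχ : ∀ x y, |χ x - χ y| ≤ K * |x - y|) (hp : 0 < p) (β w w' : Fin p → ℝ) :
    |errStat k χ β w - errStat k χ β w'| ≤ K * (l2 (w - w') / √p) := by
  have hp' : (0 : ℝ) < p := by exact_mod_cast hp
  have hs : (0 : ℝ) < √p := Real.sqrt_pos.2 hp'
  have h1 : |∑ i, (k (β i) * χ (β i + w i) - k (β i) * χ (β i + w' i))|
      ≤ K * ∑ i, |(w - w') i| := by
    rw [Finset.mul_sum]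
    refine (Finset.abs_sum_le_sum_abs _ _).trans (Finset.sum_le_sum fun i _ => ?_)
    rw [← mul_sub, abs_mul]
    calc |k (β i)| * |χ (β i + w i) - χ (β i + w' i)|
        ≤ 1 * (K * |(β i + w i) - (β i + w' i)|) := by
          gcongr
          · exact hk _
          · exact hχ _ _
      _ = K * |(w - w') i| := by simp
  have h2 := sum_abs_le_sqrt_mul_l2 (w - w')
  rw [errStat, errStat, ← sub_div, ← Finset.sum_sub_distrib, abs_div, abs_of_pos hp',
    div_le_iff₀ hp']
  refine h1.trans ?_
  calc K * ∑ i, |(w - w') i| ≤ K * (√p * l2 (w - w')) := by gcongr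
    _ = K * (l2 (w - w') / √p) * (√p * √p) := by field_simp
    _ = _ := by rw [Real.mul_self_sqrt hp'.le]

lemma continuous_errStat (hχ : Continuous χ) (β : Fin p → ℝ) :
    Continuous fun w : Fin p → ℝ => errStat k χ β w := by
  unfold errStat
  fun_prop

lemma measurable_errStat (hk : Measurable k) (hχ : Continuous χ) (w : Fin p → ℝ) :
    Measurable fun β : Fin p → ℝ => errStat k χ β w := by
  have := hχ.measurable
  unfold errStat
  fun_prop

/-- Error vectors which are either slightly too long, or whose statistic is far from `E`. -/
def IsFar (B r ε E : ℝ) (k χ : ℝ → ℝ) (w β : Fin p → ℝ) : Prop :=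
  l2 w < B + r ∧ (B - r < l2 w ∨ ε < |errStat k χ β w - E|)

lemma isOpen_isFar (B r ε E : ℝ) (hχ : Continuous χ) (β : Fin p → ℝ) :
    IsOpen {w | IsFar B r ε E k χ w β} :=
  (isOpen_lt continuous_l2 continuous_const).inter
    ((isOpen_lt continuous_const continuous_l2).union
      (isOpen_lt continuous_const ((continuous_errStat hχ β).sub continuous_const).abs))

lemma measurableSet_isFar (B r ε E : ℝ) (hk : Measurable k) (hχ : Continuous χ) (w : Fin p → ℝ) :
    MeasurableSet {β : Fin p → ℝ | IsFar B r ε E k χ w β} :=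
  (MeasurableSet.const _).inter ((MeasurableSet.const _).union
    (measurableSet_lt measurable_const ((measurable_errStat hk hχ w).sub_const E).abs))

/-- If every far vector is suboptimal, the statistic of a minimizer is close to its target. -/
lemma abs_errStat_sub_le_of_minimizer {σ lam A B r ε E c₁ c₂ : ℝ} (hlam : 0 ≤ lam)
    (hc : c₁ < c₂) (hr : 0 < r) (hA : A ≤ B) {β v : Fin p → ℝ}
    {ξ : GIdx (Fin n) (Option (Fin p)) → ℝ}
    (h1 : ∃ w, l2 w ≤ A ∧ lcost σ lam β ξ w ≤ c₁)
    (h2 : ∀ w, IsFar B r ε E k χ w β → c₂ ≤ lcost σ lam β ξ w)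
    (hv : ∀ w, lcost σ lam β ξ v ≤ lcost σ lam β ξ w) :
    |errStat k χ β v - E| ≤ ε := by
  obtain ⟨w₀, hw₀, hcw⟩ := h1
  have hcv : lcost σ lam β ξ v ≤ c₁ := (hv w₀).trans hcw
  by_contra hε
  rw [not_le] at hε
  by_cases hl : l2 v < B + r
  · linarith [h2 v ⟨hl, Or.inr hε⟩]
  rw [not_lt] at hl
  have hcont : Continuous fun t : ℝ => l2 ((1 - t) • w₀ + t • v) := by
    refine continuous_l2.comp ?_
    fun_prop
  have hmem : B ∈ Icc (l2 ((1 - (0 : ℝ)) • w₀ + (0 : ℝ) • v))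
      (l2 ((1 - (1 : ℝ)) • w₀ + (1 : ℝ) • v)) := by
    simp only [sub_zero, one_smul, zero_smul, add_zero, sub_self, zero_add]
    exact ⟨hw₀.trans hA, by linarith⟩
  obtain ⟨t, ht, htB⟩ := intermediate_value_Icc zero_le_one hcont.continuousOn hmem
  simp only at htB
  have h3 := lcost_lineMap_le hlam β ξ w₀ v (σ := σ) ht.1 ht.2
  have h4 := h2 _ ⟨by rw [htB]; linarith, Or.inl (by rw [htB]; linarith)⟩
  nlinarith [ht.1, ht.2]

end stat

section limit

variable (μ : Measure ℝ) [IsProbabilityMeasure μ] {n : ℕ → ℕ} {δ σ θ τ κ lam K : ℝ}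
  {k χ : ℝ → ℝ}

lemma tendsto_whp_errStat (hθ : 0 ≤ θ) (hk : Measurable k) (hk1 : ∀ x, |k x| ≤ 1)
    (hχ : Continuous χ) (hχ1 : ∀ x, |χ x| ≤ 1) :
    Tendsto (fun x : Σ p, LassoSpace (n p) p => errStat k χ x.2.1 (effErr θ τ x.2))
      (whp fun p => lassoLaw μ (n p) p)
      (𝓝 (∫ w, k w.1 * χ (softThr θ (w.1 + τ * w.2)) ∂μ.prod (gaussianReal 0 1))) := by
  have hc := continuous_softThr hθ
  have hm : Measurable fun w : ℝ × ℝ => k w.1 * χ (softThr θ (w.1 + τ * w.2)) := by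
    have := hχ.measurable
    have := hc.measurable
    fun_prop
  have hL : MemLp (fun w : ℝ × ℝ => k w.1 * χ (softThr θ (w.1 + τ * w.2))) 2
      (μ.prod (gaussianReal 0 1)) := by
    refine MemLp.of_bound hm.aestronglyMeasurable 1 (Eventually.of_forall fun w => ?_)
    rw [norm_mul, Real.norm_eq_abs, Real.norm_eq_abs]
    exact mul_le_one₀ (hk1 _) (abs_nonneg _) (hχ1 _)
  refine (tendsto_whp_stat μ hL (n := n)).congr fun x => ?_
  simp [errStat, softErr]

lemma eventually_far_dist (hδ : 0 < δ) (hn : Tendsto (fun p => (n p : ℝ) / p) atTop (𝓝 δ))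
    (hσ : 0 < σ) (hθ : 0 ≤ θ) (hτ : 0 < τ)
    (hfix : τ ^ 2 = σ ^ 2 + δ⁻¹ * ∫ w, sErr θ τ w ^ 2 ∂μ.prod (gaussianReal 0 1))
    (hk : Measurable k) (hk1 : ∀ x, |k x| ≤ 1) (hχ1 : ∀ x, |χ x| ≤ 1) (hK : 0 < K)
    (hχ : ∀ x y, |χ x - χ y| ≤ K * |x - y|) (hχc : Continuous χ) {ε : ℝ} (hε : 0 < ε) :
    ∃ c > 0, ∀ᶠ x in whp fun p => lassoLaw μ (n p) p, ∀ w,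
      IsFar ((τ + 2) * √(n x.1)) (√(n x.1)) ε
        (∫ w, k w.1 * χ (softThr θ (w.1 + τ * w.2)) ∂μ.prod (gaussianReal 0 1)) k χ w x.2.1 →
      c ≤ l2 (w - effErr θ τ x.2) / √(n x.1) := by
  refine ⟨min 1 (ε / (2 * K) * √(δ⁻¹ / 2)), lt_min one_pos (by positivity), ?_⟩
  generalize hE : (∫ w, k w.1 * χ (softThr θ (w.1 + τ * w.2)) ∂μ.prod (gaussianReal 0 1)) = E
  have hstat := tendsto_whp_errStat μ (n := n) (τ := τ) hθ hk hk1 hχc hχ1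
  rw [hE] at hstat
  have e1 := (Metric.tendsto_nhds.1 hstat) (ε / 2) (by positivity)
  have e2 := eventually_l2_effErr_lt hδ hn hσ hθ hτ hfix
  have e3 := (tendsto_fst_whp fun p => lassoLaw μ (n p) p).eventually
    ((tendsto_natCast_div_inv hδ hn).eventually (lt_mem_nhds (half_lt_self (inv_pos.2 hδ))))
  have e4 := (tendsto_fst_whp fun p => lassoLaw μ (n p) p).eventually (eventually_gt_atTop 0)
  have e5 := (tendsto_fst_whp fun p => lassoLaw μ (n p) p).eventually
    ((tendsto_atTop_of_ratio hδ hn).eventually (eventually_gt_atTop 0))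
  filter_upwards [e1, e2, e3, e4, e5] with x h1 h2 h3 h4 h5 w hw
  obtain ⟨p, z⟩ := x
  change 0 < p at h4
  change 0 < n p at h5
  change δ⁻¹ / 2 < (p : ℝ) / n p at h3
  change l2 (effErr θ τ z) < τ * √(n p) at h2
  change dist (errStat k χ z.1 (effErr θ τ z)) E < ε / 2 at h1
  change IsFar ((τ + 2) * √(n p)) (√(n p)) ε E k χ w z.1 at hw
  change _ ≤ l2 (w - effErr θ τ z) / √(n p)
  generalize effErr θ τ z = v at *
  have hn' : (0 : ℝ) < √(n p) := Real.sqrt_pos.2 (by exact_mod_cast h5)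
  have hp' : (0 : ℝ) < √p := Real.sqrt_pos.2 (by exact_mod_cast h4)
  rcases hw.2 with h | h
  · refine (min_le_left _ _).trans ((le_div_iff₀ hn').2 ?_)
    have h6 := l2_add_le (w - v) v
    rw [sub_add_cancel] at h6
    nlinarith
  · refine (min_le_right _ _).trans ?_
    have h6 := abs_errStat_sub_le hK.le hk1 hχ h4 z.1 w v
    rw [Real.dist_eq] at h1
    have h7 : ε / 2 ≤ K * (l2 (w - v) / √p) := by
      have := abs_sub_le (errStat k χ z.1 w) (errStat k χ z.1 v) E
      linarith
    have h8 : √(δ⁻¹ / 2) ≤ √p / √(n p) := by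
      rw [← Real.sqrt_div (Nat.cast_nonneg p)]
      exact Real.sqrt_le_sqrt h3.le
    have h9 : ε / (2 * K) ≤ l2 (w - v) / √p := by
      rw [div_le_iff₀ (by positivity)]
      nlinarith
    calc ε / (2 * K) * √(δ⁻¹ / 2) ≤ (l2 (w - v) / √p) * (√p / √(n p)) :=
          mul_le_mul h9 h8 (Real.sqrt_nonneg _) (div_nonneg (l2_nonneg _) hp'.le)
      _ = _ := by field_simp

/-- With high probability, far error vectors have a cost above that of some short vector. -/
lemma exists_eventually_lcost_gap (hμ : Integrable (fun x => x ^ 2) μ) (hδ : 0 < δ)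
    (hn : Tendsto (fun p => (n p : ℝ) / p) atTop (𝓝 δ)) (hσ : 0 < σ) (hlam : 0 < lam)
    (hθ : 0 ≤ θ) (hτ : 0 < τ) (hκ0 : 0 < κ) (hlamκ : lam * τ = κ * θ)
    (hfix : τ ^ 2 = σ ^ 2 + δ⁻¹ * ∫ w, sErr θ τ w ^ 2 ∂μ.prod (gaussianReal 0 1))
    (hκ : κ = τ * (1 - δ⁻¹ * (μ.prod (gaussianReal 0 1)).real
      {w : ℝ × ℝ | θ < |w.1 + τ * w.2|}))
    (hk : Measurable k) (hk1 : ∀ x, |k x| ≤ 1) (hχ1 : ∀ x, |χ x| ≤ 1) (hK : 0 < K)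
    (hχ : ∀ x y, |χ x - χ y| ≤ K * |x - y|) (hχc : Continuous χ) {ε : ℝ} (hε : 0 < ε) :
    ∃ c₁ c₂ : ℝ, c₁ < c₂ ∧ ∀ᶠ x in whp fun p => lassoLaw μ (n p) p,
      (∃ w, l2 w ≤ τ * √(n x.1) ∧ lcost σ lam x.2.1 x.2.2 w ≤ n x.1 * c₁) ∧
      ∀ w, IsFar ((τ + 2) * √(n x.1)) (√(n x.1)) ε
        (∫ w, k w.1 * χ (softThr θ (w.1 + τ * w.2)) ∂μ.prod (gaussianReal 0 1)) k χ w x.2.1 →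
        n x.1 * c₂ ≤ lcost σ lam x.2.1 x.2.2 w := by
  obtain ⟨c, hc, hfar⟩ := eventually_far_dist μ hδ hn hσ hθ hτ hfix hk hk1 hχ1 hK hχ hχc hε
  generalize (∫ w, k w.1 * χ (softThr θ (w.1 + τ * w.2)) ∂μ.prod (gaussianReal 0 1)) = E at *
  obtain ⟨η, hη, h2⟩ := eventually_value_lt_lcost hμ hδ hn hσ hθ hτ hκ0 hlamκ hfix hκ
    (fun p w β => IsFar ((τ + 2) * √(n p)) (√(n p)) ε E k χ w β)
    (fun p w => measurableSet_isFar _ _ _ _ hk hχc w) (fun p β => isOpen_isFar _ _ _ _ hχc β)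
    (b := τ + 3) (by linarith) hc (fun p w β hw => by
      have := hw.1
      linarith) hfar
  have h1 := eventually_exists_lcost_le_value hμ hδ hn hσ hlam hθ hτ hfix hκ (half_pos hη)
  refine ⟨_, _, ?_, h1.and (h2.mono fun x hx w hw => (hx w hw).le)⟩
  linarith

end limit

section core

variable {n p : ℕ}

/-- Coefficients together with the normalized Gaussian coordinates of the design and noise. -/
abbrev CoreSpace (n p : ℕ) := (Fin p → ℝ) × (Fin n × Option (Fin p) → ℝ)

/-- Forget the auxiliary Gaussian coordinates. -/
def toCore (z : LassoSpace n p) : CoreSpace n p := (z.1, fun a => z.2 (.inl a))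

/-- Extend by zero on the auxiliary Gaussian coordinates. -/
def ofCore (c : CoreSpace n p) : LassoSpace n p := (c.1, Sum.elim c.2 0)

/-- Normalized coordinates of a design matrix, coefficient vector and noise vector. -/
noncomputable def coreOf (σ : ℝ) (x : Fin n → Fin p → ℝ) (β : Fin p → ℝ) (ζ : Fin n → ℝ) :
    CoreSpace n p :=
  (β, fun a => a.2.elim (-σ⁻¹ * ζ a.1) fun j => √n * x a.1 j)

lemma measurable_ofCore : Measurable (ofCore : CoreSpace n p → LassoSpace n p) := by
  refine measurable_fst.prodMk (measurable_pi_iff.2 fun a => ?_)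
  rcases a with a | a
  · exact (measurable_pi_apply a).comp measurable_snd
  · exact measurable_const

lemma measurePreserving_toCore (μ : Measure ℝ) [IsProbabilityMeasure μ] :
    MeasurePreserving (toCore : LassoSpace n p → CoreSpace n p) (lassoLaw μ n p)
      ((Measure.pi fun _ => μ).prod (stdGauss (Fin n × Option (Fin p)))) :=
  (MeasurePreserving.id (Measure.pi fun _ : Fin p => μ)).prod
    (measurePreserving_pi_comp (gaussianReal 0 1)
      (ι := fun a => (.inl a : GIdx (Fin n) (Option (Fin p)))) Sum.inl_injective)

lemma lcost_coreOf (hn : 0 < n) {σ : ℝ} (hσ : 0 < σ) (lam : ℝ) (x : Fin n → Fin p → ℝ)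
    (β : Fin p → ℝ) (ζ : Fin n → ℝ) (w : Fin p → ℝ) :
    lcost σ lam (ofCore (coreOf σ x β ζ)).1 (ofCore (coreOf σ x β ζ)).2 w
      = (1 / 2) * ∑ i, (ζ i - ∑ j, x i j * w j) ^ 2 + lam * ∑ j, |β j + w j| := by
  have hn' : (0 : ℝ) < √n := Real.sqrt_pos.2 (by exact_mod_cast hn)
  have h : ∀ i, resid σ (ofCore (coreOf σ x β ζ)).2 w i = -(ζ i - ∑ j, x i j * w j) := by
    intro i
    unfold resid
    rw [sum_mul_extVec σ w fun s => (ofCore (coreOf σ x β ζ)).2 (.inl (i, s))]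
    simp only [ofCore, coreOf, Sum.elim_inl, Option.elim]
    simp only [mul_assoc, ← Finset.mul_sum]
    field_simp
    ring
  simp only [lcost, h, neg_sq]
  rfl

lemma gaussianReal_map_sqrt_mul (hn : 0 < n) :
    (gaussianReal 0 (Real.toNNReal (1 / (n : ℝ)))).map (fun y => √n * y) = gaussianReal 0 1 := by
  have hn' : (0 : ℝ) < n := by exact_mod_cast hn
  rw [gaussianReal_map_const_mul]
  congr 1
  · simp
  · ext
    simp only [NNReal.coe_mul, NNReal.coe_mk, NNReal.coe_one]
    rw [Real.sq_sqrt hn'.le, Real.coe_toNNReal _ (by positivity)]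
    field_simp

lemma gaussianReal_map_neg_inv_mul {σ : ℝ} (hσ : 0 < σ) :
    (gaussianReal 0 (Real.toNNReal (σ ^ 2))).map (fun y => -σ⁻¹ * y) = gaussianReal 0 1 := by
  rw [gaussianReal_map_const_mul]
  congr 1
  · simp
  · ext
    simp only [NNReal.coe_mul, NNReal.coe_mk, NNReal.coe_one]
    rw [Real.coe_toNNReal _ (by positivity)]
    field_simp

lemma measurePreserving_coords {σ : ℝ} (hσ : 0 < σ) :
    MeasurePreserving
      (fun (y : (Fin n → Fin p → ℝ) × (Fin n → ℝ)) (a : Fin n × Option (Fin p)) =>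
        (a.2.elim (-σ⁻¹ * y.2 a.1) fun j => √n * y.1 a.1 j : ℝ))
      ((Measure.pi fun _ : Fin n => Measure.pi fun _ : Fin p =>
        gaussianReal 0 (Real.toNNReal (1 / (n : ℝ)))).prod
        (Measure.pi fun _ : Fin n => gaussianReal 0 (Real.toNNReal (σ ^ 2))))
      (stdGauss (Fin n × Option (Fin p))) := by
  have hm : Measurable
      (fun (y : (Fin n → Fin p → ℝ) × (Fin n → ℝ)) (a : Fin n × Option (Fin p)) =>
        (a.2.elim (-σ⁻¹ * y.2 a.1) fun j => √n * y.1 a.1 j : ℝ)) := by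
    refine measurable_pi_iff.2 fun a => ?_
    obtain ⟨i, o⟩ := a
    cases o with
    | none => simp only [Option.elim]; fun_prop
    | some j => simp only [Option.elim]; fun_prop
  refine ⟨hm, (Measure.pi_eq fun s hs => ?_).symm⟩
  rw [Measure.map_apply hm (MeasurableSet.univ_pi hs)]
  have hpre : (fun (y : (Fin n → Fin p → ℝ) × (Fin n → ℝ)) (a : Fin n × Option (Fin p)) =>
        (a.2.elim (-σ⁻¹ * y.2 a.1) fun j => √n * y.1 a.1 j : ℝ)) ⁻¹' (Set.univ.pi s)
      = (Set.univ.pi fun i => Set.univ.pi fun j => (fun y : ℝ => √n * y) ⁻¹' s (i, some j)) ×ˢ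
        (Set.univ.pi fun i => (fun y : ℝ => -σ⁻¹ * y) ⁻¹' s (i, none)) := by
    ext y
    simp only [Set.mem_preimage, Set.mem_pi, Set.mem_univ, true_implies, Set.mem_prod, Prod.forall,
      Option.forall, Option.elim]
    exact ⟨fun h => ⟨fun i j => (h i).2 j, fun i => (h i).1⟩, fun h i => ⟨h.2 i, h.1 i⟩⟩
  rw [hpre, Measure.prod_prod, Measure.pi_pi, Measure.pi_pi, Fintype.prod_prod_type,
    ← Finset.prod_mul_distrib]
  refine Finset.prod_congr rfl fun i _ => ?_
  rw [Measure.pi_pi, Fintype.prod_option, mul_comm]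
  have h1 : ∀ A : Set ℝ, MeasurableSet A → gaussianReal 0 (Real.toNNReal (1 / (n : ℝ)))
      ((fun y : ℝ => √n * y) ⁻¹' A) = gaussianReal 0 1 A := fun A hA => by
    rw [← gaussianReal_map_sqrt_mul (Fin.pos i), Measure.map_apply (by fun_prop) hA]
  have h2 : ∀ A : Set ℝ, MeasurableSet A → gaussianReal 0 (Real.toNNReal (σ ^ 2))
      ((fun y : ℝ => -σ⁻¹ * y) ⁻¹' A) = gaussianReal 0 1 A := fun A hA => by
    rw [← gaussianReal_map_neg_inv_mul hσ, Measure.map_apply (by fun_prop) hA]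
  rw [h2 _ (hs _)]
  simp only [h1 _ (hs _)]

variable {Ω : Type*} [MeasurableSpace Ω] {P : Measure Ω}

lemma measurePreserving_coreOf {μ : Measure ℝ} [IsProbabilityMeasure μ] {σ : ℝ} (hσ : 0 < σ)
    {X : Ω → Fin n → Fin p → ℝ} {β : Ω → Fin p → ℝ} {ζ : Ω → Fin n → ℝ}
    (hX : Measurable X) (hβ : Measurable β) (hζ : Measurable ζ)
    (hXlaw : Measure.map X P = Measure.pi fun _ : Fin n => Measure.pi fun _ : Fin p =>
        gaussianReal 0 (Real.toNNReal (1 / (n : ℝ))))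
    (hβlaw : Measure.map β P = Measure.pi fun _ : Fin p => μ)
    (hζlaw : Measure.map ζ P = Measure.pi fun _ : Fin n =>
      gaussianReal 0 (Real.toNNReal (σ ^ 2)))
    (hindep : Measure.map (fun ω => (X ω, β ω, ζ ω)) P =
      (Measure.map X P).prod ((Measure.map β P).prod (Measure.map ζ P))) :
    MeasurePreserving (fun ω => coreOf σ (X ω) (β ω) (ζ ω)) P
      ((Measure.pi fun _ => μ).prod (stdGauss (Fin n × Option (Fin p)))) := by
  rw [hXlaw, hβlaw, hζlaw] at hindep
  have h0 : MeasurePreserving (fun ω => (X ω, β ω, ζ ω)) P _ :=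
    ⟨hX.prodMk (hβ.prodMk hζ), hindep⟩
  have h1 := (Measure.measurePreserving_swap (μ := Measure.pi fun _ : Fin n =>
    Measure.pi fun _ : Fin p => gaussianReal 0 (Real.toNNReal (1 / (n : ℝ))))
    (ν := (Measure.pi fun _ : Fin p => μ).prod
      (Measure.pi fun _ : Fin n => gaussianReal 0 (Real.toNNReal (σ ^ 2))))).comp h0
  have h2 := (measurePreserving_prodAssoc (Measure.pi fun _ : Fin p => μ)
    (Measure.pi fun _ : Fin n => gaussianReal 0 (Real.toNNReal (σ ^ 2)))
    (Measure.pi fun _ : Fin n =>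
      Measure.pi fun _ : Fin p => gaussianReal 0 (Real.toNNReal (1 / (n : ℝ))))).comp h1
  have h3 := ((MeasurePreserving.id (Measure.pi fun _ : Fin p => μ)).prod
    ((measurePreserving_coords (n := n) (p := p) hσ).comp
      Measure.measurePreserving_swap)).comp h2
  exact h3

end core

section transfer

variable {Ω : Type*} [MeasurableSpace Ω] {P : Measure Ω}
  {n : ℕ → ℕ} {μ : Measure ℝ} [IsProbabilityMeasure μ]

/-- Events that only depend on the core coordinates can be transported to any coupling. -/
lemma eventually_whp_of_lassoLaw {T : ∀ p, Ω → CoreSpace (n p) p}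
    (hT : ∀ p, MeasurePreserving (T p) P
      ((Measure.pi fun _ => μ).prod (stdGauss (Fin (n p) × Option (Fin p)))))
    {G : ∀ p, Set (LassoSpace (n p) p)} (hG : ∀ p, MeasurableSet (G p))
    (hcore : ∀ p z, z ∈ G p ↔ ofCore (toCore z) ∈ G p)
    (h : ∀ᶠ x in whp fun p => lassoLaw μ (n p) p, x.2 ∈ G x.1) :
    ∀ᶠ x in whp fun _ : ℕ => P, ofCore (T x.1 x.2) ∈ G x.1 := by
  rw [eventually_whp_iff] at h ⊢
  refine h.congr fun p => ?_
  have hm : MeasurableSet {c : CoreSpace (n p) p | ofCore c ∉ G p} :=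
    (measurable_ofCore (hG p)).compl
  have h1 := (measurePreserving_toCore (n := n p) (p := p) μ).measure_preimage hm.nullMeasurableSet
  have h2 := (hT p).measure_preimage hm.nullMeasurableSet
  have h3 : {x : LassoSpace (n p) p | x ∉ G p}
      = toCore ⁻¹' {c : CoreSpace (n p) p | ofCore c ∉ G p} := by
    ext z
    simp only [Set.mem_ofPred_eq, Set.mem_preimage]
    rw [hcore p z]
  rw [h3, h1, ← h2]
  rfl

end transfer

section lasso

variable {Ω : Type*} [MeasurableSpace Ω] {P : Measure Ω}
  {μ : Measure ℝ} [IsProbabilityMeasure μ] {n : ℕ → ℕ} {δ σ θ τ κ lam K : ℝ} {k χ : ℝ → ℝ}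

/-- Lipschitz statistics of the Lasso estimator concentrate around their effective limits. -/
lemma tendsto_whp_lasso_stat (hμ : Integrable (fun x => x ^ 2) μ) (hδ : 0 < δ)
    (hn : Tendsto (fun p => (n p : ℝ) / p) atTop (𝓝 δ)) (hσ : 0 < σ) (hlam : 0 < lam)
    (hθ : 0 ≤ θ) (hτ : 0 < τ) (hκ0 : 0 < κ) (hlamκ : lam * τ = κ * θ)
    (hfix : τ ^ 2 = σ ^ 2 + δ⁻¹ * ∫ w, sErr θ τ w ^ 2 ∂μ.prod (gaussianReal 0 1))
    (hκ : κ = τ * (1 - δ⁻¹ * (μ.prod (gaussianReal 0 1)).real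
      {w : ℝ × ℝ | θ < |w.1 + τ * w.2|}))
    {X : (p : ℕ) → Ω → Fin (n p) → Fin p → ℝ} {β : (p : ℕ) → Ω → Fin p → ℝ}
    {ζ : (p : ℕ) → Ω → Fin (n p) → ℝ} {βhat : (p : ℕ) → Ω → Fin p → ℝ}
    (hT : ∀ p, MeasurePreserving (fun ω => coreOf σ (X p ω) (β p ω) (ζ p ω)) P
      ((Measure.pi fun _ => μ).prod (stdGauss (Fin (n p) × Option (Fin p)))))
    (hlasso : ∀ p ω (b : Fin p → ℝ),
      (1 / 2) * (∑ i, (((∑ j, X p ω i j * β p ω j) + ζ p ω i)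
            - ∑ j, X p ω i j * βhat p ω j) ^ 2) + lam * ∑ j, |βhat p ω j|
        ≤ (1 / 2) * (∑ i, (((∑ j, X p ω i j * β p ω j) + ζ p ω i)
            - ∑ j, X p ω i j * b j) ^ 2) + lam * ∑ j, |b j|)
    (hk : Measurable k) (hk1 : ∀ x, |k x| ≤ 1) (hχ1 : ∀ x, |χ x| ≤ 1) (hK : 0 < K)
    (hχ : ∀ x y, |χ x - χ y| ≤ K * |x - y|) (hχc : Continuous χ) :
    Tendsto (fun x : Σ _ : ℕ, Ω => (∑ i, k (β x.1 x.2 i) * χ (βhat x.1 x.2 i)) / x.1)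
      (whp fun _ => P)
      (𝓝 (∫ w, k w.1 * χ (softThr θ (w.1 + τ * w.2)) ∂μ.prod (gaussianReal 0 1))) := by
  refine Metric.tendsto_nhds.2 fun ε hε => ?_
  obtain ⟨c₁, c₂, hc, hev⟩ := exists_eventually_lcost_gap μ hμ hδ hn hσ hlam hθ hτ hκ0 hlamκ hfix
    hκ hk hk1 hχ1 hK hχ hχc (half_pos hε)
  generalize (∫ w, k w.1 * χ (softThr θ (w.1 + τ * w.2)) ∂μ.prod (gaussianReal 0 1)) = E at *
  have hev' := eventually_whp_of_lassoLaw hT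
    (G := fun p => {z | ∃ w, l2 w ≤ τ * √(n p) ∧ lcost σ lam z.1 z.2 w ≤ n p * c₁} ∩
      {z | ∀ w, IsFar ((τ + 2) * √(n p)) (√(n p)) (ε / 2) E k χ w z.1 →
        n p * c₂ ≤ lcost σ lam z.1 z.2 w})
    (fun p => (measurableSet_exists_lcost_le _ _ _ _).inter
      (measurableSet_forall_le_lcost σ lam
        (fun w β => IsFar ((τ + 2) * √(n p)) (√(n p)) (ε / 2) E k χ w β)
        (fun w => measurableSet_isFar _ _ _ _ hk hχc w) (fun β => isOpen_isFar _ _ _ _ hχc β)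
        measurable_const))
    (fun p z => Iff.rfl) hev
  have e5 := (tendsto_fst_whp fun _ : ℕ => P).eventually
    ((tendsto_atTop_of_ratio hδ hn).eventually (eventually_gt_atTop 0))
  filter_upwards [hev', e5] with x hx h5
  obtain ⟨p, ω⟩ := x
  change 0 < n p at h5
  have hn' : (0 : ℝ) < n p := by exact_mod_cast h5
  have hs : (0 : ℝ) < √(n p) := Real.sqrt_pos.2 hn'
  have hmin : ∀ w, lcost σ lam (ofCore (coreOf σ (X p ω) (β p ω) (ζ p ω))).1
      (ofCore (coreOf σ (X p ω) (β p ω) (ζ p ω))).2 (βhat p ω - β p ω)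
      ≤ lcost σ lam (ofCore (coreOf σ (X p ω) (β p ω) (ζ p ω))).1
      (ofCore (coreOf σ (X p ω) (β p ω) (ζ p ω))).2 w := by
    intro w
    rw [lcost_coreOf h5 hσ, lcost_coreOf h5 hσ]
    have h := hlasso p ω (β p ω + w)
    simp only [Pi.add_apply, Pi.sub_apply, mul_add, mul_sub, Finset.sum_add_distrib,
      Finset.sum_sub_distrib, add_sub_cancel] at h ⊢
    convert h using 5 <;> ring
  have h6 := abs_errStat_sub_le_of_minimizer hlam.le ((mul_lt_mul_iff_right₀ hn').2 hc) hs
    (A := τ * √(n p)) (B := (τ + 2) * √(n p)) (by nlinarith) hx.1 hx.2 hmin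
  have h7 : errStat k χ (ofCore (coreOf σ (X p ω) (β p ω) (ζ p ω))).1 (βhat p ω - β p ω)
      = (∑ i, k (β p ω i) * χ (βhat p ω i)) / p := by
    simp [errStat, ofCore, coreOf]
  rw [h7] at h6
  rw [Real.dist_eq]
  exact h6.trans_lt (half_lt_self hε)

end lasso

section window

/-- Clipped steep piecewise linear approximations of the indicator of `[s, t]`. -/
noncomputable def trapezoid (s t c : ℝ) (N : ℕ) (x : ℝ) : ℝ :=
  max 0 (min 1 (c + min (x - s) (t - x) * (N + 1)))

/-- The indicator function of `[s, t]`. -/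
noncomputable def windowInd (s t x : ℝ) : ℝ := if s ≤ x ∧ x ≤ t then 1 else 0

lemma abs_trapezoid_le (s t c : ℝ) (N : ℕ) (x : ℝ) : |trapezoid s t c N x| ≤ 1 := by
  rw [trapezoid, abs_of_nonneg (le_max_left _ _)]
  exact max_le zero_le_one (min_le_left _ _)

lemma continuous_trapezoid (s t c : ℝ) (N : ℕ) : Continuous (trapezoid s t c N) := by
  unfold trapezoid
  fun_prop

lemma abs_trapezoid_sub_le (s t c : ℝ) (N : ℕ) (x y : ℝ) :
    |trapezoid s t c N x - trapezoid s t c N y| ≤ (N + 1 : ℝ) * |x - y| := by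
  have hN : (0 : ℝ) < (N : ℝ) + 1 := by positivity
  have h1 : |min (x - s) (t - x) - min (y - s) (t - y)| ≤ |x - y| := by
    refine (abs_min_sub_min_le_max _ _ _ _).trans (max_le (by simp) ?_)
    rw [show t - x - (t - y) = -(x - y) by ring, abs_neg]
  unfold trapezoid
  set a := c + min (x - s) (t - x) * ((N : ℝ) + 1) with ha
  set b := c + min (y - s) (t - y) * ((N : ℝ) + 1) with hb
  have h2 : |a - b| ≤ (N + 1 : ℝ) * |x - y| := by
    rw [ha, hb, add_sub_add_left_eq_sub, ← sub_mul, abs_mul, abs_of_pos hN, mul_comm]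
    gcongr
  refine le_trans ?_ h2
  refine (abs_max_sub_max_le_max _ _ _ _).trans (max_le (by simp) ?_)
  exact (abs_min_sub_min_le_max _ _ _ _).trans (max_le (by simp) le_rfl)

lemma windowInd_eq (s t x : ℝ) :
    windowInd s t x = if 0 ≤ min (x - s) (t - x) then 1 else 0 := by
  simp [windowInd]

lemma trapezoid_zero_le (s t : ℝ) (N : ℕ) (x : ℝ) :
    trapezoid s t 0 N x ≤ windowInd s t x := by
  rw [windowInd_eq, trapezoid]
  split_ifs with h
  · exact max_le zero_le_one (min_le_left _ _)
  · refine max_le le_rfl ((min_le_right _ _).trans ?_)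
    rw [zero_add]
    exact mul_nonpos_of_nonpos_of_nonneg (not_le.1 h).le (by positivity)

lemma le_trapezoid_one (s t : ℝ) (N : ℕ) (x : ℝ) :
    windowInd s t x ≤ trapezoid s t 1 N x := by
  rw [windowInd_eq, trapezoid]
  split_ifs with h
  · refine le_max_of_le_right (le_min le_rfl ?_)
    have : 0 ≤ min (x - s) (t - x) * ((N : ℝ) + 1) := mul_nonneg h (by positivity)
    linarith
  · exact le_max_left _ _

lemma tendsto_trapezoid (s t c : ℝ) {x : ℝ} (hs : x ≠ s) (ht : x ≠ t) :
    Tendsto (fun N => trapezoid s t c N x) atTop (𝓝 (windowInd s t x)) := by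
  rw [windowInd_eq]
  have hm : min (x - s) (t - x) ≠ 0 := by
    intro h
    rcases min_choice (x - s) (t - x) with h' | h' <;> rw [h'] at h
    · exact hs (sub_eq_zero.1 h)
    · exact ht (sub_eq_zero.1 h).symm
  have hN : Tendsto (fun N : ℕ => (N : ℝ) + 1) atTop atTop :=
    tendsto_atTop_add_const_right _ _ tendsto_natCast_atTop_atTop
  unfold trapezoid
  generalize min (x - s) (t - x) = m at hm
  rcases lt_or_gt_of_ne hm with h | h
  · rw [if_neg (not_le.2 h)]
    refine tendsto_const_nhds.congr' ?_
    have h1 := tendsto_atBot_add_const_left _ c (hN.const_mul_atTop_of_neg h)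
    filter_upwards [h1.eventually_le_atBot 0] with N hN
    rw [max_eq_left ((min_le_right _ _).trans hN)]
  · rw [if_pos h.le]
    refine tendsto_const_nhds.congr' ?_
    have h1 := tendsto_atTop_add_const_left _ c (hN.const_mul_atTop h)
    filter_upwards [h1.eventually_ge_atTop 1] with N hN
    rw [min_eq_left hN, max_eq_right zero_le_one]

lemma tendsto_integral_trapezoid {E : Type*} [MeasurableSpace E] {ν : Measure E}
    [IsFiniteMeasure ν] {f V : E → ℝ} (hf : Measurable f) (hf1 : ∀ w, |f w| ≤ 1)
    (hV : Measurable V) {s t : ℝ} (hs : ∀ᵐ w ∂ν, V w ≠ s) (ht : ∀ᵐ w ∂ν, V w ≠ t) (c : ℝ) :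
    Tendsto (fun N => ∫ w, f w * trapezoid s t c N (V w) ∂ν) atTop
      (𝓝 (∫ w, f w * windowInd s t (V w) ∂ν)) := by
  refine tendsto_integral_of_dominated_convergence (fun _ => 1)
    (fun N => (hf.mul ((continuous_trapezoid s t c N).measurable.comp hV)).aestronglyMeasurable)
    (integrable_const _) (fun N => Eventually.of_forall fun w => ?_) ?_
  · rw [norm_mul, Real.norm_eq_abs, Real.norm_eq_abs]
    exact mul_le_one₀ (hf1 w) (abs_nonneg _) (abs_trapezoid_le _ _ _ _ _)
  · filter_upwards [hs, ht] with w h1 h2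
    exact (tendsto_trapezoid s t c h1 h2).const_mul _

lemma tendsto_of_squeeze_approx {ι : Type*} {l : Filter ι} {F : ι → ℝ} {f g : ℕ → ι → ℝ}
    {a b : ℕ → ℝ} {E : ℝ} (hf : ∀ N x, f N x ≤ F x) (hg : ∀ N x, F x ≤ g N x)
    (hfa : ∀ N, Tendsto (f N) l (𝓝 (a N))) (hgb : ∀ N, Tendsto (g N) l (𝓝 (b N)))
    (ha : Tendsto a atTop (𝓝 E)) (hb : Tendsto b atTop (𝓝 E)) : Tendsto F l (𝓝 E) := by
  refine tendsto_order.2 ⟨fun c hc => ?_, fun c hc => ?_⟩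
  · obtain ⟨N, hN⟩ := (ha.eventually (lt_mem_nhds hc)).exists
    filter_upwards [(hfa N).eventually (lt_mem_nhds hN)] with x hx
    exact hx.trans_le (hf N x)
  · obtain ⟨N, hN⟩ := (hb.eventually (gt_mem_nhds hc)).exists
    filter_upwards [(hgb N).eventually (gt_mem_nhds hN)] with x hx
    exact (hg N x).trans_lt hx

/-- Convergence of Lipschitz statistics upgrades to windows with null boundary. -/
lemma tendsto_window_stat {E : Type*} [MeasurableSpace E] {ν : Measure E} [IsFiniteMeasure ν]
    {k : ℝ → ℝ} {U V : E → ℝ} (hk : Measurable k) (hk0 : ∀ x, 0 ≤ k x) (hk1 : ∀ x, k x ≤ 1)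
    (hU : Measurable U) (hV : Measurable V) {s t : ℝ}
    (hs : ∀ᵐ w ∂ν, V w ≠ s) (ht : ∀ᵐ w ∂ν, V w ≠ t)
    {ι : Type*} {l : Filter ι} {m : ι → ℕ} {u v : ∀ x, Fin (m x) → ℝ}
    (H : ∀ (χ : ℝ → ℝ) (K : ℝ), 0 < K → (∀ x, |χ x| ≤ 1) → Continuous χ →
      (∀ x y, |χ x - χ y| ≤ K * |x - y|) →
      Tendsto (fun x => (∑ i, k (u x i) * χ (v x i)) / m x) l (𝓝 (∫ w, k (U w) * χ (V w) ∂ν))) :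
    Tendsto (fun x => (∑ i, k (u x i) * windowInd s t (v x i)) / m x) l
      (𝓝 (∫ w, k (U w) * windowInd s t (V w) ∂ν)) := by
  have hk1' : ∀ x, |k x| ≤ 1 := fun x => by rw [abs_of_nonneg (hk0 x)]; exact hk1 x
  have hH : ∀ c (N : ℕ), Tendsto (fun x => (∑ i, k (u x i) * trapezoid s t c N (v x i)) / m x) l
      (𝓝 (∫ w, k (U w) * trapezoid s t c N (V w) ∂ν)) := fun c N =>
    H _ (N + 1) (by positivity) (abs_trapezoid_le s t c N) (continuous_trapezoid s t c N)
      (abs_trapezoid_sub_le s t c N)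
  refine tendsto_of_squeeze_approx (fun N x => ?_) (fun N x => ?_) (hH 0) (hH 1)
    (tendsto_integral_trapezoid (hk.comp hU) (fun w => hk1' _) hV hs ht 0)
    (tendsto_integral_trapezoid (hk.comp hU) (fun w => hk1' _) hV hs ht 1)
  · gcongr with i
    · exact hk0 _
    · exact trapezoid_zero_le _ _ _ _
  · gcongr with i
    · exact hk0 _
    · exact le_trapezoid_one _ _ _ _

end window

section density

lemma tendsto_integral_Icc_div {ι : Type*} {l : Filter ι} {g : ℝ → ℝ} {a : ℝ} {u : ι → ℝ}
    (hg : ContinuousAt g a) (hgm : Measurable g) (hu : Tendsto u l (𝓝 a)) (hlt : ∀ᶠ i in l, u i < a) :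
    Tendsto (fun i => (∫ x in Icc (u i) a, g x) / (a - u i)) l (𝓝 (g a)) := by
  have hs : Tendsto (fun i => Icc (u i) a) l (𝓝 a).smallSets := by
    have h := hu.Icc (tendsto_const_nhds (x := a) (f := l))
    exact h
  have h := hg.integral_sub_linear_isLittleO_ae (μ := volume)
    (hgm.stronglyMeasurable.aestronglyMeasurable.stronglyMeasurableAtFilter) hs
  have h1 := h.tendsto_div_nhds_zero
  have h2 := h1.add_const (g a)
  rw [zero_add] at h2
  refine h2.congr' ?_
  filter_upwards [hlt] with i hi
  have hpos : (0 : ℝ) < a - u i := sub_pos.2 hi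
  rw [Real.volume_real_Icc_of_le hi.le, smul_eq_mul]
  field_simp
  ring

lemma softThr_mem_Icc_iff {θ s t x : ℝ} (hθ : 0 < θ) (hs : 0 < s) :
    (s ≤ softThr θ x ∧ softThr θ x ≤ t) ↔ (s + θ ≤ x ∧ x ≤ t + θ) := by
  rw [softThr_eq_max_add_min hθ.le]
  constructor
  · rintro ⟨h1, h2⟩
    rcases le_total (x - θ) 0 with h | h
    · rw [max_eq_right h] at h1
      linarith [min_le_right (x + θ) 0]
    · rw [max_eq_left h, min_eq_right (by linarith)] at h1 h2
      constructor <;> linarith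
  · rintro ⟨h1, h2⟩
    rw [max_eq_left (by linarith), min_eq_right (by linarith)]
    constructor <;> linarith

end density

section mass

lemma isProbabilityMeasure_mixture {eps : ℝ} (heps : eps ∈ Ioo (0 : ℝ) 1) (Pi1 : Measure ℝ)
    [IsProbabilityMeasure Pi1] : IsProbabilityMeasure (mixture eps Pi1) := by
  constructor
  simp only [mixture, Measure.add_apply, Measure.smul_apply, smul_eq_mul, measure_univ, mul_one]
  rw [← ENNReal.ofReal_add (by linarith [heps.2]) heps.1.le]
  simp

lemma mixture_singleton_zero (eps : ℝ) {Pi1 : Measure ℝ} (h : Pi1 {0} = 0) :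
    mixture eps Pi1 {0} = ENNReal.ofReal (1 - eps) := by
  simp [mixture, h]

lemma stdPhi_eq_gaussianPDFReal (x : ℝ) : stdPhi x = gaussianPDFReal 0 1 x := by
  simp [stdPhi, gaussianPDFReal]

lemma gaussianReal_real_Icc (a b : ℝ) :
    (gaussianReal 0 1).real (Icc a b) = ∫ x in Icc a b, gaussianPDFReal 0 1 x := by
  rw [measureReal_def, gaussianReal_apply_eq_integral _ one_ne_zero, ENNReal.toReal_ofReal]
  exact setIntegral_nonneg measurableSet_Icc fun x _ => gaussianPDFReal_nonneg _ _ _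

lemma limitLaw_apply {eps : ℝ} {Pi1 : Measure ℝ} {α τ : ℝ} (hθ : 0 ≤ α * τ) {A : Set ℝ}
    (hA : MeasurableSet A) :
    limitLaw eps Pi1 α τ A = ((mixture eps Pi1).prod (gaussianReal 0 1))
      {w : ℝ × ℝ | softThr (α * τ) (w.1 + τ * w.2) ∈ A} := by
  have hc := continuous_softThr hθ
  rw [limitLaw, Measure.map_apply (by fun_prop) hA]
  rfl

/-- The null mass of a positive window of the thresholded variable. -/
lemma null_window_mass {eps : ℝ} (heps : eps ∈ Ioo (0 : ℝ) 1) {Pi1 : Measure ℝ}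
    [IsProbabilityMeasure Pi1] (h0 : Pi1 {0} = 0) {θ τ s t : ℝ} (hθ : 0 < θ) (hτ : 0 < τ)
    (hs : 0 < s) :
    (((mixture eps Pi1).prod (gaussianReal 0 1)) {w : ℝ × ℝ |
      (s ≤ softThr θ (w.1 + τ * w.2) ∧ softThr θ (w.1 + τ * w.2) ≤ t) ∧ w.1 = 0}).toReal
      = (1 - eps) * ∫ x in Icc ((s + θ) / τ) ((t + θ) / τ), gaussianPDFReal 0 1 x := by
  have hset : {w : ℝ × ℝ |
      (s ≤ softThr θ (w.1 + τ * w.2) ∧ softThr θ (w.1 + τ * w.2) ≤ t) ∧ w.1 = 0}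
      = {0} ×ˢ Icc ((s + θ) / τ) ((t + θ) / τ) := by
    ext ⟨x, z⟩
    simp only [Set.mem_ofPred_eq, Set.mem_prod, Set.mem_singleton_iff, Set.mem_Icc,
      softThr_mem_Icc_iff hθ hs, div_le_iff₀ hτ, le_div_iff₀ hτ]
    constructor
    · rintro ⟨h, rfl⟩
      exact ⟨rfl, by linarith [h.1], by linarith [h.2]⟩
    · rintro ⟨rfl, h⟩
      exact ⟨⟨by linarith [h.1], by linarith [h.2]⟩, rfl⟩
  rw [hset, Measure.prod_prod, mixture_singleton_zero eps h0, ENNReal.toReal_mul,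
    ENNReal.toReal_ofReal (by linarith [heps.2]), ← gaussianReal_real_Icc, measureReal_def]

lemma eventually_Ioo_lt {t : ℝ} (ht : 0 < t) : ∀ᶠ s' in 𝓝[<] t, 0 < s' ∧ s' < t := by
  filter_upwards [Ioo_mem_nhdsLT ht] with s' hs'
  exact hs'

lemma tendsto_null_window_mass_div {eps : ℝ} (heps : eps ∈ Ioo (0 : ℝ) 1) {Pi1 : Measure ℝ}
    [IsProbabilityMeasure Pi1] (h0 : Pi1 {0} = 0) {α τ t : ℝ} (hθ : 0 < α * τ) (hτ : 0 < τ)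
    (ht : 0 < t) :
    Tendsto (fun s' : ℝ => (((mixture eps Pi1).prod (gaussianReal 0 1)) {w : ℝ × ℝ |
      (s' ≤ softThr (α * τ) (w.1 + τ * w.2) ∧ softThr (α * τ) (w.1 + τ * w.2) ≤ t) ∧
        w.1 = 0}).toReal / (t - s')) (𝓝[<] t) (𝓝 ((1 - eps) * q0fun α τ t)) := by
  have hu : Tendsto (fun s' : ℝ => (s' + α * τ) / τ) (𝓝[<] t) (𝓝 ((t + α * τ) / τ)) :=
    (((continuous_id.add continuous_const).div_const τ).tendsto t).mono_left nhdsWithin_le_nhds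
  have hlt : ∀ᶠ s' in 𝓝[<] t, (s' + α * τ) / τ < (t + α * τ) / τ := by
    filter_upwards [self_mem_nhdsWithin] with s' (hs' : s' < t)
    gcongr
  have hcont : Continuous (gaussianPDFReal 0 1) := by
    unfold gaussianPDFReal
    fun_prop
  have h1 := (tendsto_integral_Icc_div hcont.continuousAt (measurable_gaussianPDFReal 0 1) hu
    hlt).const_mul ((1 - eps) * τ⁻¹)
  have h2 : (1 - eps) * q0fun α τ t
      = (1 - eps) * τ⁻¹ * gaussianPDFReal 0 1 ((t + α * τ) / τ) := by
    rw [q0fun, Real.sign_of_pos ht, mul_one, stdPhi_eq_gaussianPDFReal, mul_assoc]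
  rw [h2]
  refine h1.congr' ?_
  filter_upwards [eventually_Ioo_lt ht] with s' hs'
  rw [null_window_mass heps h0 hθ hτ hs'.1]
  have : t - s' ≠ 0 := (sub_pos.2 hs'.2).ne'
  have h3 : (t + α * τ) / τ - (s' + α * τ) / τ = (t - s') / τ := by ring
  rw [h3]
  field_simp

variable {eps : ℝ} {Pi1 : Measure ℝ} {α τ : ℝ} {q : ℝ → ℝ}

lemma window_mass (hθ : 0 ≤ α * τ) (hqnn : ∀ x, 0 ≤ q x)
    (hqdens : ∀ A : Set ℝ, MeasurableSet A → (0 : ℝ) ∉ A →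
      limitLaw eps Pi1 α τ A = ENNReal.ofReal (∫ x in A, q x)) {s t : ℝ} (hs : 0 < s) :
    (((mixture eps Pi1).prod (gaussianReal 0 1)) {w : ℝ × ℝ |
      s ≤ softThr (α * τ) (w.1 + τ * w.2) ∧ softThr (α * τ) (w.1 + τ * w.2) ≤ t}).toReal
      = ∫ x in Icc s t, q x := by
  have h := hqdens (Icc s t) measurableSet_Icc fun h => absurd h.1 (not_le.2 hs)
  rw [limitLaw_apply hθ measurableSet_Icc] at h
  have h' := congrArg ENNReal.toReal h
  rw [ENNReal.toReal_ofReal (setIntegral_nonneg measurableSet_Icc fun x _ => hqnn x)] at h'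
  exact h'

lemma ae_softThr_ne (hθ : 0 ≤ α * τ)
    (hqdens : ∀ A : Set ℝ, MeasurableSet A → (0 : ℝ) ∉ A →
      limitLaw eps Pi1 α τ A = ENNReal.ofReal (∫ x in A, q x)) {x : ℝ} (hx : 0 < x) :
    ∀ᵐ w ∂(mixture eps Pi1).prod (gaussianReal 0 1),
      softThr (α * τ) (w.1 + τ * w.2) ≠ x := by
  have h := hqdens {x} (measurableSet_singleton x) fun h => hx.ne (Set.mem_singleton_iff.1 h)
  rw [limitLaw_apply hθ (measurableSet_singleton x), Measure.restrict_singleton] at h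
  rw [ae_iff]
  simpa using h

lemma tendsto_window_mass_div (hθ : 0 ≤ α * τ) (hqm : Measurable q) (hqnn : ∀ x, 0 ≤ q x)
    (hqdens : ∀ A : Set ℝ, MeasurableSet A → (0 : ℝ) ∉ A →
      limitLaw eps Pi1 α τ A = ENNReal.ofReal (∫ x in A, q x)) {t : ℝ} (ht : 0 < t)
    (hqt : ContinuousAt q t) :
    Tendsto (fun s' : ℝ => (((mixture eps Pi1).prod (gaussianReal 0 1)) {w : ℝ × ℝ |
      s' ≤ softThr (α * τ) (w.1 + τ * w.2) ∧ softThr (α * τ) (w.1 + τ * w.2) ≤ t}).toReal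
        / (t - s')) (𝓝[<] t) (𝓝 (q t)) := by
  have h1 := tendsto_integral_Icc_div (l := 𝓝[<] t) (u := fun s' => s') hqt hqm
    (tendsto_id.mono_left nhdsWithin_le_nhds) (by
      filter_upwards [self_mem_nhdsWithin] with s' (hs' : s' < t)
      exact hs')
  refine h1.congr' ?_
  filter_upwards [eventually_Ioo_lt ht] with s' hs'
  rw [window_mass hθ hqnn hqdens hs'.1]

lemma window_mass_pos [IsFiniteMeasure Pi1] (hθ : 0 ≤ α * τ) (hqm : Measurable q)
    (hqnn : ∀ x, 0 ≤ q x)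
    (hqdens : ∀ A : Set ℝ, MeasurableSet A → (0 : ℝ) ∉ A →
      limitLaw eps Pi1 α τ A = ENNReal.ofReal (∫ x in A, q x)) {s t : ℝ} (hs : 0 < s) (hst : s < t)
    (hqt : ContinuousAt q t) (hqt0 : 0 < q t) :
    0 < (((mixture eps Pi1).prod (gaussianReal 0 1)) {w : ℝ × ℝ |
      s ≤ softThr (α * τ) (w.1 + τ * w.2) ∧ softThr (α * τ) (w.1 + τ * w.2) ≤ t}).toReal := by
  have ht := hs.trans hst
  have h1 := (tendsto_window_mass_div hθ hqm hqnn hqdens ht hqt).eventually (lt_mem_nhds hqt0)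
  obtain ⟨s', h2, h3⟩ := (h1.and (Ioo_mem_nhdsLT hst)).exists
  have h4 := (div_pos_iff_of_pos_right (sub_pos.2 h3.2)).1 h2
  refine h4.trans_le (ENNReal.toReal_mono (measure_ne_top _ _) (measure_mono ?_))
  exact fun w hw => ⟨h3.1.le.trans hw.1, hw.2⟩

end mass

section conclusion

lemma tendstoInMeasure_of_tendsto_whp {Ω : Type*} [MeasurableSpace Ω] {P : Measure Ω}
    {f : ℕ → Ω → ℝ} {a : ℝ}
    (h : Tendsto (fun x : Σ _ : ℕ, Ω => f x.1 x.2) (whp fun _ => P) (𝓝 a)) :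
    TendstoInMeasure P f atTop fun _ => a := by
  rw [tendstoInMeasure_iff_norm]
  intro ε hε
  refine (eventually_whp_iff.1 (Metric.tendsto_nhds.1 h ε hε)).congr fun p => ?_
  simp only [Real.dist_eq, Real.norm_eq_abs, not_lt]

lemma card_window_eq_sum {m : ℕ} (u : Fin m → ℝ) (s t : ℝ) :
    ((Finset.univ.filter fun i : Fin m => s ≤ u i ∧ u i ≤ t).card : ℝ)
      = ∑ i, 1 * windowInd s t (u i) := by
  simp only [windowInd, one_mul, Finset.sum_boole]

lemma card_null_window_eq_sum {m : ℕ} (u v : Fin m → ℝ) (s t : ℝ) :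
    ((Finset.univ.filter fun i : Fin m => (s ≤ u i ∧ u i ≤ t) ∧ v i = 0).card : ℝ)
      = ∑ i, (if v i = 0 then 1 else 0) * windowInd s t (u i) := by
  have : ∀ i, (if v i = 0 then 1 else 0) * windowInd s t (u i)
      = if (s ≤ u i ∧ u i ≤ t) ∧ v i = 0 then 1 else 0 := fun i => by
    unfold windowInd
    by_cases h1 : v i = 0 <;> by_cases h2 : s ≤ u i ∧ u i ≤ t <;> simp [h1, h2]
  simp only [this, Finset.sum_boole]

lemma integral_windowInd {E : Type*} [MeasurableSpace E] {ν : Measure E} {V : E → ℝ}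
    (hV : Measurable V) (s t : ℝ) :
    ∫ w, 1 * windowInd s t (V w) ∂ν = (ν {w | s ≤ V w ∧ V w ≤ t}).toReal := by
  have hm : MeasurableSet {w | s ≤ V w ∧ V w ≤ t} := hV measurableSet_Icc
  have : (fun w => 1 * windowInd s t (V w)) = {w | s ≤ V w ∧ V w ≤ t}.indicator 1 := by
    ext w
    simp [windowInd, Set.indicator_apply]
  rw [this, integral_indicator_one hm, measureReal_def]

lemma integral_null_windowInd {E : Type*} [MeasurableSpace E] {ν : Measure E} {U V : E → ℝ}
    (hU : Measurable U) (hV : Measurable V) (s t : ℝ) :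
    ∫ w, (if U w = 0 then 1 else 0) * windowInd s t (V w) ∂ν
      = (ν {w | (s ≤ V w ∧ V w ≤ t) ∧ U w = 0}).toReal := by
  have hm : MeasurableSet {w | (s ≤ V w ∧ V w ≤ t) ∧ U w = 0} :=
    MeasurableSet.inter (hV measurableSet_Icc) (hU (measurableSet_singleton 0))
  have : (fun w => (if U w = 0 then 1 else 0) * windowInd s t (V w))
      = {w | (s ≤ V w ∧ V w ≤ t) ∧ U w = 0}.indicator 1 := by
    ext w
    by_cases h1 : U w = 0 <;> by_cases h2 : s ≤ V w ∧ V w ≤ t <;>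
      simp [windowInd, h1, h2]
  rw [this, integral_indicator_one hm, measureReal_def]

end conclusion

/-- **Within-window FDP and the local fdr (Section 6).** Under the AMP setup, for
fixed `0 < s < t` the fraction of nulls among coordinates whose Lasso estimate
falls in `[s, t]` converges in probability to `P(Π = 0 | s ≤ η_{ατ}(Π+τZ) ≤ t)`;
moreover, if `q₀` and `q` are continuous at `t` with `q(t) > 0`, this limit
converges, as `s → t⁻`, to `lfdr(t) = (1-ε)q₀(t)/q(t)`. -/
theorem window_fdp_limit_and_lfdr
    {Ω : Type*} [MeasurableSpace Ω] (P : Measure Ω) [IsProbabilityMeasure P]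
    -- model constants
    (δ σ lam eps : ℝ) (hδ : 0 < δ) (hσ : 0 < σ) (hlam : 0 < lam)
    (heps : eps ∈ Set.Ioo (0 : ℝ) 1)
    -- the nonzero prior component Π₁
    (Pi1 : Measure ℝ) [IsProbabilityMeasure Pi1] (hPi1zero : Pi1 {0} = 0)
    (hmom : Integrable (fun x => x ^ 2) (mixture eps Pi1))
    -- sample sizes with n/p → δ
    (n : ℕ → ℕ) (hn : Tendsto (fun p => (n p : ℝ) / p) atTop (nhds δ))
    -- design matrix, coefficients, noise
    (X : (p : ℕ) → Ω → Fin (n p) → Fin p → ℝ)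
    (β : (p : ℕ) → Ω → Fin p → ℝ)
    (ζ : (p : ℕ) → Ω → Fin (n p) → ℝ)
    (hXmeas : ∀ p, Measurable (X p)) (hβmeas : ∀ p, Measurable (β p))
    (hζmeas : ∀ p, Measurable (ζ p))
    -- X has i.i.d. N(0, 1/n) entries
    (hXlaw : ∀ p, Measure.map (X p) P =
      Measure.pi fun _ : Fin (n p) => Measure.pi fun _ : Fin p =>
        gaussianReal 0 (Real.toNNReal (1 / (n p : ℝ))))
    -- β has i.i.d. coordinates distributed as Π = (1-ε)δ₀ + εΠ₁
    (hβlaw : ∀ p, Measure.map (β p) P = Measure.pi fun _ : Fin p => mixture eps Pi1)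
    -- the noise is N(0, σ²I)
    (hζlaw : ∀ p, Measure.map (ζ p) P =
      Measure.pi fun _ : Fin (n p) => gaussianReal 0 (Real.toNNReal (σ ^ 2)))
    -- X, β, ζ are mutually independent
    (hindep : ∀ p, Measure.map (fun ω => (X p ω, β p ω, ζ p ω)) P =
      (Measure.map (X p) P).prod ((Measure.map (β p) P).prod (Measure.map (ζ p) P)))
    -- the Lasso estimator at regularization λ, with response Y = Xβ + ζ
    (βhat : (p : ℕ) → Ω → Fin p → ℝ) (hβhatmeas : ∀ p, Measurable (βhat p))
    (hlasso : ∀ p ω (b : Fin p → ℝ),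
      (1 / 2) * (∑ i, (((∑ j, X p ω i j * β p ω j) + ζ p ω i)
            - ∑ j, X p ω i j * βhat p ω j) ^ 2)
          + lam * ∑ j, |βhat p ω j|
        ≤ (1 / 2) * (∑ i, (((∑ j, X p ω i j * β p ω j) + ζ p ω i)
            - ∑ j, X p ω i j * b j) ^ 2)
          + lam * ∑ j, |b j|)
    -- the AMP state-evolution parameters (α, τ)
    (α τ αmin : ℝ) (hτ : 0 < τ) (hαmin0 : 0 ≤ αmin)
    (hαmineq : (αmin ^ 2 + 1) * stdPhiCDF (-αmin) - αmin * stdPhi αmin = δ / 2)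
    (hα : αmin < α)
    (hfix1 : τ ^ 2 = σ ^ 2 + δ⁻¹ *
      ∫ w : ℝ × ℝ, (softThr (α * τ) (w.1 + τ * w.2) - w.1) ^ 2
        ∂((mixture eps Pi1).prod (gaussianReal 0 1)))
    (hfix2 : lam = α * τ * (1 - δ⁻¹ *
      (((mixture eps Pi1).prod (gaussianReal 0 1))
        {w : ℝ × ℝ | α * τ < |w.1 + τ * w.2|}).toReal))
    -- q : the (unnormalized) density of the nonzero part of the limiting law
    (q : ℝ → ℝ) (hqmeas : Measurable q) (hqnn : ∀ x, 0 ≤ q x)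
    (hqdens : ∀ A : Set ℝ, MeasurableSet A → (0 : ℝ) ∉ A →
      limitLaw eps Pi1 α τ A = ENNReal.ofReal (∫ x in A, q x))
    -- a fixed window [s, t]
    (s t : ℝ) (hs : 0 < s) (hst : s < t)
    (hq0cont : ContinuousAt (fun x => q0fun α τ x) t)
    (hqcont : ContinuousAt q t) (hqt : 0 < q t) :
    TendstoInMeasure P
      (fun (p : ℕ) ω =>
        ((Finset.univ.filter fun i : Fin p =>
          (s ≤ βhat p ω i ∧ βhat p ω i ≤ t) ∧ β p ω i = 0).card : ℝ) /
        ((Finset.univ.filter fun i : Fin p =>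
          s ≤ βhat p ω i ∧ βhat p ω i ≤ t).card : ℝ))
      atTop
      (fun _ =>
        (((mixture eps Pi1).prod (gaussianReal 0 1)) {w : ℝ × ℝ | (s ≤ softThr (α * τ) (w.1 + τ * w.2) ∧ softThr (α * τ) (w.1 + τ * w.2) ≤ t) ∧ w.1 = 0}).toReal /
        (((mixture eps Pi1).prod (gaussianReal 0 1)) {w : ℝ × ℝ | s ≤ softThr (α * τ) (w.1 + τ * w.2) ∧ softThr (α * τ) (w.1 + τ * w.2) ≤ t}).toReal)
    ∧
    Tendsto (fun s' : ℝ =>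
        (((mixture eps Pi1).prod (gaussianReal 0 1)) {w : ℝ × ℝ | (s' ≤ softThr (α * τ) (w.1 + τ * w.2) ∧ softThr (α * τ) (w.1 + τ * w.2) ≤ t) ∧ w.1 = 0}).toReal /
        (((mixture eps Pi1).prod (gaussianReal 0 1)) {w : ℝ × ℝ | s' ≤ softThr (α * τ) (w.1 + τ * w.2) ∧ softThr (α * τ) (w.1 + τ * w.2) ≤ t}).toReal)
      (nhdsWithin t (Set.Iio t)) (nhds ((1 - eps) * q0fun α τ t / q t)) := by
  have hprob := isProbabilityMeasure_mixture heps Pi1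
  have hα0 : 0 < α := hαmin0.trans_lt hα
  have hθ : 0 < α * τ := mul_pos hα0 hτ
  have ht : 0 < t := hs.trans hst
  constructor
  swap
  · have h1 := (tendsto_null_window_mass_div heps hPi1zero hθ hτ ht).div
      (tendsto_window_mass_div hθ.le hqmeas hqnn hqdens ht hqcont) hqt.ne'
    refine h1.congr' ?_
    filter_upwards [eventually_Ioo_lt ht] with s' hs'
    exact div_div_div_cancel_right₀ (sub_pos.2 hs'.2).ne' _ _
  have hκ : lam / α = τ * (1 - δ⁻¹ * ((mixture eps Pi1).prod (gaussianReal 0 1)).real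
      {w : ℝ × ℝ | α * τ < |w.1 + τ * w.2|}) := by
    rw [div_eq_iff hα0.ne', measureReal_def]
    linarith
  have hlamκ : lam * τ = lam / α * (α * τ) := by field_simp
  have hfix : τ ^ 2 = σ ^ 2 + δ⁻¹ *
      ∫ w, sErr (α * τ) τ w ^ 2 ∂(mixture eps Pi1).prod (gaussianReal 0 1) := hfix1
  have hT := fun p => measurePreserving_coreOf hσ (hXmeas p) (hβmeas p) (hζmeas p) (hXlaw p)
    (hβlaw p) (hζlaw p) (hindep p)
  have hc := continuous_softThr hθ.le
  have hV : Measurable fun w : ℝ × ℝ => softThr (α * τ) (w.1 + τ * w.2) := by fun_prop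
  have hVs := ae_softThr_ne hθ.le hqdens hs
  have hVt := ae_softThr_ne hθ.le hqdens ht
  have hstat : ∀ k : ℝ → ℝ, Measurable k → (∀ x, 0 ≤ k x) → (∀ x, k x ≤ 1) →
      Tendsto (fun x : Σ _ : ℕ, Ω =>
        (∑ i, k (β x.1 x.2 i) * windowInd s t (βhat x.1 x.2 i)) / (x.1 : ℝ)) (whp fun _ => P)
        (𝓝 (∫ w, k w.1 * windowInd s t (softThr (α * τ) (w.1 + τ * w.2))
          ∂(mixture eps Pi1).prod (gaussianReal 0 1))) := by
    intro k hk hk0 hk1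
    refine tendsto_window_stat (U := Prod.fst) (m := fun x : Σ _ : ℕ, Ω => x.1)
      (u := fun x => β x.1 x.2) (v := fun x => βhat x.1 x.2) hk hk0 hk1 measurable_fst hV hVs hVt
      fun χ K hK hχ1 hχc hχ => ?_
    exact tendsto_whp_lasso_stat hmom hδ hn hσ hlam hθ.le hτ (div_pos hlam hα0) hlamκ hfix hκ hT
      hlasso hk (fun x => abs_le.2 ⟨by linarith [hk0 x], hk1 x⟩) hχ1 hK hχ hχc
  have hden := hstat (fun _ => 1) measurable_const (fun _ => zero_le_one) fun _ => le_rfl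
  have hnum := hstat (fun x => if x = 0 then 1 else 0)
    (Measurable.ite (measurableSet_singleton 0) measurable_const measurable_const)
    (fun x => by split_ifs <;> simp) fun x => by split_ifs <;> simp
  rw [integral_windowInd hV] at hden
  rw [integral_null_windowInd measurable_fst hV] at hnum
  have hpos := window_mass_pos hθ.le hqmeas hqnn hqdens hs hst hqcont hqt
  refine tendstoInMeasure_of_tendsto_whp ((hnum.div hden hpos.ne').congr' ?_)
  filter_upwards [(tendsto_fst_whp fun _ : ℕ => P).eventually (eventually_gt_atTop 0)] with x hx
  rw [Pi.div_apply, div_div_div_cancel_right₀ (by exact_mod_cast hx.ne'), card_window_eq_sum,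
    card_null_window_eq_sum]
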